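/- Suppose |1−χ| = O(ε), Re < Re₀ and ε < ε₁ (the thresholds from the basic energy estimate). Then for all t ∈ [0,T]: (i) ∫₀ᵗ‖∂tφ(s)‖²_{L²}ds ≤ C∫₀ᵗ(‖ψ(s)‖²_{H¹} + ‖∂₁φ(s)‖²_{L²})ds; and (ii) A₁(t) ≤ C A₁(0) + C ε⁻²A₀(0) + C ε⁻²∫₀ᵗ‖∂₁φ(s)‖²_{L²}ds, where C depends only on Re, Pr, μ′/μ and γ. -/

import Mathlib

noncomputable section

open MeasureTheory Real Filter Topology

namespace Couette

/-- The periodic cell of the horizontally periodic layer `Ω = 𝕊¹ × (0,1)`. -/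
def Ω : Set (ℝ × ℝ) := {x : ℝ × ℝ | x.1 ∈ Set.Ioo 0 (2 * π) ∧ x.2 ∈ Set.Ioo 0 1}

variable {F : Type*} [NormedAddCommGroup F] [NormedSpace ℝ F]

/-- Partial derivative in the horizontal direction `x₁`. -/
def d1 (f : ℝ × ℝ → F) (x : ℝ × ℝ) : F := fderiv ℝ f x (1, 0)

/-- Partial derivative in the vertical direction `x₂`. -/
def d2 (f : ℝ × ℝ → F) (x : ℝ × ℝ) : F := fderiv ℝ f x (0, 1)

/-- Time derivative of a time-dependent field. -/
def dt (f : ℝ → ℝ × ℝ → F) (t : ℝ) (x : ℝ × ℝ) : F := deriv (fun s => f s x) t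

/-- Divergence of a (two-dimensional) vector field. -/
def divv (v : ℝ × ℝ → ℝ × ℝ) (x : ℝ × ℝ) : ℝ :=
  d1 (fun y => (v y).1) x + d2 (fun y => (v y).2) x

/-- Gradient of a scalar field. -/
def grad (f : ℝ × ℝ → ℝ) (x : ℝ × ℝ) : ℝ × ℝ := (d1 f x, d2 f x)

/-- Laplacian. -/
def lap (f : ℝ × ℝ → F) (x : ℝ × ℝ) : F := d1 (d1 f) x + d2 (d2 f) x

/-- Euclidean inner product on `ℝ²`. -/
def dot (a b : ℝ × ℝ) : ℝ := a.1 * b.1 + a.2 * b.2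

/-- The contraction `𝔇(v) : 𝔇(w)` of deformation tensors, where
`𝔇(v) = (∇v + (∇v)ᵀ)/2`. -/
def defContract (v w : ℝ × ℝ → ℝ × ℝ) (x : ℝ × ℝ) : ℝ :=
  d1 (fun y => (v y).1) x * d1 (fun y => (w y).1) x
    + d2 (fun y => (v y).2) x * d2 (fun y => (w y).2) x
    + 2 * ((d1 (fun y => (v y).2) x + d2 (fun y => (v y).1) x) / 2)
        * ((d1 (fun y => (w y).2) x + d2 (fun y => (w y).1) x) / 2)

/-- Squared `L²(Ω)` norm of the `j`-th spatial derivative. -/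
def dSq (j : ℕ) (f : ℝ × ℝ → F) : ℝ := ∫ x in Ω, ‖iteratedFDeriv ℝ j f x‖ ^ 2

/-- Squared `L²(Ω)` norm. -/
def L2Sq (f : ℝ × ℝ → F) : ℝ := dSq 0 f

/-- Squared `Hᵏ(Ω)` norm. -/
def HSq (k : ℕ) (f : ℝ × ℝ → F) : ℝ := ∑ j ∈ Finset.range (k + 1), dSq j f

/-- `L∞(Ω)` (sup) norm. -/
def LinfSup (f : ℝ × ℝ → F) : ℝ := ⨆ x ∈ Ω, ‖f x‖

/-- Membership in the Sobolev space `Hᵏ(Ω)`. -/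
def MemH (k : ℕ) (f : ℝ × ℝ → F) : Prop :=
  ∀ j ≤ k, IntegrableOn (fun x => ‖iteratedFDeriv ℝ j f x‖ ^ 2) Ω

/-- Continuity in time, with values in `Hᵏ(Ω)`, on the time set `s`. -/
def ContInH (k : ℕ) (f : ℝ → ℝ × ℝ → F) (s : Set ℝ) : Prop :=
  (∀ t ∈ s, MemH k (f t)) ∧
    ∀ t₀ ∈ s, Tendsto (fun t => HSq k (fun x => f t x - f t₀ x)) (nhdsWithin t₀ s) (nhds 0)

/-- Square integrability in time, with values in `Hᵏ(Ω)`, on the time set `s`. -/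
def L2InH (k : ℕ) (f : ℝ → ℝ × ℝ → F) (s : Set ℝ) : Prop :=
  IntegrableOn (fun t => HSq k (f t)) s

/-- Temperature `𝒯̃` of the non-dimensional plane Couette flow
(here `C_p = γ/(γ-1)`, the gas constant being normalized to `R = 1`). -/
def tT (γ Pr ε χ : ℝ) (x : ℝ × ℝ) : ℝ :=
  χ + (1 - χ) * x.2 - ε ^ 2 * Pr / (2 * (γ / (γ - 1))) * (x.2 ^ 2 - x.2)

/-- Density `ρ̃ = 𝒯̃⁻¹` of the plane Couette flow. -/
def tρ (γ Pr ε χ : ℝ) (x : ℝ × ℝ) : ℝ := (tT γ Pr ε χ x)⁻¹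

/-- Velocity `ũ = (x₂, 0)` of the plane Couette flow. -/
def tu (x : ℝ × ℝ) : ℝ × ℝ := (x.2, 0)

/-- Total density `ρ = ρ̃ + φ`. -/
def pρ (γ Pr ε χ : ℝ) (φ : ℝ → ℝ × ℝ → ℝ) (t : ℝ) (x : ℝ × ℝ) : ℝ := tρ γ Pr ε χ x + φ t x

/-- Total temperature `𝒯 = 𝒯̃ + θ`. -/
def pT (γ Pr ε χ : ℝ) (θ : ℝ → ℝ × ℝ → ℝ) (t : ℝ) (x : ℝ × ℝ) : ℝ := tT γ Pr ε χ x + θ t x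

/-- Total velocity `u = ũ + ψ`. -/
def pu (ψ : ℝ → ℝ × ℝ → ℝ × ℝ) (t : ℝ) (x : ℝ × ℝ) : ℝ × ℝ := tu x + ψ t x

/-- A classical solution `(φ, ψ, θ) = (ρ - ρ̃, u - ũ, 𝒯 - 𝒯̃)` of the perturbation
system around the plane Couette flow on `Ω × [0,T]`, with non-slip and isothermal
boundary conditions and periodicity in `x₁`.  Here `μ = 1/Re`, `μ' = r·μ`
(`r = μ'/μ = ν'/ν`), and `κ = C_p/(Re·Pr)` with `C_p = γ/(γ-1)`. -/
structure PerturbSol (γ Pr r Re ε χ T : ℝ) where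
  φ : ℝ → ℝ × ℝ → ℝ
  ψ : ℝ → ℝ × ℝ → ℝ × ℝ
  θ : ℝ → ℝ × ℝ → ℝ
  mass_eq : ∀ t ∈ Set.Icc (0 : ℝ) T, ∀ x ∈ Ω,
    dt φ t x + dot (pu ψ t x) (grad (φ t) x) + pρ γ Pr ε χ φ t x * divv (ψ t) x
      + dot (ψ t x) (grad (tρ γ Pr ε χ) x) = 0
  mom_eq1 : ∀ t ∈ Set.Icc (0 : ℝ) T, ∀ x ∈ Ω,
    pρ γ Pr ε χ φ t x * ((dt ψ t x).1 + dot (pu ψ t x) (grad (fun y => (ψ t y).1) x)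
        + dot (ψ t x) (grad (fun y => (tu y).1) x))
      + (ε ^ 2)⁻¹ * d1 (fun y => pρ γ Pr ε χ φ t y * pT γ Pr ε χ θ t y) x
      - Re⁻¹ * lap (fun y => (ψ t y).1) x
      - (Re⁻¹ + r * Re⁻¹) * d1 (divv (ψ t)) x = 0
  mom_eq2 : ∀ t ∈ Set.Icc (0 : ℝ) T, ∀ x ∈ Ω,
    pρ γ Pr ε χ φ t x * ((dt ψ t x).2 + dot (pu ψ t x) (grad (fun y => (ψ t y).2) x)
        + dot (ψ t x) (grad (fun y => (tu y).2) x))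
      + (ε ^ 2)⁻¹ * d2 (fun y => pρ γ Pr ε χ φ t y * pT γ Pr ε χ θ t y) x
      - Re⁻¹ * lap (fun y => (ψ t y).2) x
      - (Re⁻¹ + r * Re⁻¹) * d2 (divv (ψ t)) x = 0
  energy_eq : ∀ t ∈ Set.Icc (0 : ℝ) T, ∀ x ∈ Ω,
    pρ γ Pr ε χ φ t x / (γ - 1) * (dt θ t x + dot (pu ψ t x) (grad (θ t) x)
        + dot (ψ t x) (grad (tT γ Pr ε χ) x))
      + pρ γ Pr ε χ φ t x * pT γ Pr ε χ θ t x * divv (ψ t) x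
      - γ / (γ - 1) / (Re * Pr) * lap (θ t) x
      = ε ^ 2 * (2 * Re⁻¹ * defContract (ψ t) (ψ t) x
          + 4 * Re⁻¹ * defContract tu (ψ t) x + r * Re⁻¹ * (divv (ψ t) x) ^ 2)
  bc_ψ : ∀ t ∈ Set.Icc (0 : ℝ) T, ∀ x : ℝ × ℝ, (x.2 = 0 ∨ x.2 = 1) → ψ t x = 0
  bc_θ : ∀ t ∈ Set.Icc (0 : ℝ) T, ∀ x : ℝ × ℝ, (x.2 = 0 ∨ x.2 = 1) → θ t x = 0
  periodic_φ : ∀ t x, φ t (x.1 + 2 * π, x.2) = φ t x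
  periodic_ψ : ∀ t x, ψ t (x.1 + 2 * π, x.2) = ψ t x
  periodic_θ : ∀ t x, θ t (x.1 + 2 * π, x.2) = θ t x

/-- Smoothness (in time and space) of a solution of the perturbation system. -/
def SmoothSol {γ Pr r Re ε χ T : ℝ} (S : PerturbSol γ Pr r Re ε χ T) : Prop :=
  ContDiff ℝ (⊤ : ℕ∞) (Function.uncurry S.φ) ∧ ContDiff ℝ (⊤ : ℕ∞) (Function.uncurry S.ψ) ∧
    ContDiff ℝ (⊤ : ℕ∞) (Function.uncurry S.θ)

/-- Standing hypotheses on a solution of the perturbation system: initial regularity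
`(φ₀, ψ₀, θ₀) ∈ H³`, zero average of the initial density perturbation, and the
compatibility conditions `∂tψ(0) = ∂tθ(0) = 0` on `∂Ω`. -/
def StdHyp {γ Pr r Re ε χ T : ℝ} (S : PerturbSol γ Pr r Re ε χ T) : Prop :=
  MemH 3 (S.φ 0) ∧ MemH 3 (S.ψ 0) ∧ MemH 3 (S.θ 0) ∧
    (∫ x in Ω, S.φ 0 x) = 0 ∧
    ∀ x : ℝ × ℝ, (x.2 = 0 ∨ x.2 = 1) → dt S.ψ 0 x = 0 ∧ dt S.θ 0 x = 0

/-- The energy functional `A₀`. -/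
def A0 (ε : ℝ) (φ : ℝ → ℝ × ℝ → ℝ) (ψ : ℝ → ℝ × ℝ → ℝ × ℝ) (θ : ℝ → ℝ × ℝ → ℝ)
    (t : ℝ) : ℝ :=
  (⨆ s ∈ Set.Icc (0 : ℝ) t,
      (L2Sq (ψ s) + (ε ^ 2)⁻¹ * L2Sq (φ s) + (ε ^ 2)⁻¹ * L2Sq (θ s)))
    + ∫ s in (0 : ℝ)..t, (HSq 1 (ψ s) + (ε ^ 2)⁻¹ * HSq 1 (θ s))

/-- The energy functional `A₁`. -/
def A1 (ε : ℝ) (φ : ℝ → ℝ × ℝ → ℝ) (ψ : ℝ → ℝ × ℝ → ℝ × ℝ) (θ : ℝ → ℝ × ℝ → ℝ)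
    (t : ℝ) : ℝ :=
  (⨆ s ∈ Set.Icc (0 : ℝ) t, (dSq 1 (ψ s) + (ε ^ 2)⁻¹ * dSq 1 (θ s)))
    + ∫ s in (0 : ℝ)..t, (L2Sq (dt ψ s) + (ε ^ 2)⁻¹ * L2Sq (dt θ s))

/-- The energy functional `A₂`. -/
def A2 (ε : ℝ) (φ : ℝ → ℝ × ℝ → ℝ) (ψ : ℝ → ℝ × ℝ → ℝ × ℝ) (θ : ℝ → ℝ × ℝ → ℝ)
    (t : ℝ) : ℝ :=
  (ε ^ 2)⁻¹ * (⨆ s ∈ Set.Icc (0 : ℝ) t, dSq 1 (φ s))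
    + (∫ s in (0 : ℝ)..t, ((ε ^ 4)⁻¹ * HSq 1 (φ s) + (ε ^ 2)⁻¹ * L2Sq (dt φ s)))
    + ∫ s in (0 : ℝ)..t, (HSq 2 (ψ s) + (ε ^ 2)⁻¹ * HSq 2 (θ s))

/-- The energy functional `A₃`. -/
def A3 (ε : ℝ) (φ : ℝ → ℝ × ℝ → ℝ) (ψ : ℝ → ℝ × ℝ → ℝ × ℝ) (θ : ℝ → ℝ × ℝ → ℝ)
    (t : ℝ) : ℝ :=
  (⨆ s ∈ Set.Icc (0 : ℝ) t,
      ((ε ^ 2)⁻¹ * L2Sq (dt φ s) + L2Sq (dt ψ s) + (ε ^ 2)⁻¹ * L2Sq (dt θ s)))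
    + ∫ s in (0 : ℝ)..t, (dSq 1 (dt ψ s) + (ε ^ 2)⁻¹ * dSq 1 (dt θ s))

/-- The energy functional `A₄`. -/
def A4 (ε : ℝ) (φ : ℝ → ℝ × ℝ → ℝ) (ψ : ℝ → ℝ × ℝ → ℝ × ℝ) (θ : ℝ → ℝ × ℝ → ℝ)
    (t : ℝ) : ℝ :=
  (⨆ s ∈ Set.Icc (0 : ℝ) t,
      ((ε ^ 2)⁻¹ * dSq 2 (φ s) + dSq 2 (ψ s) + (ε ^ 2)⁻¹ * dSq 2 (θ s)))
    + ∫ s in (0 : ℝ)..t, ((ε ^ 4)⁻¹ * HSq 2 (φ s) + HSq 3 (ψ s) + (ε ^ 2)⁻¹ * HSq 3 (θ s))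

/-- The energy functional `A₅`. -/
def A5 (ε : ℝ) (φ : ℝ → ℝ × ℝ → ℝ) (ψ : ℝ → ℝ × ℝ → ℝ × ℝ) (θ : ℝ → ℝ × ℝ → ℝ)
    (t : ℝ) : ℝ :=
  (⨆ s ∈ Set.Icc (0 : ℝ) t,
      ((ε ^ 2)⁻¹ * dSq 3 (φ s) + (dSq 3 (ψ s) + dSq 1 (dt ψ s))
        + (ε ^ 2)⁻¹ * (dSq 3 (θ s) + dSq 1 (dt θ s))))
    + ∫ s in (0 : ℝ)..t, (L2Sq (dt (dt ψ) s) + (ε ^ 2)⁻¹ * L2Sq (dt (dt θ) s))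

/-- The total weighted energy functional `N(t)`. -/
def Nfun (ε : ℝ) (φ : ℝ → ℝ × ℝ → ℝ) (ψ : ℝ → ℝ × ℝ → ℝ × ℝ) (θ : ℝ → ℝ × ℝ → ℝ)
    (t : ℝ) : ℝ :=
  (ε ^ 2)⁻¹ * A0 ε φ ψ θ t + A1 ε φ ψ θ t + A2 ε φ ψ θ t
    + ε ^ 2 * A3 ε φ ψ θ t + ε ^ 2 * A4 ε φ ψ θ t + ε ^ 4 * A5 ε φ ψ θ t

/-- The relative entropy
`η = (ε²ρ/𝒯̃)|ψ|² + (ρ/(γ-1))(𝒯/𝒯̃ - ln(𝒯/𝒯̃) - 1) + ρ(τ/τ̃ - ln(τ/τ̃) - 1)`,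
where `τ = 1/ρ`, `τ̃ = 1/ρ̃`. -/
def relEnt (γ Pr ε χ : ℝ) (φ θ : ℝ → ℝ × ℝ → ℝ) (ψ : ℝ → ℝ × ℝ → ℝ × ℝ)
    (t : ℝ) (x : ℝ × ℝ) : ℝ :=
  ε ^ 2 * pρ γ Pr ε χ φ t x / tT γ Pr ε χ x * ‖ψ t x‖ ^ 2
    + pρ γ Pr ε χ φ t x / (γ - 1) *
        (pT γ Pr ε χ θ t x / tT γ Pr ε χ x
          - Real.log (pT γ Pr ε χ θ t x / tT γ Pr ε χ x) - 1)
    + pρ γ Pr ε χ φ t x *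
        ((pρ γ Pr ε χ φ t x)⁻¹ / (tρ γ Pr ε χ x)⁻¹
          - Real.log ((pρ γ Pr ε χ φ t x)⁻¹ / (tρ γ Pr ε χ x)⁻¹) - 1)

/-- A classical solution `(ρ, u, 𝒯)` of the non-dimensional full compressible
Navier–Stokes system on `Ω × (0,∞)`, with non-slip and isothermal boundary
conditions and periodicity in `x₁`. -/
structure FullSol (γ Pr r Re ε χ : ℝ) where
  rho : ℝ → ℝ × ℝ → ℝ
  vel : ℝ → ℝ × ℝ → ℝ × ℝ
  temp : ℝ → ℝ × ℝ → ℝ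
  mass_eq : ∀ t ∈ Set.Ioi (0 : ℝ), ∀ x ∈ Ω,
    dt rho t x + divv (fun y => rho t y • vel t y) x = 0
  mom_eq1 : ∀ t ∈ Set.Ioi (0 : ℝ), ∀ x ∈ Ω,
    rho t x * ((dt vel t x).1 + dot (vel t x) (grad (fun y => (vel t y).1) x))
      + (ε ^ 2)⁻¹ * d1 (fun y => rho t y * temp t y) x
      = Re⁻¹ * lap (fun y => (vel t y).1) x + (Re⁻¹ + r * Re⁻¹) * d1 (divv (vel t)) x
  mom_eq2 : ∀ t ∈ Set.Ioi (0 : ℝ), ∀ x ∈ Ω,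
    rho t x * ((dt vel t x).2 + dot (vel t x) (grad (fun y => (vel t y).2) x))
      + (ε ^ 2)⁻¹ * d2 (fun y => rho t y * temp t y) x
      = Re⁻¹ * lap (fun y => (vel t y).2) x + (Re⁻¹ + r * Re⁻¹) * d2 (divv (vel t)) x
  energy_eq : ∀ t ∈ Set.Ioi (0 : ℝ), ∀ x ∈ Ω,
    rho t x / (γ - 1) * (dt temp t x + dot (vel t x) (grad (temp t) x))
      + rho t x * temp t x * divv (vel t) x
      = γ / (γ - 1) / (Re * Pr) * lap (temp t) x
        + ε ^ 2 * (2 * Re⁻¹ * defContract (vel t) (vel t) x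
            + r * Re⁻¹ * (divv (vel t) x) ^ 2)
  bc_top : ∀ t ∈ Set.Ioi (0 : ℝ), ∀ x : ℝ × ℝ, x.2 = 1 →
    vel t x = (1, 0) ∧ temp t x = 1
  bc_bot : ∀ t ∈ Set.Ioi (0 : ℝ), ∀ x : ℝ × ℝ, x.2 = 0 →
    vel t x = 0 ∧ temp t x = χ
  periodic_rho : ∀ t x, rho t (x.1 + 2 * π, x.2) = rho t x
  periodic_vel : ∀ t x, vel t (x.1 + 2 * π, x.2) = vel t x
  periodic_temp : ∀ t x, temp t (x.1 + 2 * π, x.2) = temp t x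

/-- `∂tφ(0)`, defined from the initial data by taking `t = 0` in the mass equation
of the perturbation system. -/
def dtφ0 (γ Pr ε χ : ℝ) (φ₀ : ℝ × ℝ → ℝ) (ψ₀ : ℝ × ℝ → ℝ × ℝ) (x : ℝ × ℝ) : ℝ :=
  -(dot (tu x + ψ₀ x) (grad φ₀ x) + (tρ γ Pr ε χ x + φ₀ x) * divv ψ₀ x
      + dot (ψ₀ x) (grad (tρ γ Pr ε χ) x))

/-- `∂tψ(0)`, defined from the initial data by taking `t = 0` in the momentum
equation of the perturbation system. -/
def dtψ0 (γ Pr r Re ε χ : ℝ) (φ₀ θ₀ : ℝ × ℝ → ℝ) (ψ₀ : ℝ × ℝ → ℝ × ℝ)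
    (x : ℝ × ℝ) : ℝ × ℝ :=
  ((tρ γ Pr ε χ x + φ₀ x)⁻¹ *
      (Re⁻¹ * lap (fun y => (ψ₀ y).1) x + (Re⁻¹ + r * Re⁻¹) * d1 (divv ψ₀) x
        - (ε ^ 2)⁻¹ * d1 (fun y => (tρ γ Pr ε χ y + φ₀ y) * (tT γ Pr ε χ y + θ₀ y)) x)
      - dot (tu x + ψ₀ x) (grad (fun y => (ψ₀ y).1) x)
      - dot (ψ₀ x) (grad (fun y => (tu y).1) x),
   (tρ γ Pr ε χ x + φ₀ x)⁻¹ *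
      (Re⁻¹ * lap (fun y => (ψ₀ y).2) x + (Re⁻¹ + r * Re⁻¹) * d2 (divv ψ₀) x
        - (ε ^ 2)⁻¹ * d2 (fun y => (tρ γ Pr ε χ y + φ₀ y) * (tT γ Pr ε χ y + θ₀ y)) x)
      - dot (tu x + ψ₀ x) (grad (fun y => (ψ₀ y).2) x)
      - dot (ψ₀ x) (grad (fun y => (tu y).2) x))

/-- `∂tθ(0)`, defined from the initial data by taking `t = 0` in the temperature
equation of the perturbation system. -/
def dtθ0 (γ Pr r Re ε χ : ℝ) (φ₀ θ₀ : ℝ × ℝ → ℝ) (ψ₀ : ℝ × ℝ → ℝ × ℝ)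
    (x : ℝ × ℝ) : ℝ :=
  (γ - 1) * (tρ γ Pr ε χ x + φ₀ x)⁻¹ *
      (γ / (γ - 1) / (Re * Pr) * lap θ₀ x
        - (tρ γ Pr ε χ x + φ₀ x) * (tT γ Pr ε χ x + θ₀ x) * divv ψ₀ x
        + ε ^ 2 * (2 * Re⁻¹ * defContract ψ₀ ψ₀ x + 4 * Re⁻¹ * defContract tu ψ₀ x
            + r * Re⁻¹ * (divv ψ₀ x) ^ 2))
    - dot (tu x + ψ₀ x) (grad θ₀ x) - dot (ψ₀ x) (grad (tT γ Pr ε χ) x)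


/-- Space-time. -/
abbrev E3 := ℝ × ℝ × ℝ

/-- The algebra of smooth functions on space-time. -/
def SA : Subalgebra ℝ (E3 → ℝ) where
  carrier := {f | ContDiff ℝ (⊤ : ℕ∞) f}
  mul_mem' := by
    intro a b ha hb
    exact ContDiff.mul (Set.mem_ofPred_eq ▸ ha) (Set.mem_ofPred_eq ▸ hb)
  add_mem' := by
    intro a b ha hb
    exact ContDiff.add (Set.mem_ofPred_eq ▸ ha) (Set.mem_ofPred_eq ▸ hb)
  algebraMap_mem' := by
    intro r
    exact (contDiff_const : ContDiff ℝ (⊤ : ℕ∞) (fun _ : E3 => r))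

instance : CoeFun SA (fun _ => E3 → ℝ) := ⟨fun a => a.1⟩

theorem smo (a : SA) : ContDiff ℝ (⊤ : ℕ∞) a.1 := a.2

theorem dif (a : SA) (p : E3) : DifferentiableAt ℝ a.1 p :=
  ((smo a).differentiable (by simp)) p

theorem ctn (a : SA) : Continuous a.1 := (smo a).continuous

/-- constants -/
def kk (c : ℝ) : SA := algebraMap ℝ SA c

theorem SA_ext {a b : SA} (h : ∀ p, a p = b p) : a = b := Subtype.ext (funext h)

theorem mul_ap (a b : SA) (p : E3) : (a * b).1 p = a.1 p * b.1 p := rfl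
theorem add_ap (a b : SA) (p : E3) : (a + b).1 p = a.1 p + b.1 p := rfl
theorem sub_ap (a b : SA) (p : E3) : (a - b).1 p = a.1 p - b.1 p := rfl
theorem neg_ap (a : SA) (p : E3) : (-a).1 p = -a.1 p := rfl
theorem pow_ap (a : SA) (n : ℕ) (p : E3) : (a ^ n).1 p = a.1 p ^ n := rfl
theorem kk_ap (c : ℝ) (p : E3) : (kk c).1 p = c := rfl
theorem zero_ap (p : E3) : (0 : SA).1 p = 0 := rfl
theorem one_ap (p : E3) : (1 : SA).1 p = 1 := rfl

/-- directional derivative -/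
def DD (v : E3) (a : SA) : SA :=
  ⟨fun p => fderiv ℝ a.1 p v,
    ((smo a).fderiv_right (m := (⊤ : ℕ∞)) (by simp)).clm_apply contDiff_const⟩

theorem DD_ap (v : E3) (a : SA) (p : E3) : (DD v a).1 p = fderiv ℝ a.1 p v := rfl

theorem DD_mul (v : E3) (a b : SA) : DD v (a * b) = DD v a * b + a * DD v b := by
  apply SA_ext; intro p
  have : (a * b).1 = fun q => a.1 q * b.1 q := rfl
  simp only [DD_ap, mul_ap, add_ap, this]
  rw [fderiv_fun_mul (dif a p) (dif b p)]
  simp; ring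

theorem DD_add (v : E3) (a b : SA) : DD v (a + b) = DD v a + DD v b := by
  apply SA_ext; intro p
  have : (a + b).1 = fun q => a.1 q + b.1 q := rfl
  simp only [DD_ap, add_ap, this]
  rw [fderiv_fun_add (dif a p) (dif b p)]
  simp

theorem DD_sub (v : E3) (a b : SA) : DD v (a - b) = DD v a - DD v b := by
  apply SA_ext; intro p
  have : (a - b).1 = fun q => a.1 q - b.1 q := rfl
  simp only [DD_ap, sub_ap, this]
  rw [fderiv_fun_sub (dif a p) (dif b p)]
  simp

theorem DD_neg (v : E3) (a : SA) : DD v (-a) = - DD v a := by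
  apply SA_ext; intro p
  have : (-a).1 = fun q => - a.1 q := rfl
  simp only [DD_ap, neg_ap, this]
  rw [fderiv_fun_neg]
  simp

theorem DD_kk (v : E3) (c : ℝ) : DD v (kk c) = 0 := by
  apply SA_ext; intro p
  have : (kk c).1 = fun q => c := rfl
  simp only [DD_ap, this, zero_ap]
  simp

theorem DD_sq (v : E3) (a : SA) : DD v (a ^ 2) = kk 2 * a * DD v a := by
  rw [sq, DD_mul]
  apply SA_ext; intro p
  simp only [add_ap, mul_ap, kk_ap]; ring

theorem DD_comm (v w : E3) (a : SA) : DD v (DD w a) = DD w (DD v a) := by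
  apply SA_ext; intro p
  have hsym : IsSymmSndFDerivAt ℝ a.1 p :=
    ((smo a).contDiffAt).isSymmSndFDerivAt (by simp; exact WithTop.coe_le_coe.2 le_top)
  have hd : DifferentiableAt ℝ (fderiv ℝ a.1) p :=
    (((smo a).fderiv_right (m := (⊤ : ℕ∞)) (by simp)).differentiable (by simp)) p
  have key : ∀ u : E3, ∀ u' : E3, fderiv ℝ (DD u a).1 p u' = fderiv ℝ (fderiv ℝ a.1) p u' u := by
    intro u u'
    have : (DD u a).1 = fun q => (fderiv ℝ a.1 q) u := rfl
    rw [this, fderiv_clm_apply hd (differentiableAt_const _)]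
    simp
  rw [DD_ap, DD_ap, key, key]
  exact hsym v w

abbrev e0 : E3 := (1, 0, 0)
abbrev e1 : E3 := (0, 1, 0)
abbrev e2 : E3 := (0, 0, 1)

/-- time derivative -/
def Dt (a : SA) : SA := DD e0 a
/-- horizontal derivative -/
def D1 (a : SA) : SA := DD e1 a
/-- vertical derivative -/
def D2 (a : SA) : SA := DD e2 a

theorem Dt_mul (a b : SA) : Dt (a * b) = Dt a * b + a * Dt b := DD_mul _ a b
theorem D1_mul (a b : SA) : D1 (a * b) = D1 a * b + a * D1 b := DD_mul _ a b
theorem D2_mul (a b : SA) : D2 (a * b) = D2 a * b + a * D2 b := DD_mul _ a b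
theorem Dt_add (a b : SA) : Dt (a + b) = Dt a + Dt b := DD_add _ a b
theorem D1_add (a b : SA) : D1 (a + b) = D1 a + D1 b := DD_add _ a b
theorem D2_add (a b : SA) : D2 (a + b) = D2 a + D2 b := DD_add _ a b
theorem Dt_sub (a b : SA) : Dt (a - b) = Dt a - Dt b := DD_sub _ a b
theorem D1_sub (a b : SA) : D1 (a - b) = D1 a - D1 b := DD_sub _ a b
theorem D2_sub (a b : SA) : D2 (a - b) = D2 a - D2 b := DD_sub _ a b
theorem Dt_kk (c : ℝ) : Dt (kk c) = 0 := DD_kk _ c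
theorem D1_kk (c : ℝ) : D1 (kk c) = 0 := DD_kk _ c
theorem D2_kk (c : ℝ) : D2 (kk c) = 0 := DD_kk _ c
theorem Dt_sq (a : SA) : Dt (a ^ 2) = kk 2 * a * Dt a := DD_sq _ a
theorem D1_sq (a : SA) : D1 (a ^ 2) = kk 2 * a * D1 a := DD_sq _ a
theorem D2_sq (a : SA) : D2 (a ^ 2) = kk 2 * a * D2 a := DD_sq _ a
theorem Dt_D1 (a : SA) : D1 (Dt a) = Dt (D1 a) := DD_comm _ _ a
theorem Dt_D2 (a : SA) : D2 (Dt a) = Dt (D2 a) := DD_comm _ _ a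
theorem D2_D1 (a : SA) : D2 (D1 a) = D1 (D2 a) := DD_comm _ _ a

/-- the coordinate `x₂` -/
def X2 : SA := ⟨fun p => p.2.2, (contDiff_snd.snd : ContDiff ℝ (⊤ : ℕ∞) (fun p : E3 => p.2.2))⟩
theorem X2_ap (p : E3) : X2.1 p = p.2.2 := rfl

theorem DD_X2 (v : E3) : DD v X2 = kk v.2.2 := by
  apply SA_ext; intro p
  have h : HasFDerivAt X2.1 ((ContinuousLinearMap.snd ℝ ℝ ℝ).comp (ContinuousLinearMap.snd ℝ ℝ (ℝ × ℝ))) p :=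
    ((ContinuousLinearMap.snd ℝ ℝ ℝ).comp (ContinuousLinearMap.snd ℝ ℝ (ℝ × ℝ))).hasFDerivAt
  rw [DD_ap, h.fderiv]; rfl

theorem Dt_X2 : Dt X2 = 0 := DD_X2 _
theorem D1_X2 : D1 X2 = 0 := DD_X2 _
theorem D2_X2 : D2 X2 = 1 := DD_X2 _

/-! one-dimensional derivatives along coordinate lines -/

theorem hasDerivAt_t (a : SA) (t x y : ℝ) :
    HasDerivAt (fun s : ℝ => a.1 (s, x, y)) ((Dt a).1 (t, x, y)) t := by
  have h1 : HasFDerivAt a.1 (fderiv ℝ a.1 (t, x, y)) (t, x, y) := (dif a _).hasFDerivAt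
  have h2 : HasDerivAt (fun s : ℝ => ((s, x, y) : E3)) e0 t :=
    (hasDerivAt_id t).prodMk (hasDerivAt_const t ((x, y) : ℝ × ℝ))
  exact h1.comp_hasDerivAt t h2

theorem hasDerivAt_1 (a : SA) (t x y : ℝ) :
    HasDerivAt (fun s : ℝ => a.1 (t, s, y)) ((D1 a).1 (t, x, y)) x := by
  have h1 : HasFDerivAt a.1 (fderiv ℝ a.1 (t, x, y)) (t, x, y) := (dif a _).hasFDerivAt
  have h2 : HasDerivAt (fun s : ℝ => ((t, s, y) : E3)) e1 x :=
    (hasDerivAt_const x t).prodMk ((hasDerivAt_id x).prodMk (hasDerivAt_const x y))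
  exact h1.comp_hasDerivAt x h2

theorem hasDerivAt_2 (a : SA) (t x y : ℝ) :
    HasDerivAt (fun s : ℝ => a.1 (t, x, s)) ((D2 a).1 (t, x, y)) y := by
  have h1 : HasFDerivAt a.1 (fderiv ℝ a.1 (t, x, y)) (t, x, y) := (dif a _).hasFDerivAt
  have h2 : HasDerivAt (fun s : ℝ => ((t, x, s) : E3)) e2 y :=
    (hasDerivAt_const y t).prodMk ((hasDerivAt_const y x).prodMk (hasDerivAt_id y))
  exact h1.comp_hasDerivAt y h2

/-! integrals over the cell -/

theorem Ω_eq : Ω = Set.Ioo 0 (2 * π) ×ˢ Set.Ioo 0 1 := rfl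

theorem Ω_open : IsOpen Ω := by rw [Ω_eq]; exact isOpen_Ioo.prod isOpen_Ioo

theorem Ω_meas : MeasurableSet Ω := Ω_open.measurableSet

theorem integrableΩ {f : ℝ × ℝ → ℝ} (hf : Continuous f) : IntegrableOn f Ω := by
  have : IntegrableOn f (Set.Icc 0 (2 * π) ×ˢ Set.Icc 0 1) :=
    hf.continuousOn.integrableOn_compact (isCompact_Icc.prod isCompact_Icc)
  exact this.mono_set (Set.prod_mono Set.Ioo_subset_Icc_self Set.Ioo_subset_Icc_self)

/-- iterated form -/
theorem integralΩ {f : ℝ × ℝ → ℝ} (hf : Continuous f) :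
    ∫ x in Ω, f x = ∫ x in (0 : ℝ)..(2 * π), ∫ y in (0 : ℝ)..1, f (x, y) := by
  have h := integrableΩ hf
  rw [Ω_eq] at h ⊢
  rw [Measure.volume_eq_prod] at h ⊢
  rw [setIntegral_prod f h, intervalIntegral.integral_of_le (by positivity), integral_Ioc_eq_integral_Ioo]
  congr 1; funext x
  rw [intervalIntegral.integral_of_le (by norm_num), integral_Ioc_eq_integral_Ioo]

theorem integralΩ' {f : ℝ × ℝ → ℝ} (hf : Continuous f) :
    ∫ x in Ω, f x = ∫ y in (0 : ℝ)..1, ∫ x in (0 : ℝ)..(2 * π), f (x, y) := by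
  have hc : Continuous (fun z : ℝ × ℝ => f z.swap) := hf.comp continuous_swap
  have : IntegrableOn (fun z : ℝ × ℝ => f z.swap) (Set.Ioo 0 1 ×ˢ Set.Ioo 0 (2 * π)) := by
    have : IntegrableOn (fun z : ℝ × ℝ => f z.swap) (Set.Icc 0 1 ×ˢ Set.Icc 0 (2 * π)) :=
      hc.continuousOn.integrableOn_compact (isCompact_Icc.prod isCompact_Icc)
    exact this.mono_set (Set.prod_mono Set.Ioo_subset_Icc_self Set.Ioo_subset_Icc_self)
  rw [Measure.volume_eq_prod] at this
  rw [Ω_eq, Measure.volume_eq_prod, ← setIntegral_prod_swap, setIntegral_prod _ this,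
    intervalIntegral.integral_of_le (by norm_num), integral_Ioc_eq_integral_Ioo]
  congr 1; funext x
  rw [intervalIntegral.integral_of_le (by positivity), integral_Ioc_eq_integral_Ioo]
  rfl

/-- integral over the cell at time `t` -/
def J (a : SA) (t : ℝ) : ℝ := ∫ x in Ω, a.1 (t, x)

theorem slice_cont (a : SA) (t : ℝ) : Continuous (fun x : ℝ × ℝ => a.1 (t, x)) :=
  (ctn a).comp (by fun_prop)

theorem J_int (a : SA) (t : ℝ) : IntegrableOn (fun x : ℝ × ℝ => a.1 (t, x)) Ω :=
  integrableΩ (slice_cont a t)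

theorem J_add (a b : SA) (t : ℝ) : J (a + b) t = J a t + J b t :=
  integral_add (J_int a t) (J_int b t)
theorem J_sub (a b : SA) (t : ℝ) : J (a - b) t = J a t - J b t :=
  integral_sub (J_int a t) (J_int b t)
theorem J_kk (c : ℝ) (a : SA) (t : ℝ) : J (kk c * a) t = c * J a t :=
  integral_const_mul c _

theorem J_mono {a b : SA} {t : ℝ} (h : ∀ x ∈ Ω, a.1 (t, x) ≤ b.1 (t, x)) : J a t ≤ J b t :=
  setIntegral_mono_on (J_int a t) (J_int b t) Ω_meas h

theorem J_congr {a b : SA} {t : ℝ} (h : ∀ x ∈ Ω, a.1 (t, x) = b.1 (t, x)) : J a t = J b t :=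
  setIntegral_congr_fun Ω_meas h

theorem J_nonneg {a : SA} {t : ℝ} (h : ∀ x ∈ Ω, 0 ≤ a.1 (t, x)) : 0 ≤ J a t :=
  setIntegral_nonneg Ω_meas h

theorem J_D1 (a : SA) (t : ℝ) (h : ∀ x y, a.1 (t, x + 2 * π, y) = a.1 (t, x, y)) : J (D1 a) t = 0 := by
  rw [J, integralΩ' (slice_cont _ t)]
  have : ∀ y : ℝ, ∫ x in (0 : ℝ)..(2 * π), (D1 a).1 (t, x, y) = 0 := by
    intro y
    rw [intervalIntegral.integral_eq_sub_of_hasDerivAt (fun x _ => hasDerivAt_1 a t x y)]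
    · have := h 0 y
      rw [zero_add] at this
      rw [this, sub_self]
    · exact ((ctn (D1 a)).comp (by fun_prop)).intervalIntegrable _ _
  simp [this]

theorem J_D2 (a : SA) (t : ℝ) (h0 : ∀ x, a.1 (t, x, 0) = 0) (h1 : ∀ x, a.1 (t, x, 1) = 0) :
    J (D2 a) t = 0 := by
  rw [J, integralΩ (slice_cont _ t)]
  have : ∀ x : ℝ, ∫ y in (0 : ℝ)..1, (D2 a).1 (t, x, y) = 0 := by
    intro x
    rw [intervalIntegral.integral_eq_sub_of_hasDerivAt (fun y _ => hasDerivAt_2 a t x y)]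
    · rw [h0, h1, sub_self]
    · exact ((ctn (D2 a)).comp (by fun_prop)).intervalIntegrable _ _
  simp [this]

/-- continuity of parametric cell integrals -/
theorem contΩ {f : ℝ → ℝ × ℝ → ℝ} (hf : Continuous (Function.uncurry f)) :
    Continuous (fun t => ∫ x in Ω, f t x) := by
  have hK : IsCompact (Set.Icc (0:ℝ) (2 * π) ×ˢ Set.Icc (0:ℝ) 1) := isCompact_Icc.prod isCompact_Icc
  have h1 := continuous_parametric_integral_of_continuous (μ := volume) hf hK
  have h2 : ∀ t, ∫ x in Ω, f t x = ∫ x in (Set.Icc (0:ℝ) (2 * π) ×ˢ Set.Icc (0:ℝ) 1), f t x := by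
    intro t
    apply setIntegral_congr_set
    rw [Ω_eq, Measure.volume_eq_prod]
    exact Measure.set_prod_ae_eq Ioo_ae_eq_Icc Ioo_ae_eq_Icc
  simpa only [h2] using h1

theorem J_cont (a : SA) : Continuous (J a) := contΩ (f := fun t x => a.1 (t, x)) (ctn a)

theorem J_Dt (a : SA) (t : ℝ) : ∫ s in (0 : ℝ)..t, J (Dt a) s = J a t - J a 0 := by
  have hintg : Integrable (Function.uncurry fun (s : ℝ) (x : ℝ × ℝ) => (Dt a).1 (s, x))
      ((volume.restrict (Set.uIoc 0 t)).prod (volume.restrict Ω)) := by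
    rw [Measure.prod_restrict]
    have : IntegrableOn (Dt a).1 (Set.uIcc 0 t ×ˢ (Set.Icc (0:ℝ) (2 * π) ×ˢ Set.Icc (0:ℝ) 1)) volume :=
      (ctn (Dt a)).continuousOn.integrableOn_compact
        (isCompact_uIcc.prod (isCompact_Icc.prod isCompact_Icc))
    exact this.mono_set (Set.prod_mono Set.uIoc_subset_uIcc
      (Set.prod_mono Set.Ioo_subset_Icc_self Set.Ioo_subset_Icc_self))
  have := intervalIntegral_integral_swap (μ := volume.restrict Ω) hintg
  simp only [J]
  rw [this, ← integral_sub (J_int a t) (J_int a 0)]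
  congr 1; funext x
  obtain ⟨x, y⟩ := x
  rw [intervalIntegral.integral_eq_sub_of_hasDerivAt (fun s _ => hasDerivAt_t a s x y)]
  exact ((ctn (Dt a)).comp (by fun_prop)).intervalIntegrable _ _

theorem poincare (a : SA) (t : ℝ) (h0 : ∀ x, a.1 (t, x, 0) = 0) (h1 : ∀ x, a.1 (t, x, 1) = 0) :
    J (a ^ 2) t ≤ 4 * J (D2 a ^ 2) t := by
  have hz : J (D2 (X2 * a ^ 2)) t = 0 := by
    apply J_D2
    · intro x; simp [mul_ap, pow_ap, h0]
    · intro x; simp [mul_ap, pow_ap, h1]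
  have hle : J (a ^ 2) t ≤ J (kk 2 * D2 (X2 * a ^ 2) + kk 4 * D2 a ^ 2) t := by
    apply J_mono
    rintro ⟨x, y⟩ ⟨-, hy⟩
    simp only [D2_mul, D2_sq, D2_X2, mul_ap, add_ap, pow_ap, kk_ap, one_ap, X2_ap]
    set A := a.1 (t, x, y)
    set B := (D2 a).1 (t, x, y)
    have hy2 : y ^ 2 ≤ 1 := by nlinarith [hy.1, hy.2]
    nlinarith [sq_nonneg (A + 2 * y * B), mul_nonneg (sub_nonneg.2 hy2) (sq_nonneg B)]
  rw [J_add, J_kk, J_kk, hz] at hle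
  linarith

/-- one-dimensional sup bound -/
theorem oneD {g g' k : ℝ → ℝ} {L : ℝ} (hL : 0 < L) (hg : ∀ x, HasDerivAt g (g' x) x)
    (hg' : Continuous g') (hk : Continuous k) (hgk : ∀ x, |g' x| ≤ k x) {x : ℝ}
    (hx : x ∈ Set.Icc 0 L) : L * g x ≤ (∫ y in (0:ℝ)..L, g y) + L * ∫ y in (0:ℝ)..L, k y := by
  have hgc : Continuous g := continuous_iff_continuousAt.2 fun x => (hg x).continuousAt
  have key : ∀ y ∈ Set.Icc 0 L, g x ≤ g y + ∫ y in (0:ℝ)..L, k y := by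
    intro y hy
    have h1 : ∫ z in y..x, g' z = g x - g y :=
      intervalIntegral.integral_eq_sub_of_hasDerivAt (fun z _ => hg z) (hg'.intervalIntegrable _ _)
    have h2 : |∫ z in y..x, g' z| ≤ |(∫ z in y..x, k z)| := by
      have := intervalIntegral.norm_integral_le_abs_of_norm_le (f := g') (g := k) (a := y) (b := x)
        (μ := volume) (Filter.Eventually.of_forall fun z => by simpa using hgk z) (hk.intervalIntegrable _ _)
      simpa using this
    have h3 : |∫ z in y..x, k z| ≤ ∫ z in (0:ℝ)..L, k z := by
      have hk0 : ∀ z, 0 ≤ k z := fun z => (abs_nonneg _).trans (hgk z)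
      rcases le_total y x with h | h
      · rw [abs_of_nonneg (intervalIntegral.integral_nonneg h fun z _ => hk0 z)]
        exact intervalIntegral.integral_mono_interval hy.1 h hx.2
          (Filter.Eventually.of_forall hk0) (hk.intervalIntegrable _ _)
      · rw [intervalIntegral.integral_symm, abs_neg,
          abs_of_nonneg (intervalIntegral.integral_nonneg h fun z _ => hk0 z)]
        exact intervalIntegral.integral_mono_interval hx.1 h hy.2
          (Filter.Eventually.of_forall hk0) (hk.intervalIntegrable _ _)
    have := le_abs_self (∫ z in y..x, g' z)
    linarith
  have h4 : ∫ y in (0:ℝ)..L, g x ≤ ∫ y in (0:ℝ)..L, (g y + ∫ y in (0:ℝ)..L, k y) :=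
    intervalIntegral.integral_mono_on hL.le (by simp) ((hgc.add continuous_const).intervalIntegrable _ _) key
  rw [intervalIntegral.integral_add (hgc.intervalIntegrable _ _) (by simp)] at h4
  simpa using h4

theorem two_pi_one : (1:ℝ) ≤ 2 * π := by linarith [Real.pi_gt_three]

/-- horizontal bound -/
theorem sup1 (a : SA) {m : ℝ} (hm : 0 < m) (t x y : ℝ) (hx : x ∈ Set.Icc 0 (2 * π)) :
    a.1 (t, x, y) ^ 2 ≤ ∫ z in (0:ℝ)..(2 * π), (kk (1 + m) * a ^ 2 + kk m⁻¹ * D1 a ^ 2).1 (t, z, y) := by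
  have h := oneD (g := fun z => (a ^ 2).1 (t, z, y)) (g' := fun z => (D1 (a ^ 2)).1 (t, z, y))
    (k := fun z => (kk m * a ^ 2 + kk m⁻¹ * D1 a ^ 2).1 (t, z, y)) (L := 2 * π) (by positivity)
    (fun z => hasDerivAt_1 _ t z y) ((ctn _).comp (by fun_prop)) ((ctn _).comp (by fun_prop))
    (by
      intro z
      simp only [D1_sq, mul_ap, add_ap, pow_ap, kk_ap]
      set A := a.1 (t, z, y)
      set B := (D1 a).1 (t, z, y)
      have e1 : m * A ^ 2 + m⁻¹ * B ^ 2 - 2 * A * B = m⁻¹ * (m * A - B) ^ 2 := by field_simp; ring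
      have e2 : m * A ^ 2 + m⁻¹ * B ^ 2 + 2 * A * B = m⁻¹ * (m * A + B) ^ 2 := by field_simp; ring
      have p1 : 0 ≤ m⁻¹ * (m * A - B) ^ 2 := by positivity
      have p2 : 0 ≤ m⁻¹ * (m * A + B) ^ 2 := by positivity
      rw [abs_le]; constructor <;> linarith) hx
  have hi : ∀ b : SA, IntervalIntegrable (fun z => b.1 (t, z, y)) volume 0 (2 * π) := fun b =>
    ((ctn b).comp (by fun_prop)).intervalIntegrable _ _
  have hsplit : ∫ z in (0:ℝ)..(2 * π), (kk (1 + m) * a ^ 2 + kk m⁻¹ * D1 a ^ 2).1 (t, z, y)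
      = (∫ z in (0:ℝ)..(2 * π), (a ^ 2).1 (t, z, y))
        + ∫ z in (0:ℝ)..(2 * π), (kk m * a ^ 2 + kk m⁻¹ * D1 a ^ 2).1 (t, z, y) := by
    rw [← intervalIntegral.integral_add (hi _) (hi _)]
    congr 1; funext z
    simp only [mul_ap, add_ap, pow_ap, kk_ap]; ring
  rw [hsplit]
  have h0 : 0 ≤ ∫ z in (0:ℝ)..(2 * π), (a ^ 2).1 (t, z, y) :=
    intervalIntegral.integral_nonneg (by positivity) fun z _ => by rw [pow_ap]; positivity
  have hpi := two_pi_one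
  rw [pow_ap] at h
  set I1 := ∫ z in (0:ℝ)..(2 * π), (a ^ 2).1 (t, z, y)
  set I2 := ∫ z in (0:ℝ)..(2 * π), (kk m * a ^ 2 + kk m⁻¹ * D1 a ^ 2).1 (t, z, y)
  have : 2 * π * a.1 (t, x, y) ^ 2 ≤ 2 * π * (I1 + I2) := by nlinarith
  exact le_of_mul_le_mul_left this (by positivity)

theorem sup2gen (b k : SA) (t x y : ℝ) (hk : ∀ z, |(D2 b).1 (t, x, z)| ≤ k.1 (t, x, z))
    (hy : y ∈ Set.Icc (0:ℝ) 1) : b.1 (t, x, y) ≤ ∫ z in (0:ℝ)..1, (b + k).1 (t, x, z) := by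
  have h := oneD (g := fun z => b.1 (t, x, z)) (g' := fun z => (D2 b).1 (t, x, z))
    (k := fun z => k.1 (t, x, z)) (L := 1) one_pos
    (fun z => hasDerivAt_2 _ t x z) ((ctn _).comp (by fun_prop)) ((ctn _).comp (by fun_prop)) hk hy
  have hi : ∀ b : SA, IntervalIntegrable (fun z => b.1 (t, x, z)) volume 0 1 := fun b =>
    ((ctn b).comp (by fun_prop)).intervalIntegrable _ _
  have : ∫ z in (0:ℝ)..1, (b + k).1 (t, x, z) = (∫ z in (0:ℝ)..1, b.1 (t, x, z)) + ∫ z in (0:ℝ)..1, k.1 (t, x, z) := by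
    rw [← intervalIntegral.integral_add (hi _) (hi _)]; rfl
  rw [this]; linarith

theorem sup2 (a : SA) {m : ℝ} (hm : 0 < m) (t x y : ℝ) (hy : y ∈ Set.Icc (0:ℝ) 1) :
    a.1 (t, x, y) ^ 2 ≤ ∫ z in (0:ℝ)..1, (kk (1 + m) * a ^ 2 + kk m⁻¹ * D2 a ^ 2).1 (t, x, z) := by
  have h := sup2gen (a ^ 2) (kk m * a ^ 2 + kk m⁻¹ * D2 a ^ 2) t x y (by
      intro z
      simp only [D2_sq, mul_ap, add_ap, pow_ap, kk_ap]
      set A := a.1 (t, x, z)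
      set B := (D2 a).1 (t, x, z)
      have e1 : m * A ^ 2 + m⁻¹ * B ^ 2 - 2 * A * B = m⁻¹ * (m * A - B) ^ 2 := by field_simp; ring
      have e2 : m * A ^ 2 + m⁻¹ * B ^ 2 + 2 * A * B = m⁻¹ * (m * A + B) ^ 2 := by field_simp; ring
      have p1 : 0 ≤ m⁻¹ * (m * A - B) ^ 2 := by positivity
      have p2 : 0 ≤ m⁻¹ * (m * A + B) ^ 2 := by positivity
      rw [abs_le]; constructor <;> linarith) hy
  rw [pow_ap] at h
  refine h.trans (le_of_eq ?_)
  congr 1; funext z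
  simp only [mul_ap, add_ap, pow_ap, kk_ap]; ring

/-- sup bound on the cell -/
theorem supΩ (a : SA) {m : ℝ} (hm : 1 ≤ m) (t : ℝ) (x : ℝ × ℝ) (hx : x ∈ Ω) :
    a.1 (t, x) ^ 2 ≤ 6 * (m ^ 2 * J (a ^ 2) t + J (D1 a ^ 2) t + J (D2 a ^ 2) t
      + (m ^ 2)⁻¹ * J (D1 (D2 a) ^ 2) t) := by
  obtain ⟨x, y⟩ := x
  have hx1 : x ∈ Set.Icc 0 (2 * π) := Set.Ioo_subset_Icc_self hx.1
  have hy1 : y ∈ Set.Icc (0:ℝ) 1 := Set.Ioo_subset_Icc_self hx.2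
  have hm0 : 0 < m := by linarith
  set b : SA := kk (1 + m) * a ^ 2 + kk m⁻¹ * D1 a ^ 2 with hb
  set k : SA := kk 2 * (kk (m ^ 2) * a ^ 2 + D2 a ^ 2) + (D1 a ^ 2 + kk (m ^ 2)⁻¹ * D1 (D2 a) ^ 2) with hk
  have h1 := sup1 a hm0 t x y hx1
  have hkb : ∀ z w, |(D2 b).1 (t, z, w)| ≤ k.1 (t, z, w) := by
    intro z w
    simp only [hb, hk, D2_add, D2_mul, D2_kk, D2_sq, mul_ap, add_ap, pow_ap, kk_ap, zero_ap, D2_D1]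
    set A := a.1 (t, z, w)
    set B := (D2 a).1 (t, z, w)
    set C := (D1 a).1 (t, z, w)
    set D := (D1 (D2 a)).1 (t, z, w)
    have q1 : |A * B| * (1 + m) ≤ m ^ 2 * A ^ 2 + B ^ 2 := by
      have : |A * B| * (2 * m) ≤ m ^ 2 * A ^ 2 + B ^ 2 := by
        rw [abs_mul]; nlinarith [sq_nonneg (m * |A| - |B|), sq_abs A, sq_abs B]
      nlinarith [abs_nonneg (A * B)]
    have q2 : 2 * |m⁻¹ * (C * D)| ≤ C ^ 2 + (m ^ 2)⁻¹ * D ^ 2 := by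
      have e : (m ^ 2)⁻¹ * D ^ 2 = (m⁻¹ * D) ^ 2 := by rw [mul_pow, inv_pow]
      rw [e, show m⁻¹ * (C * D) = C * (m⁻¹ * D) by ring, abs_mul]
      nlinarith [sq_nonneg (|C| - |m⁻¹ * D|), sq_abs C, sq_abs (m⁻¹ * D)]
    have e : 0 * A ^ 2 + (1 + m) * (2 * A * B) + (0 * C ^ 2 + m⁻¹ * (2 * C * D))
      = 2 * (1 + m) * (A * B) + 2 * (m⁻¹ * (C * D)) := by ring
    rw [e]
    refine (abs_add_le _ _).trans ?_
    rw [abs_mul, abs_mul 2 (m⁻¹ * (C * D)), abs_of_pos (by positivity : 0 < 2 * (1 + m)), abs_of_pos (by norm_num : (0:ℝ) < 2)]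
    linarith
  have h2 : ∀ z, b.1 (t, z, y) ≤ ∫ w in (0:ℝ)..1, (b + k).1 (t, z, w) :=
    fun z => sup2gen b k t z y (hkb z) hy1
  have h3 : ∫ z in (0:ℝ)..(2 * π), b.1 (t, z, y) ≤ J (b + k) t := by
    rw [J, integralΩ (slice_cont _ t)]
    apply intervalIntegral.integral_mono_on (by positivity)
    · exact ((ctn b).comp (by fun_prop)).intervalIntegrable _ _
    · apply Continuous.intervalIntegrable
      apply intervalIntegral.continuous_parametric_intervalIntegral_of_continuous'
      exact (ctn (b + k)).comp (by fun_prop)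
    · intro z _; exact h2 z
  refine h1.trans (h3.trans ?_)
  simp only [hb, hk, J_add, J_kk]
  have n1 : 0 ≤ J (a ^ 2) t := J_nonneg fun x _ => by rw [pow_ap]; positivity
  have n2 : 0 ≤ J (D1 a ^ 2) t := J_nonneg fun x _ => by rw [pow_ap]; positivity
  have n3 : 0 ≤ J (D2 a ^ 2) t := J_nonneg fun x _ => by rw [pow_ap]; positivity
  have n4 : 0 ≤ J (D1 (D2 a) ^ 2) t := J_nonneg fun x _ => by rw [pow_ap]; positivity
  have hmi : m⁻¹ ≤ 1 := inv_le_one_of_one_le₀ hm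
  have n5 : 0 ≤ (m ^ 2)⁻¹ * J (D1 (D2 a) ^ 2) t := by positivity
  have n6 : m⁻¹ * J (D1 a ^ 2) t ≤ J (D1 a ^ 2) t := by nlinarith
  have n7 : (1 + m) * J (a ^ 2) t ≤ 2 * m ^ 2 * J (a ^ 2) t := by
    apply mul_le_mul_of_nonneg_right _ n1; nlinarith
  nlinarith

/-- anisotropic product estimate -/
theorem aniso (a b : SA) {m n : ℝ} (hm : 0 < m) (hn : 0 < n) (t : ℝ) :
    J (a ^ 2 * b ^ 2) t ≤ ((1 + m) * J (a ^ 2) t + m⁻¹ * J (D1 a ^ 2) t)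
      * ((1 + n) * J (b ^ 2) t + n⁻¹ * J (D2 b ^ 2) t) := by
  set A : SA := kk (1 + m) * a ^ 2 + kk m⁻¹ * D1 a ^ 2 with hA
  set B : SA := kk (1 + n) * b ^ 2 + kk n⁻¹ * D2 b ^ 2 with hB
  have eA : (1 + m) * J (a ^ 2) t + m⁻¹ * J (D1 a ^ 2) t = J A t := by simp only [hA, J_add, J_kk]
  have eB : (1 + n) * J (b ^ 2) t + n⁻¹ * J (D2 b ^ 2) t = J B t := by simp only [hB, J_add, J_kk]
  rw [eA, eB]
  set M : ℝ → ℝ := fun y => ∫ z in (0:ℝ)..(2 * π), A.1 (t, z, y) with hM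
  set N : ℝ → ℝ := fun x => ∫ z in (0:ℝ)..1, B.1 (t, x, z) with hN
  have cM : Continuous M := by
    apply intervalIntegral.continuous_parametric_intervalIntegral_of_continuous'
    exact (ctn A).comp (by fun_prop)
  have cN : Continuous N := by
    apply intervalIntegral.continuous_parametric_intervalIntegral_of_continuous'
    exact (ctn B).comp (by fun_prop)
  have cMN : Continuous (fun x : ℝ × ℝ => M x.2 * N x.1) := by fun_prop
  have h1 : J (a ^ 2 * b ^ 2) t ≤ ∫ x in Ω, M x.2 * N x.1 := by
    apply setIntegral_mono_on (J_int _ t) (integrableΩ cMN) Ω_meas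
    rintro ⟨x, y⟩ hx
    have hx1 : x ∈ Set.Icc 0 (2 * π) := Set.Ioo_subset_Icc_self hx.1
    have hy1 : y ∈ Set.Icc (0:ℝ) 1 := Set.Ioo_subset_Icc_self hx.2
    simp only [mul_ap, pow_ap]
    have s1 := sup1 a hm t x y hx1
    have s2 := sup2 b hn t x y hy1
    exact mul_le_mul s1 s2 (by positivity) ((sq_nonneg _).trans s1)
  refine h1.trans (le_of_eq ?_)
  rw [integralΩ cMN]
  simp only [intervalIntegral.integral_mul_const, intervalIntegral.integral_const_mul]
  congr 1
  · rw [J, integralΩ' (slice_cont _ t)]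
  · rw [J, integralΩ (slice_cont _ t)]

theorem J_sq_nonneg (a : SA) (t : ℝ) : 0 ≤ J (a ^ 2) t :=
  J_nonneg fun x _ => by rw [pow_ap]; positivity

/-- fourth power estimate -/
theorem ladyz (a : SA) (t Y : ℝ) (h1 : J (D1 a ^ 2) t ≤ Y) (h2 : J (D2 a ^ 2) t ≤ Y) :
    J (a ^ 2 * a ^ 2) t ≤ 9 * J (a ^ 2) t * (J (a ^ 2) t + Y) := by
  have hX := J_sq_nonneg a t
  have hY : 0 ≤ Y := (J_sq_nonneg _ t).trans h1
  have key : ∀ m : ℝ, 0 < m → J (a ^ 2 * a ^ 2) t ≤ ((1 + m) * J (a ^ 2) t + m⁻¹ * Y) ^ 2 := by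
    intro m hm
    refine (aniso a a hm hm t).trans (le_of_le_of_eq ?_ (sq ((1 + m) * J (a ^ 2) t + m⁻¹ * Y)).symm)
    have := J_sq_nonneg (D2 a) t
    have := J_sq_nonneg (D1 a) t
    gcongr
  set X := J (a ^ 2) t
  rcases hX.eq_or_lt with h0 | h0
  · rw [← h0] at key ⊢
    simp only [mul_zero, zero_add, zero_mul]
    by_contra hc
    push Not at hc
    set S := J (a ^ 2 * a ^ 2) t
    have hs : 0 < √S := Real.sqrt_pos.2 hc
    have := key ((Y + 1) / √S) (by positivity)
    rw [inv_div] at this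
    have e : (√S / (Y + 1) * Y) ^ 2 = S * (Y / (Y + 1)) ^ 2 := by
      rw [div_mul_eq_mul_div, div_pow, mul_pow, Real.sq_sqrt hc.le, div_pow]; ring
    have hlt : (Y / (Y + 1)) ^ 2 < 1 := by
      rw [sq_lt_one_iff₀ (by positivity), div_lt_one (by positivity)]; linarith
    rw [show (1 + (Y + 1) / √S) * 0 + √S / (Y + 1) * Y = √S / (Y + 1) * Y by ring, e] at this
    nlinarith
  · set m := √((X + Y) / X) with hm
    have hm2 : m ^ 2 = (X + Y) / X := Real.sq_sqrt (by positivity)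
    have hmp : 0 < m := Real.sqrt_pos.2 (by positivity)
    have hm2X : m ^ 2 * X = X + Y := by rw [hm2]; field_simp
    refine (key m hmp).trans ?_
    have hm1 : 1 ≤ m := by
      rw [hm]; apply Real.one_le_sqrt.2; rw [le_div_iff₀ h0]; linarith
    have hYm : m⁻¹ * Y ≤ m * X := by
      rw [inv_mul_le_iff₀ hmp]; nlinarith
    have hb : (1 + m) * X + m⁻¹ * Y ≤ 3 * (m * X) := by nlinarith
    have : ((1 + m) * X + m⁻¹ * Y) ^ 2 ≤ (3 * (m * X)) ^ 2 := by
      apply pow_le_pow_left₀ _ hb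
      positivity
    refine this.trans (le_of_eq ?_)
    rw [← hm2X]; ring

/-- horizontal periodicity -/
def Per (a : SA) : Prop := ∀ t x y : ℝ, a.1 (t, x + 2 * π, y) = a.1 (t, x, y)

theorem Per.mul {a b : SA} (ha : Per a) (hb : Per b) : Per (a * b) := fun t x y => by
  rw [mul_ap, mul_ap, ha, hb]
theorem Per.add {a b : SA} (ha : Per a) (hb : Per b) : Per (a + b) := fun t x y => by
  rw [add_ap, add_ap, ha, hb]
theorem Per.sub {a b : SA} (ha : Per a) (hb : Per b) : Per (a - b) := fun t x y => by
  rw [sub_ap, sub_ap, ha, hb]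
theorem Per.pow {a : SA} (ha : Per a) (n : ℕ) : Per (a ^ n) := fun t x y => by
  rw [pow_ap, pow_ap, ha]
theorem Per.kk (c : ℝ) : Per (kk c) := fun _ _ _ => rfl
theorem Per.X2 : Per X2 := fun _ _ _ => rfl
theorem Per.DD {a : SA} (ha : Per a) (v : E3) : Per (DD v a) := fun t x y => by
  have h : a.1 = fun p => a.1 (p + ((0, 2 * π, 0) : E3)) := by
    funext ⟨t, x, y⟩
    have := ha t x y
    simp only [Prod.mk_add_mk, add_zero]
    exact this.symm
  have h2 := fderiv_comp_add_right (𝕜 := ℝ) (f := a.1) (x := ((t, x, y) : E3)) ((0, 2 * π, 0) : E3)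
  rw [← h] at h2
  rw [DD_ap, DD_ap, h2]
  simp
theorem Per.Dt {a : SA} (ha : Per a) : Per (Dt a) := ha.DD _
theorem Per.D1 {a : SA} (ha : Per a) : Per (D1 a) := ha.DD _
theorem Per.D2 {a : SA} (ha : Per a) : Per (D2 a) := ha.DD _

/-- vanishing on the walls at time `t` -/
def Van (t : ℝ) (a : SA) : Prop := ∀ x y : ℝ, (y = 0 ∨ y = 1) → a.1 (t, x, y) = 0

/-- the reformulated system, together with the a priori bounds -/
structure Sys (B c0 r μ ε σ κ τ : ℝ) where
  f : SA
  p : SA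
  q : SA
  h : SA
  R : SA
  T : SA
  hB : 1 ≤ B
  hc0 : 0 < c0
  hc1 : c0 ≤ 1
  hε : 0 < ε
  hε1 : ε ≤ 1
  hμ : 1 ≤ μ
  hr : 0 < 1 + r
  hrB : |r| ≤ B
  hrB1 : |1 + r| ≤ B
  hσ : c0 ≤ σ
  hσB : |σ| ≤ B
  hκ : c0 * μ ≤ κ
  hκB : |κ| ≤ B * μ
  pf : Per f
  pp : Per p
  pq : Per q
  ph : Per h
  pR : Per R
  pT : Per T
  D1R : D1 R = 0
  D1T : D1 T = 0
  DtR : Dt R = 0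
  DtT : Dt T = 0
  vp : ∀ t ∈ Set.Icc 0 τ, Van t p
  vq : ∀ t ∈ Set.Icc 0 τ, Van t q
  vh : ∀ t ∈ Set.Icc 0 τ, Van t h
  vpt : ∀ t ∈ Set.Icc 0 τ, Van t (Dt p)
  vqt : ∀ t ∈ Set.Icc 0 τ, Van t (Dt q)
  vht : ∀ t ∈ Set.Icc 0 τ, Van t (Dt h)
  RT : ∀ t ∈ Set.Icc 0 τ, ∀ x ∈ Ω, R.1 (t, x) * T.1 (t, x) = 1
  mass : ∀ t ∈ Set.Icc 0 τ, ∀ x ∈ Ω,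
    (Dt f + (X2 + p) * D1 f + q * D2 f + (R + f) * (D1 p + D2 q) + q * D2 R).1 (t, x) = 0
  mom1 : ∀ t ∈ Set.Icc 0 τ, ∀ x ∈ Ω,
    ((R + f) * (Dt p + (X2 + p) * D1 p + q * D2 p + q) + kk (ε ^ 2)⁻¹ * D1 (R * h + T * f + f * h)
      - kk μ * (D1 (D1 p) + D2 (D2 p)) - kk (μ * (1 + r)) * (D1 (D1 p) + D1 (D2 q))).1 (t, x) = 0
  mom2 : ∀ t ∈ Set.Icc 0 τ, ∀ x ∈ Ω,
    ((R + f) * (Dt q + (X2 + p) * D1 q + q * D2 q) + kk (ε ^ 2)⁻¹ * D2 (R * h + T * f + f * h)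
      - kk μ * (D1 (D1 q) + D2 (D2 q)) - kk (μ * (1 + r)) * (D2 (D1 p) + D2 (D2 q))).1 (t, x) = 0
  ener : ∀ t ∈ Set.Icc 0 τ, ∀ x ∈ Ω,
    (kk σ * (R + f) * (Dt h + (X2 + p) * D1 h + q * D2 h + q * D2 T)
      + (R + f) * (T + h) * (D1 p + D2 q) - kk κ * (D1 (D1 h) + D2 (D2 h))
      - kk (ε ^ 2) * (kk (2 * μ) * (D1 p ^ 2 + D2 q ^ 2 + kk (1 / 2) * (D1 q + D2 p) ^ 2)
        + kk (2 * μ) * (D1 q + D2 p) + kk (r * μ) * (D1 p + D2 q) ^ 2)).1 (t, x) = 0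
  bp : ∀ t ∈ Set.Icc 0 τ, ∀ x ∈ Ω, |p.1 (t, x)| ≤ B
  bq : ∀ t ∈ Set.Icc 0 τ, ∀ x ∈ Ω, |q.1 (t, x)| ≤ B
  bf : ∀ t ∈ Set.Icc 0 τ, ∀ x ∈ Ω, |f.1 (t, x)| ≤ B * ε
  bh : ∀ t ∈ Set.Icc 0 τ, ∀ x ∈ Ω, |h.1 (t, x)| ≤ B * ε
  bR : ∀ t ∈ Set.Icc 0 τ, ∀ x ∈ Ω, |R.1 (t, x)| ≤ B
  bT : ∀ t ∈ Set.Icc 0 τ, ∀ x ∈ Ω, |T.1 (t, x)| ≤ B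
  bρ : ∀ t ∈ Set.Icc 0 τ, ∀ x ∈ Ω, |R.1 (t, x) + f.1 (t, x)| ≤ B
  bR' : ∀ t ∈ Set.Icc 0 τ, ∀ x ∈ Ω, |(D2 R).1 (t, x)| ≤ B * ε
  bT' : ∀ t ∈ Set.Icc 0 τ, ∀ x ∈ Ω, |(D2 T).1 (t, x)| ≤ B * ε
  lR : ∀ t ∈ Set.Icc 0 τ, ∀ x ∈ Ω, c0 ≤ R.1 (t, x)
  lT : ∀ t ∈ Set.Icc 0 τ, ∀ x ∈ Ω, c0 ≤ T.1 (t, x)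
  lρ : ∀ t ∈ Set.Icc 0 τ, ∀ x ∈ Ω, c0 ≤ R.1 (t, x) + f.1 (t, x)
  nint : ∫ s in (0 : ℝ)..τ, (ε ^ 2)⁻¹ * (J (f ^ 2) s + J (D1 f ^ 2) s + J (D2 f ^ 2) s
    + J (D1 (D2 f) ^ 2) s) ≤ B
  nf : ∀ t ∈ Set.Icc 0 τ, J (D2 f ^ 2) t ≤ B ∧ J (D1 (D2 f) ^ 2) t ≤ B ∧ J (D2 (D2 f) ^ 2) t ≤ B
  np : ∀ t ∈ Set.Icc 0 τ, J (D1 p ^ 2) t ≤ B ∧ J (D2 p ^ 2) t ≤ B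
    ∧ J (D1 q ^ 2) t ≤ B ∧ J (D2 q ^ 2) t ≤ B
  npp : ∀ t ∈ Set.Icc 0 τ, J (D1 (D1 p) ^ 2) t ≤ B * (ε ^ 2)⁻¹ ∧ J (D1 (D2 p) ^ 2) t ≤ B * (ε ^ 2)⁻¹
    ∧ J (D2 (D2 p) ^ 2) t ≤ B * (ε ^ 2)⁻¹
  nqq : ∀ t ∈ Set.Icc 0 τ, J (D1 (D1 q) ^ 2) t ≤ B * (ε ^ 2)⁻¹ ∧ J (D1 (D2 q) ^ 2) t ≤ B * (ε ^ 2)⁻¹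
    ∧ J (D2 (D2 q) ^ 2) t ≤ B * (ε ^ 2)⁻¹

namespace Sys
variable {B c0 r μ ε σ κ τ : ℝ}

/-- pressure perturbation -/
def P (S : Sys B c0 r μ ε σ κ τ) : SA := S.R * S.h + S.T * S.f + S.f * S.h
/-- divergence -/
def d (S : Sys B c0 r μ ε σ κ τ) : SA := D1 S.p + D2 S.q
/-- density -/
def ρ (S : Sys B c0 r μ ε σ κ τ) : SA := S.R + S.f

/-- basic energy density -/
def E0 (S : Sys B c0 r μ ε σ κ τ) : SA :=
  kk (1/2) * (S.ρ * S.R * (S.p ^ 2 + S.q ^ 2) + kk (ε ^ 2)⁻¹ * (S.T * S.f ^ 2)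
    + kk ((ε ^ 2)⁻¹ * σ) * (S.R ^ 2 * S.ρ * S.h ^ 2))

/-- first flux -/
def F1 (S : Sys B c0 r μ ε σ κ τ) : SA :=
  (X2 + S.p) * S.E0 + kk (ε ^ 2)⁻¹ * (S.R * S.p * S.P)
    - kk μ * (S.R * S.p * D1 S.p + S.R * S.q * D1 S.q) - kk (μ * (1 + r)) * (S.R * S.p * S.d)
    - kk (κ * (ε ^ 2)⁻¹) * (S.R ^ 2 * S.h * D1 S.h)
/-- second flux -/
def F2 (S : Sys B c0 r μ ε σ κ τ) : SA :=
  S.q * S.E0 + kk (ε ^ 2)⁻¹ * (S.R * S.q * S.P)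
    - kk μ * (S.R * S.p * D2 S.p + S.R * S.q * D2 S.q) - kk (μ * (1 + r)) * (S.R * S.q * S.d)
    - kk (κ * (ε ^ 2)⁻¹) * (S.R ^ 2 * S.h * D2 S.h)

/-- squared gradient of velocity -/
def G (S : Sys B c0 r μ ε σ κ τ) : SA := D1 S.p ^ 2 + D2 S.p ^ 2 + D1 S.q ^ 2 + D2 S.q ^ 2
/-- squared gradient of temperature -/
def Z (S : Sys B c0 r μ ε σ κ τ) : SA := D1 S.h ^ 2 + D2 S.h ^ 2

/-- viscous heating -/
def Q (S : Sys B c0 r μ ε σ κ τ) : SA :=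
  kk (2 * μ) * (D1 S.p ^ 2 + D2 S.q ^ 2 + kk (1 / 2) * (D1 S.q + D2 S.p) ^ 2)
        + kk (2 * μ) * (D1 S.q + D2 S.p) + kk (r * μ) * (D1 S.p + D2 S.q) ^ 2

/-- remainder without the cubic density term -/
def Rem (S : Sys B c0 r μ ε σ κ τ) : SA :=
  kk (1/2) * S.ρ * S.q * D2 S.R * (S.p ^ 2 + S.q ^ 2) - S.R * S.ρ * S.q * S.p
  - kk μ * (D2 S.R * (S.p * D2 S.p + S.q * D2 S.q)) - kk (μ * (1 + r)) * (D2 S.R * S.q * S.d)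
  + kk (ε ^ 2)⁻¹ * (S.R * S.h * S.q * D2 S.R) + kk (ε ^ 2)⁻¹ * (S.f * S.h * (S.R * S.d + S.q * D2 S.R))
  + kk ((ε ^ 2)⁻¹ * σ) * (S.ρ * S.h ^ 2 * S.R * D2 S.R * S.q)
  - kk ((ε ^ 2)⁻¹ * σ) * (S.R ^ 2 * S.h * S.ρ * S.q * D2 S.T)
  - kk (ε ^ 2)⁻¹ * (S.R ^ 2 * S.h * S.P * S.d)
  - kk (2 * κ * (ε ^ 2)⁻¹) * (S.R * D2 S.R * S.h * D2 S.h)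
  + S.R ^ 2 * S.h * S.Q

/-- the cubic density term -/
def Cub (S : Sys B c0 r μ ε σ κ τ) : SA :=
  kk (1/2 * (ε ^ 2)⁻¹) * (S.f ^ 2 * (S.q * D2 S.T - S.T * S.d))

set_option maxHeartbeats 1000000 in
theorem identity0 (S : Sys B c0 r μ ε σ κ τ) (t : ℝ) (ht : t ∈ Set.Icc 0 τ) (x : ℝ × ℝ) (hx : x ∈ Ω) :
    (Dt S.E0 + D1 S.F1 + D2 S.F2 + (kk μ * (S.R * S.G) + kk (μ * (1 + r)) * (S.R * S.d ^ 2)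
      + kk (κ * (ε ^ 2)⁻¹) * (S.R ^ 2 * S.Z))).1 (t, x) = (S.Rem + S.Cub).1 (t, x) := by
  have hRT := S.RT t ht x hx
  have hma := S.mass t ht x hx
  have hm1 := S.mom1 t ht x hx
  have hm2 := S.mom2 t ht x hx
  have hen := S.ener t ht x hx
  have hk : (ε ^ 2)⁻¹ * ε ^ 2 = 1 := inv_mul_cancel₀ (by have := S.hε; positivity)
  simp only [E0, F1, F2, G, Z, Q, Rem, Cub, P, d, ρ, Dt_mul, Dt_add, Dt_sub, Dt_sq, Dt_kk, D1_mul, D1_add,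
    D1_sub, D1_sq, D1_kk, D2_mul, D2_add, D2_sub, D2_sq, D2_kk, Dt_X2, D1_X2, D2_X2, S.D1R, S.D1T, S.DtR,
    S.DtT, D2_D1, mul_ap, add_ap, sub_ap, pow_ap, kk_ap, zero_ap, one_ap] at hRT hma hm1 hm2 hen ⊢
  generalize S.p.1 (t, x) = p at *
  generalize S.q.1 (t, x) = q at *
  generalize S.f.1 (t, x) = f at *
  generalize S.h.1 (t, x) = h at *
  generalize S.R.1 (t, x) = R at *
  generalize S.T.1 (t, x) = T at *
  generalize (ε ^ 2)⁻¹ = k at *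
  linear_combination (R * p) * hm1 + (R * q) * hm2 + (k * T * f) * hma
    + (k * R ^ 2 * h) * hen + (1/2 * R * (p ^ 2 + q ^ 2) + 1/2 * k * σ * R ^ 2 * h ^ 2) * hma
    - k * (R ^ 2 * h * ((D1 S.p).1 (t, x) + (D2 S.q).1 (t, x))) * hRT
    + R ^ 2 * h * (2 * μ * ((D1 S.p).1 (t, x) ^ 2 + (D2 S.q).1 (t, x) ^ 2
      + 1 / 2 * ((D1 S.q).1 (t, x) + (D2 S.p).1 (t, x)) ^ 2)
      + 2 * μ * ((D1 S.q).1 (t, x) + (D2 S.p).1 (t, x))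
      + r * μ * ((D1 S.p).1 (t, x) + (D2 S.q).1 (t, x)) ^ 2) * hk
end Sys

theorem abm {B a b : ℝ} {m n : ℕ} (ha : |a| ≤ B ^ m) (hb : |b| ≤ B ^ n) : |a * b| ≤ B ^ (m + n) := by
  rw [abs_mul, pow_add]
  exact mul_le_mul ha hb (abs_nonneg _) ((abs_nonneg _).trans ha)

theorem prW {B c u v W : ℝ} {n : ℕ} (N : ℕ) (hB : 1 ≤ B) (hc : |c| ≤ B ^ n) (hn : n ≤ N)
    (hu : u ^ 2 ≤ W) (hv : v ^ 2 ≤ W) : c * (u * v) ≤ B ^ N * W := by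
  have h1 : |c| ≤ B ^ N := hc.trans (pow_le_pow_right₀ hB hn)
  have h2 : |u * v| ≤ W := by
    rw [abs_le]; constructor <;> nlinarith [sq_nonneg (u - v), sq_nonneg (u + v)]
  calc c * (u * v) ≤ |c * (u * v)| := le_abs_self _
    _ = |c| * |u * v| := abs_mul _ _
    _ ≤ B ^ N * W := mul_le_mul h1 h2 (abs_nonneg _) (by positivity)

theorem prW' {B c u v W : ℝ} {n : ℕ} (N : ℕ) (hB : 1 ≤ B) (hc : |c| ≤ B ^ n) (hn : n ≤ N)
    (hu : u ^ 2 ≤ W) (hv : v ^ 2 ≤ W) : -(c * (u * v)) ≤ B ^ N * W := by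
  have := prW (c := -c) N hB (by rwa [abs_neg]) hn hu hv
  linarith

set_option maxHeartbeats 2000000 in
theorem rem_real {B r μ ε σ κ p q p1 p2 q1 q2 H H1 H2 F R T R1 T1 ρ W : ℝ} (hB : 1 ≤ B) (hε : 0 < ε)
    (hε1 : ε ≤ 1) (hμ : 0 ≤ μ)
    (hr : |r| ≤ B) (hr1 : |1 + r| ≤ B) (hσ : |σ| ≤ B) (hκ : |κ| ≤ B)
    (bq : |q| ≤ B) (bF : |F| ≤ B) (bH : |H| ≤ B) (bR : |R| ≤ B) (bT : |T| ≤ B)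
    (bρ : |ρ| ≤ B) (bR1 : |R1| ≤ B) (bT1 : |T1| ≤ B)
    (hW : W = p ^ 2 + q ^ 2 + (p1 ^ 2 + p2 ^ 2 + q1 ^ 2 + q2 ^ 2) + H ^ 2 + (H1 ^ 2 + H2 ^ 2)) :
    1/2 * ρ * q * (ε * R1) * (p ^ 2 + q ^ 2) - R * ρ * q * p
    - μ * ((ε * R1) * (p * p2 + q * q2)) - μ * (1 + r) * ((ε * R1) * q * (p1 + q2))
    + R * H * q * R1 + F * H * (R * (p1 + q2) + q * (ε * R1))
    + σ * (ρ * H ^ 2 * R * (ε * R1) * q)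
    - σ * (R ^ 2 * H * ρ * q * T1)
    - (R ^ 2 * H * (R * H + T * F + ε * F * H) * (p1 + q2))
    - 2 * (μ * κ) * (R * (ε * R1) * H * H2)
    + R ^ 2 * (ε * H) * (2 * μ * (p1 ^ 2 + q2 ^ 2 + 1 / 2 * (q1 + p2) ^ 2) + 2 * μ * (q1 + p2)
      + r * μ * (p1 + q2) ^ 2) ≤ 22 * B ^ 5 * (1 + μ * ε) * W := by
  have z1 := sq_nonneg p
  have z2 := sq_nonneg q
  have z3 := sq_nonneg p1
  have z4 := sq_nonneg p2
  have z5 := sq_nonneg q1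
  have z6 := sq_nonneg q2
  have z7 := sq_nonneg H
  have z8 := sq_nonneg H1
  have z9 := sq_nonneg H2
  have wp : p ^ 2 ≤ W := by rw [hW]; linarith
  have wq : q ^ 2 ≤ W := by rw [hW]; linarith
  have wp1 : p1 ^ 2 ≤ W := by rw [hW]; linarith
  have wp2 : p2 ^ 2 ≤ W := by rw [hW]; linarith
  have wq1 : q1 ^ 2 ≤ W := by rw [hW]; linarith
  have wq2 : q2 ^ 2 ≤ W := by rw [hW]; linarith
  have wH : H ^ 2 ≤ W := by rw [hW]; linarith
  have wH2 : H2 ^ 2 ≤ W := by rw [hW]; linarith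
  have hW0 : 0 ≤ W := (sq_nonneg _).trans wp
  have eε : |ε| ≤ B ^ 0 := by rw [abs_of_pos hε]; simpa using hε1
  have eh : |(1/2:ℝ)| ≤ B ^ 0 := by norm_num [abs_of_pos]
  rw [← pow_one B] at hr hr1 hσ hκ bq bF bH bR bT bρ bR1 bT1
  have hB' : 1 ≤ B := hB
  -- first group
  have a1 := prW 5 hB (abm (abm (abm eh bρ) bq) (abm eε bR1)) (by norm_num) wp wp
  have a2 := prW 5 hB (abm (abm (abm eh bρ) bq) (abm eε bR1)) (by norm_num) wq wq
  have a3 := prW' 5 hB (abm bR bρ) (by norm_num) wq wp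
  have a4 := prW 5 hB (abm bR bR1) (by norm_num) wH wq
  have a5 := prW 5 hB (abm bF bR) (by norm_num) wH wp1
  have a6 := prW 5 hB (abm bF bR) (by norm_num) wH wq2
  have a7 := prW 5 hB (abm (abm bF eε) bR1) (by norm_num) wH wq
  have a8 := prW 5 hB (abm (abm (abm (abm hσ bρ) bR) (abm eε bR1)) bq) (by norm_num) wH wH
  have a9 := prW' 5 hB (abm (abm (abm (abm hσ bR) bR) bρ) bT1) (by norm_num) wH wq
  have c1 := prW' 5 hB (abm (abm bR bR) (abm bR bH)) (by norm_num) wH wp1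
  have c2 := prW' 5 hB (abm (abm bR bR) (abm bR bH)) (by norm_num) wH wq2
  have c3 := prW' 5 hB (abm (abm bR bR) (abm bT bF)) (by norm_num) wH wp1
  have c4 := prW' 5 hB (abm (abm bR bR) (abm bT bF)) (by norm_num) wH wq2
  have c5 := prW' 5 hB (abm (abm bR bR) (abm (abm eε bF) bH)) (by norm_num) wH wp1
  have c6 := prW' 5 hB (abm (abm bR bR) (abm (abm eε bF) bH)) (by norm_num) wH wq2
  -- second group
  have e1 := prW' 5 hB bR1 (by norm_num) wp wp2
  have e2 := prW' 5 hB bR1 (by norm_num) wq wq2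
  have e3 := prW' 5 hB (abm hr1 bR1) (by norm_num) wq wp1
  have e4 := prW' 5 hB (abm hr1 bR1) (by norm_num) wq wq2
  have e5 := prW' 5 hB (abm (abm hκ bR) bR1) (by norm_num) wH wH2
  have g1 := prW 5 hB (abm (abm bR bR) bH) (by norm_num) wp1 wp1
  have g2 := prW 5 hB (abm (abm bR bR) bH) (by norm_num) wq2 wq2
  have g3 := prW 5 hB (abm (abm bR bR) bH) (by norm_num) wq1 wq1
  have g4 := prW 5 hB (abm (abm bR bR) bH) (by norm_num) wp2 wp2
  have g5 := prW 5 hB (abm (abm bR bR) bH) (by norm_num) wq1 wp2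
  have g6 := prW 5 hB (abm bR bR) (by norm_num) wH wq1
  have g7 := prW 5 hB (abm bR bR) (by norm_num) wH wp2
  have i1 := prW 5 hB (abm (abm (abm bR bR) bH) hr) (by norm_num) wp1 wp1
  have i2 := prW 5 hB (abm (abm (abm bR bR) bH) hr) (by norm_num) wq2 wq2
  have i3 := prW 5 hB (abm (abm (abm bR bR) bH) hr) (by norm_num) wp1 wq2
  have hb : 0 ≤ B ^ 5 * W := by positivity
  have S2 : -(R1 * (p * p2)) - (R1 * (q * q2)) - ((1 + r) * R1 * (q * p1)) - ((1 + r) * R1 * (q * q2))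
      - 2 * (κ * R * R1 * (H * H2)) + 2 * (R * R * H * (p1 * p1)) + 2 * (R * R * H * (q2 * q2))
      + (R * R * H * (q1 * q1)) + (R * R * H * (p2 * p2)) + 2 * (R * R * H * (q1 * p2))
      + 2 * (R * R * (H * q1)) + 2 * (R * R * (H * p2)) + (R * R * H * r * (p1 * p1))
      + (R * R * H * r * (q2 * q2)) + 2 * (R * R * H * r * (p1 * q2)) ≤ 22 * (B ^ 5 * W) := by
    linarith
  have S2' := mul_le_mul_of_nonneg_left S2 (mul_nonneg hμ hε.le)
  linarith

theorem cub_real {B X ε F q p1 q2 T T1 W : ℝ} (hX : 0 < X) (hε : 0 < ε) (hε1 : ε ≤ 1)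
    (bT : |T| ≤ B) (bT1 : |T1| ≤ B) (wq : q ^ 2 ≤ W) (wp1 : p1 ^ 2 ≤ W) (wq2 : q2 ^ 2 ≤ W) :
    1/2 * (F ^ 2 * (q * (ε * T1) - T * (p1 + q2))) ≤ 3 * X * W + B ^ 2 / X * (F ^ 2) ^ 2 := by
  have hB0 : 0 ≤ B := (abs_nonneg _).trans bT
  have key : ∀ c u : ℝ, c ^ 2 ≤ B ^ 2 → u ^ 2 ≤ W → 1/2 * (F ^ 2 * (c * u)) ≤ X * W + B ^ 2 / X * (F ^ 2) ^ 2 / 4 := by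
    intro c u hc hu
    have h1 : 1/2 * (F ^ 2 * (c * u)) ≤ X * u ^ 2 + c ^ 2 / X * (F ^ 2) ^ 2 / 4 := by
      have : X * u ^ 2 + c ^ 2 / X * (F ^ 2) ^ 2 / 4 - 1/2 * (F ^ 2 * (c * u))
          = (X * u - c * F ^ 2 / 2) ^ 2 / X + 1/2 * (F ^ 2 * (c * u)) := by
        field_simp; ring
      have h2 : X * u ^ 2 + c ^ 2 / X * (F ^ 2) ^ 2 / 4 - 1/2 * (F ^ 2 * (c * u))
          = (X * u - c * F ^ 2 / 4) ^ 2 / X + 3 / 16 * (c ^ 2 / X * (F ^ 2) ^ 2) := by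
        field_simp; ring
      have : 0 ≤ (X * u - c * F ^ 2 / 4) ^ 2 / X + 3 / 16 * (c ^ 2 / X * (F ^ 2) ^ 2) := by positivity
      linarith
    have h3 : c ^ 2 / X * (F ^ 2) ^ 2 ≤ B ^ 2 / X * (F ^ 2) ^ 2 := by gcongr
    have h4 : X * u ^ 2 ≤ X * W := by gcongr
    linarith
  have sT : T ^ 2 ≤ B ^ 2 := sq_le_sq' (neg_le_of_abs_le bT) (le_of_abs_le bT)
  have sT1 : (ε * T1) ^ 2 ≤ B ^ 2 := by
    have : T1 ^ 2 ≤ B ^ 2 := sq_le_sq' (neg_le_of_abs_le bT1) (le_of_abs_le bT1)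
    have h5 : ε ^ 2 ≤ 1 := by nlinarith
    nlinarith [sq_nonneg T1, sq_nonneg ε]
  have k1 := key (ε * T1) q sT1 wq
  have k2 := key (-T) p1 (by rwa [neg_sq]) wp1
  have k3 := key (-T) q2 (by rwa [neg_sq]) wq2
  have : 0 ≤ B ^ 2 / X * (F ^ 2) ^ 2 := by positivity
  nlinarith

namespace Sys
variable {B c0 r μ ε σ κ τ : ℝ}

/-- dissipation density -/
def V (S : Sys B c0 r μ ε σ κ τ) : SA := S.G + kk (ε ^ 2)⁻¹ * S.Z
/-- full quadratic density -/
def W (S : Sys B c0 r μ ε σ κ τ) : SA :=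
  S.p ^ 2 + S.q ^ 2 + S.G + kk (ε ^ 2)⁻¹ * S.h ^ 2 + kk (ε ^ 2)⁻¹ * S.Z

theorem scale {ε B h : ℝ} (hε : 0 < ε) (hh : |h| ≤ B * ε) : ∃ H, h = ε * H ∧ |H| ≤ B := by
  refine ⟨h / ε, by field_simp, ?_⟩
  rw [abs_div, abs_of_pos hε, div_le_iff₀ hε]; exact hh

set_option maxHeartbeats 1000000 in
theorem rem_le (S : Sys B c0 r μ ε σ κ τ) (t : ℝ) (ht : t ∈ Set.Icc 0 τ) (x : ℝ × ℝ) (hx : x ∈ Ω) :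
    S.Rem.1 (t, x) ≤ 22 * B ^ 5 * (1 + μ * ε) * S.W.1 (t, x) := by
  have hε := S.hε
  have hμ0 : 0 < μ := by linarith [S.hμ]
  obtain ⟨H, hH, bH⟩ := scale S.hε (S.bh t ht x hx)
  obtain ⟨F, hF, bF⟩ := scale S.hε (S.bf t ht x hx)
  obtain ⟨R1, hR1, bR1⟩ := scale S.hε (S.bR' t ht x hx)
  obtain ⟨T1, hT1, bT1⟩ := scale S.hε (S.bT' t ht x hx)
  obtain ⟨κ', hκ', bκ⟩ := scale hμ0 S.hκB
  have key := rem_real (p := S.p.1 (t, x)) (q := S.q.1 (t, x)) (p1 := (D1 S.p).1 (t, x))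
    (p2 := (D2 S.p).1 (t, x)) (q1 := (D1 S.q).1 (t, x)) (q2 := (D2 S.q).1 (t, x))
    (H1 := (D1 S.h).1 (t, x) / ε) (H2 := (D2 S.h).1 (t, x) / ε) S.hB S.hε S.hε1 hμ0.le S.hrB S.hrB1
    S.hσB bκ (S.bq t ht x hx) bF bH (S.bR t ht x hx) (S.bT t ht x hx) (S.bρ t ht x hx) bR1 bT1 rfl
  have hWW : S.W.1 (t, x) = (S.p.1 (t, x)) ^ 2 + S.q.1 (t, x) ^ 2 + ((D1 S.p).1 (t, x) ^ 2
      + (D2 S.p).1 (t, x) ^ 2 + (D1 S.q).1 (t, x) ^ 2 + (D2 S.q).1 (t, x) ^ 2) + H ^ 2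
      + (((D1 S.h).1 (t, x) / ε) ^ 2 + ((D2 S.h).1 (t, x) / ε) ^ 2) := by
    simp only [W, G, Z, mul_ap, add_ap, pow_ap, kk_ap, hH]
    field_simp
    try ring
  rw [hWW]
  refine le_trans (le_of_eq ?_) key
  simp only [Rem, Q, P, d, ρ, mul_ap, add_ap, sub_ap, pow_ap, kk_ap, hH, hF, hR1, hT1]
  rw [← hκ']
  field_simp

set_option maxHeartbeats 1000000 in
theorem cub_le (S : Sys B c0 r μ ε σ κ τ) {X : ℝ} (hX : 0 < X) (t : ℝ) (ht : t ∈ Set.Icc 0 τ)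
    (x : ℝ × ℝ) (hx : x ∈ Ω) :
    S.Cub.1 (t, x) ≤ 3 * X * S.W.1 (t, x) + B ^ 2 / X * ((kk (ε ^ 2)⁻¹ * S.f ^ 2) ^ 2).1 (t, x) := by
  have hε := S.hε
  obtain ⟨F, hF, bF⟩ := scale S.hε (S.bf t ht x hx)
  obtain ⟨T1, hT1, bT1⟩ := scale S.hε (S.bT' t ht x hx)
  have hk : 0 < (ε ^ 2)⁻¹ := by positivity
  have hWW : S.W.1 (t, x) = (S.p.1 (t, x)) ^ 2 + S.q.1 (t, x) ^ 2 + ((D1 S.p).1 (t, x) ^ 2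
      + (D2 S.p).1 (t, x) ^ 2 + (D1 S.q).1 (t, x) ^ 2 + (D2 S.q).1 (t, x) ^ 2)
      + (ε ^ 2)⁻¹ * S.h.1 (t, x) ^ 2
      + (ε ^ 2)⁻¹ * ((D1 S.h).1 (t, x) ^ 2 + (D2 S.h).1 (t, x) ^ 2) := by
    simp only [W, G, Z, mul_ap, add_ap, pow_ap, kk_ap]
  have key := cub_real (F := F) (q := S.q.1 (t, x)) (p1 := (D1 S.p).1 (t, x))
    (q2 := (D2 S.q).1 (t, x)) (W := S.W.1 (t, x)) hX hε S.hε1 (S.bT t ht x hx) bT1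
    (by rw [hWW]
        have : 0 ≤ (S.p.1 (t, x)) ^ 2 + ((D1 S.p).1 (t, x) ^ 2
          + (D2 S.p).1 (t, x) ^ 2 + (D1 S.q).1 (t, x) ^ 2 + (D2 S.q).1 (t, x) ^ 2)
          + (ε ^ 2)⁻¹ * S.h.1 (t, x) ^ 2
          + (ε ^ 2)⁻¹ * ((D1 S.h).1 (t, x) ^ 2 + (D2 S.h).1 (t, x) ^ 2) := by positivity
        linarith)
    (by rw [hWW]
        have : 0 ≤ (S.p.1 (t, x)) ^ 2 + S.q.1 (t, x) ^ 2 + (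
          (D2 S.p).1 (t, x) ^ 2 + (D1 S.q).1 (t, x) ^ 2 + (D2 S.q).1 (t, x) ^ 2)
          + (ε ^ 2)⁻¹ * S.h.1 (t, x) ^ 2
          + (ε ^ 2)⁻¹ * ((D1 S.h).1 (t, x) ^ 2 + (D2 S.h).1 (t, x) ^ 2) := by positivity
        linarith)
    (by rw [hWW]
        have : 0 ≤ (S.p.1 (t, x)) ^ 2 + S.q.1 (t, x) ^ 2 + ((D1 S.p).1 (t, x) ^ 2
          + (D2 S.p).1 (t, x) ^ 2 + (D1 S.q).1 (t, x) ^ 2)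
          + (ε ^ 2)⁻¹ * S.h.1 (t, x) ^ 2
          + (ε ^ 2)⁻¹ * ((D1 S.h).1 (t, x) ^ 2 + (D2 S.h).1 (t, x) ^ 2) := by positivity
        linarith)
  have e1 : ((kk (ε ^ 2)⁻¹ * S.f ^ 2) ^ 2).1 (t, x) = (F ^ 2) ^ 2 := by
    simp only [mul_ap, pow_ap, kk_ap, hF]; field_simp
  rw [e1]
  refine le_trans (le_of_eq ?_) key
  simp only [Cub, d, mul_ap, add_ap, sub_ap, pow_ap, kk_ap, hF, hT1]
  field_simp

theorem Ez (S : Sys B c0 r μ ε σ κ τ) (t : ℝ) : J S.V t = J (D1 S.p ^ 2) t + J (D2 S.p ^ 2) t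
    + J (D1 S.q ^ 2) t + J (D2 S.q ^ 2) t + (ε ^ 2)⁻¹ * (J (D1 S.h ^ 2) t + J (D2 S.h ^ 2) t) := by
  simp only [V, G, Z, J_add, J_kk]

theorem V_nonneg (S : Sys B c0 r μ ε σ κ τ) (t : ℝ) : 0 ≤ J S.V t := by
  have hε := S.hε
  rw [Ez]
  have := J_sq_nonneg (D1 S.p) t
  have := J_sq_nonneg (D2 S.p) t
  have := J_sq_nonneg (D1 S.q) t
  have := J_sq_nonneg (D2 S.q) t
  have := J_sq_nonneg (D1 S.h) t
  have := J_sq_nonneg (D2 S.h) t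
  positivity

theorem poin (S : Sys B c0 r μ ε σ κ τ) (t : ℝ) (ht : t ∈ Set.Icc 0 τ) :
    J (S.p ^ 2) t + J (S.q ^ 2) t + (ε ^ 2)⁻¹ * J (S.h ^ 2) t ≤ 4 * J S.V t := by
  have hε := S.hε
  have hp := poincare S.p t (fun x => S.vp t ht x 0 (Or.inl rfl)) (fun x => S.vp t ht x 1 (Or.inr rfl))
  have hq := poincare S.q t (fun x => S.vq t ht x 0 (Or.inl rfl)) (fun x => S.vq t ht x 1 (Or.inr rfl))
  have hh := poincare S.h t (fun x => S.vh t ht x 0 (Or.inl rfl)) (fun x => S.vh t ht x 1 (Or.inr rfl))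
  rw [Ez]
  have := J_sq_nonneg (D1 S.p) t
  have := J_sq_nonneg (D1 S.q) t
  have := J_sq_nonneg (D1 S.h) t
  have hk : 0 < (ε ^ 2)⁻¹ := by positivity
  have := mul_le_mul_of_nonneg_left hh hk.le
  have : 0 ≤ (ε ^ 2)⁻¹ * J (D1 S.h ^ 2) t := by positivity
  linarith

theorem W_le (S : Sys B c0 r μ ε σ κ τ) (t : ℝ) (ht : t ∈ Set.Icc 0 τ) : J S.W t ≤ 5 * J S.V t := by
  have := S.poin t ht
  have e : J S.W t = J (S.p ^ 2) t + J (S.q ^ 2) t + (ε ^ 2)⁻¹ * J (S.h ^ 2) t + J S.V t := by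
    simp only [W, V, J_add, J_kk]; ring
  linarith

theorem per_d (S : Sys B c0 r μ ε σ κ τ) : Per S.d := S.pp.D1.add S.pq.D2
theorem per_P (S : Sys B c0 r μ ε σ κ τ) : Per S.P :=
  ((S.pR.mul S.ph).add (S.pT.mul S.pf)).add (S.pf.mul S.ph)
theorem per_E0 (S : Sys B c0 r μ ε σ κ τ) : Per S.E0 :=
  (Per.kk _).mul (((((S.pR.add S.pf).mul S.pR).mul ((S.pp.pow 2).add (S.pq.pow 2))).add
    ((Per.kk _).mul (S.pT.mul (S.pf.pow 2)))).add ((Per.kk _).mul ((((S.pR.pow 2).mul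
    (S.pR.add S.pf)).mul (S.ph.pow 2)))))
theorem per_F1 (S : Sys B c0 r μ ε σ κ τ) : Per S.F1 :=
  (((((Per.X2.add S.pp).mul S.per_E0).add ((Per.kk _).mul ((S.pR.mul S.pp).mul S.per_P))).sub
    ((Per.kk _).mul (((S.pR.mul S.pp).mul S.pp.D1).add ((S.pR.mul S.pq).mul S.pq.D1)))).sub
    ((Per.kk _).mul ((S.pR.mul S.pp).mul S.per_d))).sub
    ((Per.kk _).mul (((S.pR.pow 2).mul S.ph).mul S.ph.D1))

theorem energy_diff (S : Sys B c0 r μ ε σ κ τ) (hM : 880 * B ^ 5 ≤ c0 ^ 4 * μ)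
    (hE : 880 * B ^ 5 * ε ≤ c0 ^ 4) (t : ℝ) (ht : t ∈ Set.Icc 0 τ) :
    J (Dt S.E0) t + c0 ^ 4 * μ / 2 * J S.V t
      ≤ 60 * B ^ 2 / (c0 ^ 4 * μ) * J ((kk (ε ^ 2)⁻¹ * S.f ^ 2) ^ 2) t := by
  have hε := S.hε
  have hc := S.hc0
  have hc1 := S.hc1
  have hB := S.hB
  have hμ0 : 0 < μ := by linarith [S.hμ]
  set X : ℝ := c0 ^ 4 * μ / 60 with hXd
  have hX : 0 < X := by positivity
  have i1 : J (D1 S.F1) t = 0 := J_D1 _ _ (fun x y => S.per_F1 t x y)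
  have i2 : J (D2 S.F2) t = 0 := by
    apply J_D2
    · intro x
      simp [F2, mul_ap, add_ap, sub_ap, S.vp t ht x 0 (Or.inl rfl), S.vq t ht x 0 (Or.inl rfl), S.vh t ht x 0 (Or.inl rfl)]
    · intro x
      simp [F2, mul_ap, add_ap, sub_ap, S.vp t ht x 1 (Or.inr rfl), S.vq t ht x 1 (Or.inr rfl), S.vh t ht x 1 (Or.inr rfl)]
  have pt : J (Dt S.E0 + D1 S.F1 + D2 S.F2 + kk (c0 ^ 4 * μ) * S.V) t
      ≤ J (kk (22 * B ^ 5 * (1 + μ * ε) + 3 * X) * S.W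
        + kk (B ^ 2 / X) * (kk (ε ^ 2)⁻¹ * S.f ^ 2) ^ 2) t := by
    apply J_mono
    intro x hx
    have h1 := S.identity0 t ht x hx
    have h2 := S.rem_le t ht x hx
    have h3 := S.cub_le hX t ht x hx
    have hR := S.lR t ht x hx
    have hdis : (kk (c0 ^ 4 * μ) * S.V).1 (t, x) ≤ (kk μ * (S.R * S.G) + kk (μ * (1 + r)) * (S.R * S.d ^ 2)
      + kk (κ * (ε ^ 2)⁻¹) * (S.R ^ 2 * S.Z)).1 (t, x) := by
      have hG : 0 ≤ S.G.1 (t, x) := by simp only [G, add_ap, pow_ap]; positivity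
      have hZ : 0 ≤ S.Z.1 (t, x) := by simp only [Z, add_ap, pow_ap]; positivity
      simp only [V, mul_ap, add_ap, pow_ap, kk_ap]
      have hk : 0 < (ε ^ 2)⁻¹ := by positivity
      have k1 : c0 ^ 4 ≤ S.R.1 (t, x) := by
        have : c0 ^ 4 ≤ c0 ^ 1 := pow_le_pow_of_le_one hc.le hc1 (by norm_num)
        linarith
      have k2 : c0 ^ 4 * μ ≤ κ * S.R.1 (t, x) ^ 2 := by
        have a1 : c0 ^ 2 ≤ S.R.1 (t, x) ^ 2 := pow_le_pow_left₀ hc.le hR 2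
        have a2 : c0 ^ 4 ≤ c0 ^ 3 := pow_le_pow_of_le_one hc.le hc1 (by norm_num)
        calc c0 ^ 4 * μ ≤ c0 ^ 3 * μ := by gcongr
          _ = (c0 * μ) * c0 ^ 2 := by ring
          _ ≤ κ * S.R.1 (t, x) ^ 2 := mul_le_mul S.hκ a1 (by positivity) ((by positivity : 0 ≤ c0 * μ).trans S.hκ)
      have hr := S.hr
      have hR0 : 0 < S.R.1 (t, x) := hc.trans_le hR
      have b1 : c0 ^ 4 * μ * S.G.1 (t, x) ≤ μ * (S.R.1 (t, x) * S.G.1 (t, x)) := by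
        have := mul_le_mul_of_nonneg_right k1 (mul_nonneg hμ0.le hG)
        linarith
      have b2 : 0 ≤ μ * (1 + r) * (S.R.1 (t, x) * S.d.1 (t, x) ^ 2) := by positivity
      have b3 := mul_le_mul_of_nonneg_right k2 (mul_nonneg hk.le hZ)
      linarith
    simp only [add_ap, mul_ap, kk_ap] at h1 h2 h3 hdis ⊢
    simp only [pow_ap, mul_ap, kk_ap] at h1 h2 h3 hdis ⊢
    linarith
  rw [J_add, J_add, J_add, J_add, J_kk, J_kk, J_kk, i1, i2] at pt
  have hW := S.W_le t ht
  have hV := S.V_nonneg t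
  have cf : 0 ≤ 22 * B ^ 5 * (1 + μ * ε) + 3 * X := by positivity
  have h1 := mul_le_mul_of_nonneg_left hW cf
  have h2 : 22 * B ^ 5 * (1 + μ * ε) * 5 + 3 * X * 5 ≤ c0 ^ 4 * μ / 2 := by
    have := mul_le_mul_of_nonneg_left hE hμ0.le
    rw [hXd]; linarith
  have h3 := mul_le_mul_of_nonneg_right h2 hV
  have h4 : B ^ 2 / X = 60 * B ^ 2 / (c0 ^ 4 * μ) := by rw [hXd]; field_simp
  rw [h4] at pt
  linarith
end Sys

namespace Sys
variable {B c0 r μ ε σ κ τ : ℝ}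

/-- size of the basic energy -/
def mm (S : Sys B c0 r μ ε σ κ τ) (s : ℝ) : ℝ :=
  J (S.p ^ 2) s + J (S.q ^ 2) s + (ε ^ 2)⁻¹ * J (S.f ^ 2) s + (ε ^ 2)⁻¹ * J (S.h ^ 2) s

/-- weighted second order norm of the density perturbation -/
def NN (S : Sys B c0 r μ ε σ κ τ) (s : ℝ) : ℝ :=
  (ε ^ 2)⁻¹ * (J (S.f ^ 2) s + J (D1 S.f ^ 2) s + J (D2 S.f ^ 2) s + J (D1 (D2 S.f) ^ 2) s)

theorem mm_cont (S : Sys B c0 r μ ε σ κ τ) : Continuous S.mm := by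
  unfold mm
  have := J_cont (S.p ^ 2)
  have := J_cont (S.q ^ 2)
  have := J_cont (S.f ^ 2)
  have := J_cont (S.h ^ 2)
  fun_prop

theorem NN_cont (S : Sys B c0 r μ ε σ κ τ) : Continuous S.NN := by
  unfold NN
  have := J_cont (S.f ^ 2)
  have := J_cont (D1 S.f ^ 2)
  have := J_cont (D2 S.f ^ 2)
  have := J_cont (D1 (D2 S.f) ^ 2)
  fun_prop

theorem mm_nonneg (S : Sys B c0 r μ ε σ κ τ) (s : ℝ) : 0 ≤ S.mm s := by
  have hε := S.hε
  have := J_sq_nonneg S.p s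
  have := J_sq_nonneg S.q s
  have := J_sq_nonneg S.f s
  have := J_sq_nonneg S.h s
  unfold mm; positivity

theorem NN_nonneg (S : Sys B c0 r μ ε σ κ τ) (s : ℝ) : 0 ≤ S.NN s := by
  have hε := S.hε
  have := J_sq_nonneg S.f s
  have := J_sq_nonneg (D1 S.f) s
  have := J_sq_nonneg (D2 S.f) s
  have := J_sq_nonneg (D1 (D2 S.f)) s
  unfold NN; positivity

theorem quartic (S : Sys B c0 r μ ε σ κ τ) (s : ℝ) :
    J ((kk (ε ^ 2)⁻¹ * S.f ^ 2) ^ 2) s ≤ 6 * S.NN s * S.mm s := by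
  have hε := S.hε
  have hk : 0 < (ε ^ 2)⁻¹ := by positivity
  have h1 : J ((kk (ε ^ 2)⁻¹ * S.f ^ 2) ^ 2) s ≤ J (kk (6 * S.NN s * (ε ^ 2)⁻¹) * S.f ^ 2) s := by
    apply J_mono
    intro x hx
    have h := supΩ S.f le_rfl s x hx
    simp only [mul_ap, pow_ap, kk_ap]
    have h' := mul_le_mul_of_nonneg_left h hk.le
    have h2 : (ε ^ 2)⁻¹ * S.f.1 (s, x) ^ 2 ≤ 6 * S.NN s := by
      refine h'.trans (le_of_eq ?_); unfold NN; ring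
    have h3 : 0 ≤ (ε ^ 2)⁻¹ * S.f.1 (s, x) ^ 2 := by positivity
    have := mul_le_mul_of_nonneg_right h2 h3
    linarith
  rw [J_kk] at h1
  refine h1.trans ?_
  have h4 : (ε ^ 2)⁻¹ * J (S.f ^ 2) s ≤ S.mm s := by
    have := J_sq_nonneg S.p s
    have := J_sq_nonneg S.q s
    have := J_sq_nonneg S.h s
    have : 0 ≤ (ε ^ 2)⁻¹ * J (S.h ^ 2) s := by positivity
    unfold mm; linarith
  have := mul_le_mul_of_nonneg_left h4 (S.NN_nonneg s)
  linarith

theorem E0_bounds (S : Sys B c0 r μ ε σ κ τ) (t : ℝ) (ht : t ∈ Set.Icc 0 τ) :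
    c0 ^ 4 / 2 * S.mm t ≤ J S.E0 t ∧ J S.E0 t ≤ B ^ 4 / 2 * S.mm t := by
  have hε := S.hε
  have hc := S.hc0
  have hc1 := S.hc1
  have hB := S.hB
  have hk : 0 < (ε ^ 2)⁻¹ := by positivity
  set U : SA := S.p ^ 2 + S.q ^ 2 + kk (ε ^ 2)⁻¹ * S.f ^ 2 + kk (ε ^ 2)⁻¹ * S.h ^ 2 with hU
  have e : S.mm t = J U t := by simp only [hU, mm, J_add, J_kk]
  rw [e, ← J_kk, ← J_kk]
  have key : ∀ x ∈ Ω, ∀ lo : ℝ, True → c0 ^ 4 ≤ (S.R.1 (t, x) + S.f.1 (t, x)) * S.R.1 (t, x) ∧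
      (S.R.1 (t, x) + S.f.1 (t, x)) * S.R.1 (t, x) ≤ B ^ 4 ∧ c0 ^ 4 ≤ S.T.1 (t, x) ∧ S.T.1 (t, x) ≤ B ^ 4
      ∧ c0 ^ 4 ≤ σ * (S.R.1 (t, x) ^ 2 * (S.R.1 (t, x) + S.f.1 (t, x)))
      ∧ σ * (S.R.1 (t, x) ^ 2 * (S.R.1 (t, x) + S.f.1 (t, x))) ≤ B ^ 4 := by
    intro x hx _ _
    have a1 := S.lR t ht x hx
    have a2 := S.lT t ht x hx
    have a3 := S.lρ t ht x hx
    have a4 := le_of_abs_le (S.bR t ht x hx)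
    have a5 := le_of_abs_le (S.bT t ht x hx)
    have a6 := le_of_abs_le (S.bρ t ht x hx)
    have a7 := S.hσ
    have a8 := le_of_abs_le S.hσB
    generalize S.R.1 (t, x) = R at *
    generalize S.R.1 (t, x) + S.f.1 (t, x) = ρ at *
    generalize S.T.1 (t, x) = T at *
    have p1 : c0 ^ 4 ≤ c0 ^ 1 := pow_le_pow_of_le_one hc.le hc1 (by norm_num)
    have p2 : c0 ^ 4 ≤ c0 ^ 2 := pow_le_pow_of_le_one hc.le hc1 (by norm_num)
    have p3 : B ^ 1 ≤ B ^ 4 := pow_le_pow_right₀ hB (by norm_num)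
    have p4 : B ^ 2 ≤ B ^ 4 := pow_le_pow_right₀ hB (by norm_num)
    have hR0 : 0 < R := by linarith
    have hρ0 : 0 < R + S.f.1 (t, x) := by linarith
    have hσ0 : 0 < σ := by linarith
    refine ⟨?_, ?_, ?_, ?_, ?_, ?_⟩
    · refine p2.trans ?_
      rw [pow_two]; exact mul_le_mul a3 a1 hc.le hρ0.le
    · refine le_trans ?_ p4
      rw [pow_two]; exact mul_le_mul a6 a4 hR0.le (by linarith)
    · linarith
    · linarith
    · calc c0 ^ 4 = c0 * (c0 ^ 2 * c0) := by ring
        _ ≤ _ := by gcongr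
    · calc σ * (R ^ 2 * (R + S.f.1 (t, x))) ≤ B * (B ^ 2 * B) := by gcongr
        _ = B ^ 4 := by ring
  constructor
  · apply J_mono
    intro x hx
    obtain ⟨k1, -, k3, -, k5, -⟩ := key x hx 0 trivial
    simp only [hU, E0, ρ, mul_ap, add_ap, pow_ap, kk_ap]
    have b1 := mul_le_mul_of_nonneg_right k1 (by positivity : 0 ≤ S.p.1 (t, x) ^ 2 + S.q.1 (t, x) ^ 2)
    have b2 := mul_le_mul_of_nonneg_right k3 (by positivity : 0 ≤ (ε ^ 2)⁻¹ * S.f.1 (t, x) ^ 2)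
    have b3 := mul_le_mul_of_nonneg_right k5 (by positivity : 0 ≤ (ε ^ 2)⁻¹ * S.h.1 (t, x) ^ 2)
    linarith
  · apply J_mono
    intro x hx
    obtain ⟨-, k1, -, k3, -, k5⟩ := key x hx 0 trivial
    simp only [hU, E0, ρ, mul_ap, add_ap, pow_ap, kk_ap]
    have b1 := mul_le_mul_of_nonneg_right k1 (by positivity : 0 ≤ S.p.1 (t, x) ^ 2 + S.q.1 (t, x) ^ 2)
    have b2 := mul_le_mul_of_nonneg_right k3 (by positivity : 0 ≤ (ε ^ 2)⁻¹ * S.f.1 (t, x) ^ 2)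
    have b3 := mul_le_mul_of_nonneg_right k5 (by positivity : 0 ≤ (ε ^ 2)⁻¹ * S.h.1 (t, x) ^ 2)
    linarith

/-- the basic energy estimate -/
theorem basic (S : Sys B c0 r μ ε σ κ τ) (hM : 880 * B ^ 5 ≤ c0 ^ 4 * μ)
    (hE : 880 * B ^ 5 * ε ≤ c0 ^ 4) (hM2 : 1440 * B ^ 3 ≤ c0 ^ 8 * μ) (t : ℝ) (ht : t ∈ Set.Icc 0 τ) :
    S.mm t ≤ 2 * B ^ 4 / c0 ^ 4 * S.mm 0 ∧
      ∫ s in (0 : ℝ)..t, J S.V s ≤ 2 * B ^ 4 / c0 ^ 4 * S.mm 0 := by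
  have hε := S.hε
  have hc := S.hc0
  have hB := S.hB
  have hμ0 : 0 < μ := by linarith [S.hμ]
  obtain ⟨s0, hs0, hmax⟩ := isCompact_Icc.exists_isMaxOn ⟨t, ht.1, le_rfl⟩
    (S.mm_cont.continuousOn (s := Set.Icc 0 t))
  have hmax' : ∀ s ∈ Set.Icc 0 t, S.mm s ≤ S.mm s0 := fun s hs => hmax hs
  have hM0 := S.mm_nonneg s0
  have Vc : Continuous (J S.V) := J_cont _
  have fin : ∀ t' ∈ Set.Icc 0 t, c0 ^ 4 / 2 * S.mm t' + c0 ^ 4 * μ / 2 * ∫ s in (0 : ℝ)..t', J S.V s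
      ≤ B ^ 4 / 2 * S.mm 0 + c0 ^ 4 / 4 * S.mm s0 := by
    intro t' ht'
    have ht2 : t' ∈ Set.Icc 0 τ := ⟨ht'.1, ht'.2.trans ht.2⟩
    have h1 : ∫ s in (0 : ℝ)..t', (J (Dt S.E0) s + c0 ^ 4 * μ / 2 * J S.V s)
        ≤ ∫ s in (0 : ℝ)..t', (360 * B ^ 2 / (c0 ^ 4 * μ) * S.mm s0) * S.NN s := by
      apply intervalIntegral.integral_mono_on ht'.1
      · exact ((J_cont _).add (continuous_const.mul Vc)).intervalIntegrable _ _
      · exact (continuous_const.mul S.NN_cont).intervalIntegrable _ _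
      · intro s hs
        refine (S.energy_diff hM hE s ⟨hs.1, hs.2.trans ht2.2⟩).trans ?_
        have q1 := S.quartic s
        have q2 := mul_le_mul_of_nonneg_left (hmax' s ⟨hs.1, hs.2.trans ht'.2⟩) (S.NN_nonneg s)
        have q3 : 0 ≤ 60 * B ^ 2 / (c0 ^ 4 * μ) := by positivity
        have q4 : J ((kk (ε ^ 2)⁻¹ * S.f ^ 2) ^ 2) s ≤ 6 * (S.NN s * S.mm s0) := by linarith
        refine (mul_le_mul_of_nonneg_left q4 q3).trans (le_of_eq ?_)
        ring
    have hi2 : IntervalIntegrable (fun s => c0 ^ 4 * μ / 2 * J S.V s) volume 0 t' :=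
      (continuous_const.mul Vc).intervalIntegrable _ _
    rw [intervalIntegral.integral_add ((J_cont _).intervalIntegrable _ _) hi2, J_Dt, intervalIntegral.integral_const_mul,
      intervalIntegral.integral_const_mul] at h1
    have h2 : ∫ s in (0 : ℝ)..t', S.NN s ≤ B := by
      refine le_trans ?_ S.nint
      change _ ≤ ∫ s in (0 : ℝ)..τ, S.NN s
      exact intervalIntegral.integral_mono_interval le_rfl ht'.1 ht2.2
        (ae_of_all _ fun s => S.NN_nonneg s) (S.NN_cont.intervalIntegrable _ _)
    have h3 : 360 * B ^ 2 / (c0 ^ 4 * μ) * S.mm s0 * (∫ s in (0 : ℝ)..t', S.NN s)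
        ≤ c0 ^ 4 / 4 * S.mm s0 := by
      have a1 : 360 * B ^ 2 / (c0 ^ 4 * μ) * S.mm s0 * (∫ s in (0 : ℝ)..t', S.NN s)
          ≤ 360 * B ^ 2 / (c0 ^ 4 * μ) * S.mm s0 * B :=
        mul_le_mul_of_nonneg_left h2 (by positivity)
      have a2 : 360 * B ^ 2 / (c0 ^ 4 * μ) * B ≤ c0 ^ 4 / 4 := by
        rw [div_mul_eq_mul_div, div_le_iff₀ (by positivity)]
        nlinarith
      have := mul_le_mul_of_nonneg_right a2 hM0
      linarith
    have h4 := (S.E0_bounds t' ht2).1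
    have h5 := (S.E0_bounds 0 ⟨le_rfl, ht.1.trans ht.2⟩).2
    linarith
  have hVi : ∀ t' ∈ Set.Icc 0 t, 0 ≤ ∫ s in (0 : ℝ)..t', J S.V s := fun t' ht' =>
    intervalIntegral.integral_nonneg ht'.1 fun s _ => S.V_nonneg s
  have f1 := fin s0 hs0
  have f2 : S.mm s0 ≤ 2 * B ^ 4 / c0 ^ 4 * S.mm 0 := by
    have : 0 ≤ c0 ^ 4 * μ / 2 * ∫ s in (0 : ℝ)..s0, J S.V s := mul_nonneg (by positivity) (hVi s0 hs0)
    rw [div_mul_eq_mul_div, le_div_iff₀ (by positivity)]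
    linarith
  have htt : t ∈ Set.Icc 0 t := ⟨ht.1, le_rfl⟩
  refine ⟨(hmax' t htt).trans f2, ?_⟩
  have f3 := fin t htt
  have hmt := S.mm_nonneg t
  have f4 : c0 ^ 4 / 2 * ∫ s in (0 : ℝ)..t, J S.V s ≤ c0 ^ 4 * μ / 2 * ∫ s in (0 : ℝ)..t, J S.V s := by
    apply mul_le_mul_of_nonneg_right _ (hVi t htt)
    have : 0 < c0 ^ 4 := by positivity
    nlinarith [S.hμ]
  have f5 : c0 ^ 4 * S.mm s0 ≤ 2 * B ^ 4 * S.mm 0 := by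
    rw [div_mul_eq_mul_div, le_div_iff₀ (by positivity)] at f2
    linarith
  have f6 : 0 ≤ c0 ^ 4 / 2 * S.mm t := by positivity
  rw [div_mul_eq_mul_div, le_div_iff₀ (by positivity)]
  linarith
end Sys

theorem sq_le_of_abs {a B : ℝ} (h : |a| ≤ B) : a ^ 2 ≤ B ^ 2 :=
  sq_le_sq' (neg_le_of_abs_le h) (le_of_abs_le h)

theorem sq4 (a b c d : ℝ) : (a + b + c + d) ^ 2 ≤ 4 * (a ^ 2 + b ^ 2 + c ^ 2 + d ^ 2) := by
  nlinarith [sq_nonneg (a - b), sq_nonneg (a - c), sq_nonneg (a - d), sq_nonneg (b - c), sq_nonneg (b - d),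
    sq_nonneg (c - d)]

theorem sq3 (a b c : ℝ) : (a + b + c) ^ 2 ≤ 3 * (a ^ 2 + b ^ 2 + c ^ 2) := by
  nlinarith [sq_nonneg (a - b), sq_nonneg (a - c), sq_nonneg (b - c)]

theorem sq2 (a b : ℝ) : (a + b) ^ 2 ≤ 2 * (a ^ 2 + b ^ 2) := by
  nlinarith [sq_nonneg (a - b)]

theorem mulsq {a A b : ℝ} (h : a ^ 2 ≤ A) : (a * b) ^ 2 ≤ A * b ^ 2 := by
  rw [mul_pow]; exact mul_le_mul_of_nonneg_right h (sq_nonneg b)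

theorem young {c : ℝ} (hc : 0 < c) (a b : ℝ) : a * b ≤ c / 8 * b ^ 2 + 2 / c * a ^ 2 := by
  have : c / 8 * b ^ 2 + 2 / c * a ^ 2 - a * b = (c * b / 4 - a * 1) ^ 2 * (2 / c)  + 0 := by
    field_simp; ring
  have h2 : 0 ≤ (c * b / 4 - a * 1) ^ 2 * (2 / c) := by positivity
  linarith

namespace Sys
variable {B c0 r μ ε σ κ τ : ℝ}

/-- estimate of the time derivative of the density perturbation -/
theorem dtf (S : Sys B c0 r μ ε σ κ τ) (t : ℝ) (ht : t ∈ Set.Icc 0 τ) :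
    J (Dt S.f ^ 2) t ≤ 40 * B ^ 2 * (J (D1 S.f ^ 2) t + J (S.p ^ 2) t + J (S.q ^ 2) t + J S.G t) := by
  have hB := S.hB
  have hε := S.hε
  have h1 : J (Dt S.f ^ 2) t ≤ J (kk (16 * B ^ 2) * D1 S.f ^ 2 + kk 4 * (S.q ^ 2 * D2 S.f ^ 2)
      + kk (8 * B ^ 2) * (D1 S.p ^ 2 + D2 S.q ^ 2) + kk (4 * B ^ 2) * S.q ^ 2) t := by
    apply J_mono
    intro x hx
    have hm := S.mass t ht x hx
    have hX : X2.1 (t, x) = x.2 := X2_ap _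
    have hx2 : x.2 ∈ Set.Ioo (0:ℝ) 1 := hx.2
    have hp := S.bp t ht x hx
    have hρ := sq_le_of_abs (S.bρ t ht x hx)
    have hR := S.bR' t ht x hx
    have hRB : ((D2 S.R).1 (t, x)) ^ 2 ≤ B ^ 2 := sq_le_of_abs (hR.trans (by nlinarith [S.hε1]))
    have hXp : (X2.1 (t, x) + S.p.1 (t, x)) ^ 2 ≤ 4 * B ^ 2 := by
      have : |X2.1 (t, x) + S.p.1 (t, x)| ≤ 2 * B := by
        rw [hX]
        refine (abs_add_le _ _).trans ?_
        rw [abs_of_pos hx2.1]; linarith [hx2.2]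
      have := sq_le_of_abs this
      linarith
    simp only [mul_ap, add_ap, pow_ap, kk_ap] at hm ⊢
    have e : (Dt S.f).1 (t, x) = -((X2.1 (t, x) + S.p.1 (t, x)) * (D1 S.f).1 (t, x)
      + S.q.1 (t, x) * (D2 S.f).1 (t, x)
      + (S.R.1 (t, x) + S.f.1 (t, x)) * ((D1 S.p).1 (t, x) + (D2 S.q).1 (t, x))
      + (D2 S.R).1 (t, x) * S.q.1 (t, x)) := by linarith
    rw [e, neg_sq]
    refine (sq4 _ _ _ _).trans ?_
    have a1 := mulsq (b := (D1 S.f).1 (t, x)) hXp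
    have a2 := mulsq (b := (D1 S.p).1 (t, x) + (D2 S.q).1 (t, x)) hρ
    have a3 := mulsq (b := S.q.1 (t, x)) hRB
    have a4 := mul_le_mul_of_nonneg_left (sq2 ((D1 S.p).1 (t, x)) ((D2 S.q).1 (t, x))) (sq_nonneg B)
    have a5 : (S.q.1 (t, x) * (D2 S.f).1 (t, x)) ^ 2 = S.q.1 (t, x) ^ 2 * (D2 S.f).1 (t, x) ^ 2 := mul_pow _ _ _
    linarith
  simp only [J_add, J_kk] at h1
  have h2 := aniso S.q (D2 S.f) one_pos one_pos t
  obtain ⟨n1, n2, n3⟩ := S.nf t ht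
  have q0 := J_sq_nonneg S.q t
  have q1 := J_sq_nonneg (D1 S.q) t
  have q2 := J_sq_nonneg (D2 S.q) t
  have p0 := J_sq_nonneg S.p t
  have p1 := J_sq_nonneg (D1 S.p) t
  have p2 := J_sq_nonneg (D2 S.p) t
  have f1 := J_sq_nonneg (D1 S.f) t
  have h3 : J (S.q ^ 2 * D2 S.f ^ 2) t ≤ (2 * J (S.q ^ 2) t + J (D1 S.q ^ 2) t) * (3 * B) := by
    refine h2.trans ?_
    have e1 : (1 + 1) * J (S.q ^ 2) t + 1⁻¹ * J (D1 S.q ^ 2) t = 2 * J (S.q ^ 2) t + J (D1 S.q ^ 2) t := by ring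
    rw [e1]
    apply mul_le_mul_of_nonneg_left _ (by positivity)
    rw [inv_one]; linarith
  have eG : J S.G t = J (D1 S.p ^ 2) t + J (D2 S.p ^ 2) t + J (D1 S.q ^ 2) t + J (D2 S.q ^ 2) t := by
    simp only [G, J_add]
  have hBB : B ≤ B ^ 2 := by nlinarith
  have b1 := mul_le_mul_of_nonneg_right hBB q0
  have b2 := mul_le_mul_of_nonneg_right hBB q1
  have z1 : 0 ≤ B ^ 2 * J (D1 S.f ^ 2) t := by positivity
  have z2 : 0 ≤ B ^ 2 * J (S.p ^ 2) t := by positivity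
  have z3 : 0 ≤ B ^ 2 * J (S.q ^ 2) t := by positivity
  have z4 : 0 ≤ B ^ 2 * J (D1 S.p ^ 2) t := by positivity
  have z5 : 0 ≤ B ^ 2 * J (D2 S.p ^ 2) t := by positivity
  have z6 : 0 ≤ B ^ 2 * J (D1 S.q ^ 2) t := by positivity
  have z7 : 0 ≤ B ^ 2 * J (D2 S.q ^ 2) t := by positivity
  rw [eG]
  linarith

/-- first order energy density -/
def E1 (S : Sys B c0 r μ ε σ κ τ) : SA :=
  kk (1/2 * μ) * S.G + kk (1/2 * (μ * (1 + r))) * S.d ^ 2 + kk (1/2 * (κ * (ε ^ 2)⁻¹)) * S.Z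
    - kk (ε ^ 2)⁻¹ * (S.P * S.d)
/-- first flux -/
def K1 (S : Sys B c0 r μ ε σ κ τ) : SA :=
  kk (ε ^ 2)⁻¹ * (S.P * Dt S.p) - kk μ * (Dt S.p * D1 S.p + Dt S.q * D1 S.q)
    - kk (μ * (1 + r)) * (S.d * Dt S.p) - kk (κ * (ε ^ 2)⁻¹) * (Dt S.h * D1 S.h)
/-- second flux -/
def K2 (S : Sys B c0 r μ ε σ κ τ) : SA :=
  kk (ε ^ 2)⁻¹ * (S.P * Dt S.q) - kk μ * (Dt S.p * D2 S.p + Dt S.q * D2 S.q)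
    - kk (μ * (1 + r)) * (S.d * Dt S.q) - kk (κ * (ε ^ 2)⁻¹) * (Dt S.h * D2 S.h)

set_option maxHeartbeats 1000000 in
theorem identity1 (S : Sys B c0 r μ ε σ κ τ) (t : ℝ) (ht : t ∈ Set.Icc 0 τ) (x : ℝ × ℝ) (hx : x ∈ Ω) :
    (Dt S.E1 + D1 S.K1 + D2 S.K2 + S.ρ * (Dt S.p ^ 2 + Dt S.q ^ 2)
      + kk ((ε ^ 2)⁻¹ * σ) * (S.ρ * Dt S.h ^ 2)).1 (t, x)
    = (Dt S.p * (kk (-1) * S.ρ * ((X2 + S.p) * D1 S.p + S.q * D2 S.p + S.q))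
      + Dt S.q * (kk (-1) * S.ρ * ((X2 + S.p) * D1 S.q + S.q * D2 S.q))
      - kk (ε ^ 2)⁻¹ * ((S.ρ * Dt S.h + (S.T + S.h) * Dt S.f) * S.d)
      - kk (ε ^ 2)⁻¹ * ((kk σ * S.ρ * ((X2 + S.p) * D1 S.h + S.q * D2 S.h + S.q * D2 S.T)
        + S.ρ * (S.T + S.h) * S.d) * Dt S.h) + S.Q * Dt S.h).1 (t, x) := by
  have hm1 := S.mom1 t ht x hx
  have hm2 := S.mom2 t ht x hx
  have hen := S.ener t ht x hx
  have hk : (ε ^ 2)⁻¹ * ε ^ 2 = 1 := inv_mul_cancel₀ (by have := S.hε; positivity)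
  simp only [E1, K1, K2, G, Z, Q, P, d, ρ, Dt_mul, Dt_add, Dt_sub, Dt_sq, Dt_kk, D1_mul, D1_add,
    D1_sub, D1_sq, D1_kk, D2_mul, D2_add, D2_sub, D2_sq, D2_kk, Dt_X2, D1_X2, D2_X2, S.D1R, S.D1T, S.DtR,
    S.DtT, D2_D1, Dt_D1, Dt_D2, mul_ap, add_ap, sub_ap, pow_ap, kk_ap, zero_ap, one_ap] at hm1 hm2 hen ⊢
  generalize S.p.1 (t, x) = p at *
  generalize S.q.1 (t, x) = q at *
  generalize S.f.1 (t, x) = f at *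
  generalize S.h.1 (t, x) = h at *
  generalize S.R.1 (t, x) = R at *
  generalize S.T.1 (t, x) = T at *
  generalize (ε ^ 2)⁻¹ = k at *
  linear_combination (Dt S.p).1 (t, x) * hm1 + (Dt S.q).1 (t, x) * hm2 + (k * (Dt S.h).1 (t, x)) * hen
    + (Dt S.h).1 (t, x) * (2 * μ * ((D1 S.p).1 (t, x) ^ 2 + (D2 S.q).1 (t, x) ^ 2
      + 1 / 2 * ((D1 S.q).1 (t, x) + (D2 S.p).1 (t, x)) ^ 2)
      + 2 * μ * ((D1 S.q).1 (t, x) + (D2 S.p).1 (t, x))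
      + r * μ * ((D1 S.p).1 (t, x) + (D2 S.q).1 (t, x)) ^ 2) * hk
end Sys

set_option maxHeartbeats 2000000 in
theorem rhs_real {B c r μ ε k σ q p1 p2 q1 q2 h1 h2 u v w Ft X ρ θ T1 G Z : ℝ} (hB : 1 ≤ B)
    (hc : 0 < c) (hc1 : c ≤ 1) (hk1 : 1 ≤ k) (hkε : k * ε ^ 2 = 1) (hμ : 1 ≤ μ)
    (hr : |r| ≤ B) (hσ : |σ| ≤ B) (bX : |X| ≤ 2 * B) (bq : |q| ≤ B) (bρ : |ρ| ≤ B) (bθ : |θ| ≤ 2 * B)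
    (bT1 : |T1| ≤ B) (hG : G = p1 ^ 2 + p2 ^ 2 + q1 ^ 2 + q2 ^ 2) (hZ : Z = h1 ^ 2 + h2 ^ 2) :
    u * (-1 * ρ * (X * p1 + q * p2 + q)) + v * (-1 * ρ * (X * q1 + q * q2))
    - k * ((ρ * w + θ * Ft) * (p1 + q2))
    - k * ((σ * ρ * (X * h1 + q * h2 + q * T1) + ρ * θ * (p1 + q2)) * w)
    + (2 * μ * (p1 ^ 2 + q2 ^ 2 + 1 / 2 * (q1 + p2) ^ 2) + 2 * μ * (q1 + p2) + r * μ * (p1 + q2) ^ 2) * w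
    ≤ c / 2 * (u ^ 2 + v ^ 2 + k * w ^ 2) + k * Ft ^ 2 + 128 / c * (B ^ 6 * μ ^ 2 * k) * (G + k * Z + q ^ 2)
      + 64 / c * (μ ^ 2 * B ^ 2) * (ε ^ 2 * G ^ 2) := by
  have hk0 : 0 < k := by linarith
  have hB0 : 0 < B := by linarith
  have sX : X ^ 2 ≤ 4 * B ^ 2 := by have := sq_le_of_abs bX; linarith
  have sq' := sq_le_of_abs bq
  have sρ := sq_le_of_abs bρ
  have sσ := sq_le_of_abs hσ
  have sr := sq_le_of_abs hr
  have sT := sq_le_of_abs bT1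
  have sθ : θ ^ 2 ≤ 4 * B ^ 2 := by have := sq_le_of_abs bθ; linarith
  have hG0 : 0 ≤ G := by rw [hG]; positivity
  have hZ0 : 0 ≤ Z := by rw [hZ]; positivity
  have g1 : p1 ^ 2 ≤ G := by rw [hG]; linarith [sq_nonneg p1, sq_nonneg p2, sq_nonneg q1, sq_nonneg q2]
  have gd : (p1 + q2) ^ 2 ≤ 2 * G := by
    refine (sq2 _ _).trans ?_
    rw [hG]; linarith [sq_nonneg p1, sq_nonneg p2, sq_nonneg q1, sq_nonneg q2]
  have ge : (q1 + p2) ^ 2 ≤ 2 * G := by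
    refine (sq2 _ _).trans ?_
    rw [hG]; linarith [sq_nonneg p1, sq_nonneg p2, sq_nonneg q1, sq_nonneg q2]
  set d := p1 + q2 with hd
  set e := q1 + p2 with he
  have B2 : 1 ≤ B ^ 2 := one_le_pow₀ hB
  have B4 : B ^ 4 ≤ B ^ 6 := pow_le_pow_right₀ hB (by norm_num)
  have B26 : B ^ 2 ≤ B ^ 6 := pow_le_pow_right₀ hB (by norm_num)
  have B06 : 1 ≤ B ^ 6 := one_le_pow₀ hB
  -- A1
  have a1 : (ρ * (X * p1 + q * p2 + q)) ^ 2 ≤ 12 * B ^ 4 * (G + q ^ 2) := by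
    have i1 := mulsq (b := p1) sX
    have i2 := mulsq (b := p2) sq'
    have i3 := sq3 (X * p1) (q * p2) q
    have i4 : q ^ 2 ≤ B ^ 2 * q ^ 2 := le_mul_of_one_le_left (sq_nonneg _) B2
    have i5 : (X * p1 + q * p2 + q) ^ 2 ≤ 12 * B ^ 2 * (G + q ^ 2) := by
      rw [hG]
      have z1 : 0 ≤ B ^ 2 * p2 ^ 2 := by positivity
      have z2 : 0 ≤ B ^ 2 * q1 ^ 2 := by positivity
      have z3 : 0 ≤ B ^ 2 * q2 ^ 2 := by positivity
      have z4 : 0 ≤ B ^ 2 * q ^ 2 := by positivity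
      linarith
    calc (ρ * (X * p1 + q * p2 + q)) ^ 2 ≤ B ^ 2 * (X * p1 + q * p2 + q) ^ 2 := mulsq sρ
      _ ≤ B ^ 2 * (12 * B ^ 2 * (G + q ^ 2)) := by gcongr
      _ = 12 * B ^ 4 * (G + q ^ 2) := by ring
  have a2 : (ρ * (X * q1 + q * q2)) ^ 2 ≤ 8 * B ^ 4 * G := by
    have i1 := mulsq (b := q1) sX
    have i2 := mulsq (b := q2) sq'
    have i3 := sq2 (X * q1) (q * q2)
    have i5 : (X * q1 + q * q2) ^ 2 ≤ 8 * B ^ 2 * G := by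
      rw [hG]
      have z1 : 0 ≤ B ^ 2 * p2 ^ 2 := by positivity
      have z2 : 0 ≤ B ^ 2 * p1 ^ 2 := by positivity
      have z3 : 0 ≤ B ^ 2 * q2 ^ 2 := by positivity
      linarith
    calc (ρ * (X * q1 + q * q2)) ^ 2 ≤ B ^ 2 * (X * q1 + q * q2) ^ 2 := mulsq sρ
      _ ≤ B ^ 2 * (8 * B ^ 2 * G) := by gcongr
      _ = 8 * B ^ 4 * G := by ring
  have a3 : (ρ * d) ^ 2 ≤ 2 * B ^ 2 * G := by
    refine (mulsq sρ).trans ?_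
    have := mul_le_mul_of_nonneg_left gd (sq_nonneg B)
    linarith
  have a4 : -(θ * Ft * d) ≤ Ft ^ 2 + 2 * B ^ 2 * G := by
    have i1 : (θ * d) ^ 2 ≤ 8 * B ^ 2 * G := by
      refine (mulsq sθ).trans ?_
      have := mul_le_mul_of_nonneg_left gd (sq_nonneg B)
      linarith
    have i2 : (2 * Ft + θ * d) ^ 2 = 4 * Ft ^ 2 + 4 * (θ * Ft * d) + (θ * d) ^ 2 := by ring
    have i3 := sq_nonneg (2 * Ft + θ * d)
    linarith
  have a5 : (σ * ρ * (X * h1 + q * h2 + q * T1) + ρ * θ * d) ^ 2 ≤ 24 * B ^ 6 * (Z + q ^ 2 + G) := by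
    have i1 := mulsq (b := h1) sX
    have i2 := mulsq (b := h2) sq'
    have i4 : (q * T1) ^ 2 ≤ B ^ 2 * q ^ 2 := by rw [mul_comm q T1]; exact mulsq sT
    have i3 := sq3 (X * h1) (q * h2) (q * T1)
    have i5 : (X * h1 + q * h2 + q * T1) ^ 2 ≤ 12 * B ^ 2 * (Z + q ^ 2) := by
      rw [hZ]
      have z1 : 0 ≤ B ^ 2 * h2 ^ 2 := by positivity
      have z2 : 0 ≤ B ^ 2 * h1 ^ 2 := by positivity
      have z3 : 0 ≤ B ^ 2 * q ^ 2 := by positivity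
      linarith
    have i6 : (σ * ρ) ^ 2 ≤ B ^ 4 := by
      calc (σ * ρ) ^ 2 ≤ B ^ 2 * ρ ^ 2 := mulsq sσ
        _ ≤ B ^ 2 * B ^ 2 := by gcongr
        _ = B ^ 4 := by ring
    have i7 : (σ * ρ * (X * h1 + q * h2 + q * T1)) ^ 2 ≤ 12 * B ^ 6 * (Z + q ^ 2) := by
      calc _ ≤ B ^ 4 * (X * h1 + q * h2 + q * T1) ^ 2 := mulsq i6
        _ ≤ B ^ 4 * (12 * B ^ 2 * (Z + q ^ 2)) := by gcongr
        _ = _ := by ring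
    have i8 : (ρ * θ) ^ 2 ≤ 4 * B ^ 4 := by
      calc (ρ * θ) ^ 2 ≤ B ^ 2 * θ ^ 2 := mulsq sρ
        _ ≤ B ^ 2 * (4 * B ^ 2) := by gcongr
        _ = _ := by ring
    have i9 : (ρ * θ * d) ^ 2 ≤ 8 * B ^ 6 * G := by
      calc _ ≤ 4 * B ^ 4 * d ^ 2 := mulsq i8
        _ ≤ 4 * B ^ 6 * (2 * G) := by gcongr
        _ = _ := by ring
    have i10 := sq2 (σ * ρ * (X * h1 + q * h2 + q * T1)) (ρ * θ * d)
    have z1 : 0 ≤ B ^ 6 * G := by positivity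
    linarith
  have a6 : (2 * μ * (p1 ^ 2 + q2 ^ 2 + 1 / 2 * e ^ 2) + 2 * μ * e + r * μ * d ^ 2) ^ 2
      ≤ μ ^ 2 * (32 * B ^ 2 * G ^ 2 + 16 * G) := by
    have i1 : |2 * (p1 ^ 2 + q2 ^ 2 + 1 / 2 * e ^ 2) + r * d ^ 2| ≤ 4 * B * G := by
      have j0 : 0 ≤ 2 * (p1 ^ 2 + q2 ^ 2 + 1 / 2 * e ^ 2) := by positivity
      have j1 : 2 * (p1 ^ 2 + q2 ^ 2 + 1 / 2 * e ^ 2) ≤ 2 * G := by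
        rw [hG, he]; nlinarith [sq_nonneg (q1 - p2)]
      have j2 : |r * d ^ 2| ≤ 2 * B * G := by
        rw [abs_mul, abs_of_nonneg (sq_nonneg d)]
        calc |r| * d ^ 2 ≤ B * (2 * G) := by gcongr
          _ = _ := by ring
      refine (abs_add_le _ _).trans ?_
      rw [abs_of_nonneg j0]
      have : G ≤ B * G := le_mul_of_one_le_left hG0 hB
      linarith
    have i2 := sq_le_of_abs i1
    have i3 := sq2 (2 * (p1 ^ 2 + q2 ^ 2 + 1 / 2 * e ^ 2) + r * d ^ 2) (2 * e)
    calc _ = μ ^ 2 * ((2 * (p1 ^ 2 + q2 ^ 2 + 1 / 2 * e ^ 2) + r * d ^ 2) + 2 * e) ^ 2 := by ring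
      _ ≤ _ := by
        apply mul_le_mul_of_nonneg_left _ (sq_nonneg μ)
        linarith
  -- Young
  have y1 := young hc (-1 * ρ * (X * p1 + q * p2 + q)) u
  have y2 := young hc (-1 * ρ * (X * q1 + q * q2)) v
  have y3 := mul_le_mul_of_nonneg_left (young hc (-(ρ * d)) w) hk0.le
  have y4 := mul_le_mul_of_nonneg_left (young hc (-(σ * ρ * (X * h1 + q * h2 + q * T1) + ρ * θ * d)) w) hk0.le
  have y5 := mul_le_mul_of_nonneg_left (young hc
    (ε ^ 2 * (2 * μ * (p1 ^ 2 + q2 ^ 2 + 1 / 2 * e ^ 2) + 2 * μ * e + r * μ * d ^ 2)) w) hk0.le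
  set Q := 2 * μ * (p1 ^ 2 + q2 ^ 2 + 1 / 2 * e ^ 2) + 2 * μ * e + r * μ * d ^ 2 with hQ
  have eQ1 : k * (ε ^ 2 * Q * w) = Q * w := by linear_combination (Q * w) * hkε
  have eQ2 : k * (2 / c * (ε ^ 2 * Q) ^ 2) = 2 / c * (ε ^ 2 * Q ^ 2) := by
    linear_combination (2 / c * Q ^ 2 * ε ^ 2) * hkε
  set m := 2 / c with hm
  have hm0 : 0 < m := by positivity
  have hm1 : 1 ≤ m := by rw [hm, le_div_iff₀ hc]; linarith
  have e126 : 128 / c = 64 * m := by rw [hm]; ring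
  have e64 : 64 / c = 32 * m := by rw [hm]; ring
  rw [e126, e64]
  have μ2 : 1 ≤ μ ^ 2 := one_le_pow₀ hμ
  have hε2 : ε ^ 2 ≤ 1 := by
    have : ε ^ 2 ≤ k * ε ^ 2 := le_mul_of_one_le_left (sq_nonneg _) hk1
    rwa [hkε] at this
  set Y := G + k * Z + q ^ 2 with hY
  have hkZ : Z ≤ k * Z := le_mul_of_one_le_left hZ0 hk1
  have hY0 : 0 ≤ Y := by positivity
  have hGY : G ≤ Y := by rw [hY]; linarith [sq_nonneg q]
  have hGqY : G + q ^ 2 ≤ Y := by rw [hY]; linarith [sq_nonneg q]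
  have hZqY : Z + q ^ 2 + G ≤ Y := by rw [hY]; linarith [sq_nonneg q]
  set N := B ^ 6 * μ ^ 2 * k with hN
  have hN1 : B ^ 6 * k ≤ N := by
    rw [hN]
    have : B ^ 6 * k * 1 ≤ B ^ 6 * k * μ ^ 2 := by gcongr
    linarith
  have hN2 : B ^ 6 ≤ N := by
    have : B ^ 6 * 1 ≤ B ^ 6 * k := by gcongr
    linarith
  have hN3 : μ ^ 2 ≤ N := by
    have : 1 * μ ^ 2 * 1 ≤ B ^ 6 * μ ^ 2 * k := by gcongr
    linarith
  have f1 : (-1 * ρ * (X * p1 + q * p2 + q)) ^ 2 ≤ 12 * (N * Y) := by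
    calc _ = (ρ * (X * p1 + q * p2 + q)) ^ 2 := by ring
      _ ≤ 12 * B ^ 4 * (G + q ^ 2) := a1
      _ ≤ 12 * N * Y := by
        have : B ^ 4 ≤ N := B4.trans hN2
        gcongr
      _ = _ := by ring
  have f2 : (-1 * ρ * (X * q1 + q * q2)) ^ 2 ≤ 8 * (N * Y) := by
    calc _ = (ρ * (X * q1 + q * q2)) ^ 2 := by ring
      _ ≤ 8 * B ^ 4 * G := a2
      _ ≤ 8 * N * Y := by
        have : B ^ 4 ≤ N := B4.trans hN2
        gcongr
      _ = _ := by ring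
  have f3 : k * (-(ρ * d)) ^ 2 ≤ 2 * (N * Y) := by
    calc _ = k * (ρ * d) ^ 2 := by ring
      _ ≤ k * (2 * B ^ 2 * G) := by gcongr
      _ = 2 * (B ^ 2 * k) * G := by ring
      _ ≤ 2 * (B ^ 6 * k) * G := by gcongr
      _ ≤ 2 * N * Y := by gcongr
      _ = _ := by ring
  have f4 : k * -(θ * Ft * d) ≤ k * Ft ^ 2 + 2 * (N * Y) := by
    have := mul_le_mul_of_nonneg_left a4 hk0.le
    have f4' : k * (2 * B ^ 2 * G) ≤ 2 * (N * Y) := by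
      calc _ = 2 * (B ^ 2 * k) * G := by ring
        _ ≤ 2 * (B ^ 6 * k) * G := by gcongr
        _ ≤ 2 * N * Y := by gcongr
        _ = _ := by ring
    linarith
  have f5 : k * (-(σ * ρ * (X * h1 + q * h2 + q * T1) + ρ * θ * d)) ^ 2 ≤ 24 * (N * Y) := by
    calc _ = k * (σ * ρ * (X * h1 + q * h2 + q * T1) + ρ * θ * d) ^ 2 := by ring
      _ ≤ k * (24 * B ^ 6 * (Z + q ^ 2 + G)) := by gcongr
      _ = 24 * (B ^ 6 * k) * (Z + q ^ 2 + G) := by ring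
      _ ≤ 24 * N * Y := by gcongr
      _ = _ := by ring
  have f6 : ε ^ 2 * Q ^ 2 ≤ 32 * (μ ^ 2 * B ^ 2 * (ε ^ 2 * G ^ 2)) + 16 * (N * Y) := by
    have j1 := mul_le_mul_of_nonneg_left a6 (sq_nonneg ε)
    have j2 : ε ^ 2 * (μ ^ 2 * (16 * G)) ≤ 16 * (N * Y) := by
      calc _ ≤ 1 * (N * (16 * Y)) := by gcongr
        _ = _ := by ring
    linarith
  have hNY : 0 ≤ N * Y := by positivity
  have m1 := mul_le_mul_of_nonneg_left f1 hm0.le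
  have m2 := mul_le_mul_of_nonneg_left f2 hm0.le
  have m3 := mul_le_mul_of_nonneg_left f3 hm0.le
  have m5 := mul_le_mul_of_nonneg_left f5 hm0.le
  have m6 := mul_le_mul_of_nonneg_left f6 hm0.le
  have m7 : N * Y ≤ m * (N * Y) := le_mul_of_one_le_left hNY hm1
  have zu : 0 ≤ c * u ^ 2 := by positivity
  have zv : 0 ≤ c * v ^ 2 := by positivity
  have zw : 0 ≤ c * (k * w ^ 2) := by positivity
  have ge' : u * (-1 * ρ * (X * p1 + q * p2 + q)) + v * (-1 * ρ * (X * q1 + q * q2))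
    - k * ((ρ * w + θ * Ft) * d)
    - k * ((σ * ρ * (X * h1 + q * h2 + q * T1) + ρ * θ * d) * w) + Q * w
    = (-1 * ρ * (X * p1 + q * p2 + q)) * u + (-1 * ρ * (X * q1 + q * q2)) * v
      + k * (-(ρ * d) * w) + k * -(θ * Ft * d)
      + k * (-(σ * ρ * (X * h1 + q * h2 + q * T1) + ρ * θ * d) * w) + k * (ε ^ 2 * Q * w) := by
    rw [eQ1]; ring
  rw [ge']
  generalize (-1 * ρ * (X * p1 + q * p2 + q)) = A1 at *
  generalize (-1 * ρ * (X * q1 + q * q2)) = A2 at *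
  generalize (-(σ * ρ * (X * h1 + q * h2 + q * T1) + ρ * θ * d)) = A3 at *
  generalize -(ρ * d) = A4 at *
  generalize -(θ * Ft * d) = A5 at *
  clear_value Q m Y N d e
  clear ge' eQ1 a1 a2 a3 a4 a5 a6 f1 f2 f3 f5 f6
  generalize ε ^ 2 * Q = Q' at *
  linarith

namespace Sys
variable {B c0 r μ ε σ κ τ : ℝ}

/-- squared norm of the time derivatives -/
def YY (S : Sys B c0 r μ ε σ κ τ) : SA := Dt S.p ^ 2 + Dt S.q ^ 2 + kk (ε ^ 2)⁻¹ * Dt S.h ^ 2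

theorem per_K1 (S : Sys B c0 r μ ε σ κ τ) : Per S.K1 :=
  ((((Per.kk _).mul (S.per_P.mul S.pp.Dt)).sub
    ((Per.kk _).mul ((S.pp.Dt.mul S.pp.D1).add (S.pq.Dt.mul S.pq.D1)))).sub
    ((Per.kk _).mul (S.per_d.mul S.pp.Dt))).sub ((Per.kk _).mul (S.ph.Dt.mul S.ph.D1))

theorem one_le_k (S : Sys B c0 r μ ε σ κ τ) : 1 ≤ (ε ^ 2)⁻¹ :=
  (one_le_inv₀ (by have := S.hε; positivity)).2 (pow_le_one₀ S.hε.le S.hε1)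

theorem quart_one (S : Sys B c0 r μ ε σ κ τ) (a : SA) (t : ℝ) (h0 : J (a ^ 2) t ≤ B)
    (h1 : J (D1 a ^ 2) t ≤ B * (ε ^ 2)⁻¹) (h2 : J (D2 a ^ 2) t ≤ B * (ε ^ 2)⁻¹) :
    ε ^ 2 * J (a ^ 2 * a ^ 2) t ≤ 18 * B * J (a ^ 2) t := by
  have hε := S.hε
  have hB := S.hB
  have h := ladyz a t _ h1 h2
  have hk := S.one_le_k
  have a0 := J_sq_nonneg a t
  have hke : (ε ^ 2)⁻¹ * ε ^ 2 = 1 := inv_mul_cancel₀ (by positivity)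
  have h3 : J (a ^ 2) t ≤ B * (ε ^ 2)⁻¹ := h0.trans (le_mul_of_one_le_right (by linarith) hk)
  calc ε ^ 2 * J (a ^ 2 * a ^ 2) t ≤ ε ^ 2 * (9 * J (a ^ 2) t * (J (a ^ 2) t + B * (ε ^ 2)⁻¹)) := by gcongr
    _ ≤ ε ^ 2 * (9 * J (a ^ 2) t * (B * (ε ^ 2)⁻¹ + B * (ε ^ 2)⁻¹)) := by gcongr
    _ = 18 * B * J (a ^ 2) t * ((ε ^ 2)⁻¹ * ε ^ 2) := by ring
    _ = _ := by rw [hke, mul_one]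

theorem quart (S : Sys B c0 r μ ε σ κ τ) (t : ℝ) (ht : t ∈ Set.Icc 0 τ) :
    ε ^ 2 * J (S.G ^ 2) t ≤ 72 * B * J S.V t := by
  have hε := S.hε
  have hB := S.hB
  obtain ⟨n1, n2, n3, n4⟩ := S.np t ht
  obtain ⟨p1, p2, p3⟩ := S.npp t ht
  obtain ⟨q1, q2, q3⟩ := S.nqq t ht
  have c1 := S.quart_one (D1 S.p) t n1 p1 (by rw [D2_D1]; exact p2)
  have c2 := S.quart_one (D2 S.p) t n2 p2 p3
  have c3 := S.quart_one (D1 S.q) t n3 q1 (by rw [D2_D1]; exact q2)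
  have c4 := S.quart_one (D2 S.q) t n4 q2 q3
  have h1 : J (S.G ^ 2) t ≤ J (kk 4 * (D1 S.p ^ 2 * D1 S.p ^ 2 + D2 S.p ^ 2 * D2 S.p ^ 2
      + D1 S.q ^ 2 * D1 S.q ^ 2 + D2 S.q ^ 2 * D2 S.q ^ 2)) t := by
    apply J_mono
    intro x hx
    simp only [G, mul_ap, add_ap, pow_ap, kk_ap]
    have := sq4 ((D1 S.p).1 (t, x) ^ 2) ((D2 S.p).1 (t, x) ^ 2) ((D1 S.q).1 (t, x) ^ 2) ((D2 S.q).1 (t, x) ^ 2)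
    linarith
  simp only [J_kk, J_add] at h1
  have h2 := mul_le_mul_of_nonneg_left h1 (sq_nonneg ε)
  rw [S.Ez]
  have z1 := J_sq_nonneg (D1 S.h) t
  have z2 := J_sq_nonneg (D2 S.h) t
  have z3 : 0 ≤ B * ((ε ^ 2)⁻¹ * (J (D1 S.h ^ 2) t + J (D2 S.h ^ 2) t)) := by positivity
  linarith

/-- the constant of the first order estimate -/
def C1 (B c0 μ : ℝ) : ℝ := 200 * B ^ 2 + 640 / c0 ^ 2 * (B ^ 6 * μ ^ 2) + 64 * 72 / c0 ^ 2 * (B ^ 3 * μ ^ 2)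

set_option maxHeartbeats 1000000 in
theorem first_diff (S : Sys B c0 r μ ε σ κ τ) (t : ℝ) (ht : t ∈ Set.Icc 0 τ) :
    J (Dt S.E1) t + c0 ^ 2 / 2 * J S.YY t ≤ C1 B c0 μ * (ε ^ 2)⁻¹ * (J S.V t + J (D1 S.f ^ 2) t) := by
  have hε := S.hε
  have hc := S.hc0
  have hc1 := S.hc1
  have hB := S.hB
  have hk1 := S.one_le_k
  have hke : (ε ^ 2)⁻¹ * ε ^ 2 = 1 := inv_mul_cancel₀ (by positivity)
  have hμ0 : 0 < μ := by linarith [S.hμ]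
  have i1 : J (D1 S.K1) t = 0 := J_D1 _ _ (fun x y => S.per_K1 t x y)
  have i2 : J (D2 S.K2) t = 0 := by
    apply J_D2
    · intro x
      simp [K2, mul_ap, add_ap, sub_ap, S.vpt t ht x 0 (Or.inl rfl), S.vqt t ht x 0 (Or.inl rfl), S.vht t ht x 0 (Or.inl rfl)]
    · intro x
      simp [K2, mul_ap, add_ap, sub_ap, S.vpt t ht x 1 (Or.inr rfl), S.vqt t ht x 1 (Or.inr rfl), S.vht t ht x 1 (Or.inr rfl)]
  have hc2 : 0 < c0 ^ 2 := by positivity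
  have hc21 : c0 ^ 2 ≤ 1 := pow_le_one₀ hc.le hc1
  have hc22 : c0 ^ 2 ≤ c0 := by nlinarith
  have pt : J (Dt S.E1 + D1 S.K1 + D2 S.K2 + kk (c0 ^ 2 / 2) * S.YY) t
      ≤ J (kk (ε ^ 2)⁻¹ * Dt S.f ^ 2 + kk (128 / c0 ^ 2 * (B ^ 6 * μ ^ 2 * (ε ^ 2)⁻¹)) * (S.V + S.q ^ 2)
        + kk (64 / c0 ^ 2 * (μ ^ 2 * B ^ 2) * ε ^ 2) * S.G ^ 2) t := by
    apply J_mono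
    intro x hx
    have h1 := S.identity1 t ht x hx
    have hx2 : 0 < X2.1 (t, x) ∧ X2.1 (t, x) < 1 := hx.2
    have bX : |X2.1 (t, x) + S.p.1 (t, x)| ≤ 2 * B := by
      refine (abs_add_le _ _).trans ?_
      rw [abs_of_pos hx2.1]; linarith [hx2.2, S.bp t ht x hx]
    have bθ : |S.T.1 (t, x) + S.h.1 (t, x)| ≤ 2 * B := by
      refine (abs_add_le _ _).trans ?_
      have : B * ε ≤ B * 1 := mul_le_mul_of_nonneg_left S.hε1 (by linarith)
      linarith [S.bT t ht x hx, S.bh t ht x hx]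
    have bT1 : |(D2 S.T).1 (t, x)| ≤ B := by
      have : B * ε ≤ B * 1 := mul_le_mul_of_nonneg_left S.hε1 (by linarith)
      linarith [S.bT' t ht x hx]
    have h2 := rhs_real (u := (Dt S.p).1 (t, x)) (v := (Dt S.q).1 (t, x)) (w := (Dt S.h).1 (t, x))
      (Ft := (Dt S.f).1 (t, x)) (h1 := (D1 S.h).1 (t, x)) (h2 := (D2 S.h).1 (t, x))
      (p1 := (D1 S.p).1 (t, x)) (p2 := (D2 S.p).1 (t, x)) (q1 := (D1 S.q).1 (t, x)) (q2 := (D2 S.q).1 (t, x))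
      hB hc2 hc21 hk1 hke S.hμ S.hrB S.hσB bX (S.bq t ht x hx) (S.bρ t ht x hx)
      bθ bT1 rfl rfl
    have hρ := S.lρ t ht x hx
    have e1 : c0 ^ 2 * ((Dt S.p).1 (t, x) ^ 2 + (Dt S.q).1 (t, x) ^ 2)
        ≤ (S.R.1 (t, x) + S.f.1 (t, x)) * ((Dt S.p).1 (t, x) ^ 2 + (Dt S.q).1 (t, x) ^ 2) :=
      mul_le_mul_of_nonneg_right (hc22.trans hρ) (by positivity)
    have e2 : c0 ^ 2 * ((ε ^ 2)⁻¹ * (Dt S.h).1 (t, x) ^ 2)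
        ≤ (σ * (S.R.1 (t, x) + S.f.1 (t, x))) * ((ε ^ 2)⁻¹ * (Dt S.h).1 (t, x) ^ 2) := by
      refine mul_le_mul_of_nonneg_right ?_ (by positivity)
      rw [pow_two]; exact mul_le_mul S.hσ hρ hc.le (hc.le.trans S.hσ)
    simp only [YY, V, G, Z, Q, ρ, d, add_ap, mul_ap, sub_ap, pow_ap, kk_ap] at h1 h2 ⊢
    linarith
  simp only [J_add, J_kk, i1, i2] at pt
  have h1 := S.dtf t ht
  have h2 := S.poin t ht
  have h3 := S.quart t ht
  have hV := S.V_nonneg t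
  have q0 := J_sq_nonneg S.q t
  have p0 := J_sq_nonneg S.p t
  have hh0 : 0 ≤ (ε ^ 2)⁻¹ * J (S.h ^ 2) t := mul_nonneg (by positivity) (J_sq_nonneg S.h t)
  have f0 := J_sq_nonneg (D1 S.f) t
  have hGV : J S.G t ≤ J S.V t := by
    have e : J S.V t = J S.G t + (ε ^ 2)⁻¹ * J S.Z t := by simp only [V, J_add, J_kk]
    have : 0 ≤ J S.Z t := J_nonneg (fun x _ => by simp only [Z, add_ap, pow_ap]; positivity)
    have : 0 ≤ (ε ^ 2)⁻¹ * J S.Z t := by positivity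
    linarith
  have A1 : J (Dt S.f ^ 2) t ≤ 200 * B ^ 2 * (J S.V t + J (D1 S.f ^ 2) t) := by
    refine h1.trans ?_
    calc 40 * B ^ 2 * (J (D1 S.f ^ 2) t + J (S.p ^ 2) t + J (S.q ^ 2) t + J S.G t)
        ≤ 40 * B ^ 2 * (5 * (J S.V t + J (D1 S.f ^ 2) t)) := by gcongr; linarith
      _ = _ := by ring
  have A2 : J S.V t + J (S.q ^ 2) t ≤ 5 * (J S.V t + J (D1 S.f ^ 2) t) := by linarith
  have A3 : ε ^ 2 * J (S.G ^ 2) t ≤ 72 * B * (ε ^ 2)⁻¹ * (J S.V t + J (D1 S.f ^ 2) t) := by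
    refine h3.trans ?_
    calc 72 * B * J S.V t = 72 * B * 1 * J S.V t := by ring
      _ ≤ 72 * B * (ε ^ 2)⁻¹ * (J S.V t + J (D1 S.f ^ 2) t) := by gcongr; linarith
  have M1 := mul_le_mul_of_nonneg_left A1 (by linarith : 0 ≤ (ε ^ 2)⁻¹)
  have M2 := mul_le_mul_of_nonneg_left A2 (by positivity : 0 ≤ 128 / c0 ^ 2 * (B ^ 6 * μ ^ 2 * (ε ^ 2)⁻¹))
  have M3 := mul_le_mul_of_nonneg_left A3 (by positivity : 0 ≤ 64 / c0 ^ 2 * (μ ^ 2 * B ^ 2))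
  have E : C1 B c0 μ * (ε ^ 2)⁻¹ * (J S.V t + J (D1 S.f ^ 2) t)
    = (ε ^ 2)⁻¹ * (200 * B ^ 2 * (J S.V t + J (D1 S.f ^ 2) t))
    + 128 / c0 ^ 2 * (B ^ 6 * μ ^ 2 * (ε ^ 2)⁻¹) * (5 * (J S.V t + J (D1 S.f ^ 2) t))
    + 64 / c0 ^ 2 * (μ ^ 2 * B ^ 2) * (72 * B * (ε ^ 2)⁻¹ * (J S.V t + J (D1 S.f ^ 2) t)) := by
    unfold C1; ring
  rw [E]
  simp only [YY, V, J_add, J_kk] at pt M1 M2 M3 ⊢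
  linarith

theorem E1_bounds (S : Sys B c0 r μ ε σ κ τ) (t : ℝ) (ht : t ∈ Set.Icc 0 τ) :
    c0 / 4 * J S.V t - 4 * B ^ 2 * (ε ^ 2)⁻¹ * S.mm t ≤ J S.E1 t ∧
    J S.E1 t ≤ 2 * B * μ * J S.V t + 4 * B ^ 2 * (ε ^ 2)⁻¹ * S.mm t := by
  have hε := S.hε
  have hc := S.hc0
  have hc1 := S.hc1
  have hB := S.hB
  have hμ := S.hμ
  have hr := S.hr
  have hμ0 : 0 < μ := by linarith [S.hμ]
  have hk : 0 < (ε ^ 2)⁻¹ := by positivity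
  have hPm : (ε ^ 2)⁻¹ * ((ε ^ 2)⁻¹ * J (S.P ^ 2) t) ≤ 2 * B ^ 2 * (ε ^ 2)⁻¹ * S.mm t := by
    have h1 : J (S.P ^ 2) t ≤ J (kk (2 * B ^ 2) * (S.h ^ 2 + S.f ^ 2)) t := by
      apply J_mono
      intro x hx
      have a1 := mulsq (b := S.h.1 (t, x)) (sq_le_of_abs (S.bρ t ht x hx))
      have a2 := mulsq (b := S.f.1 (t, x)) (sq_le_of_abs (S.bT t ht x hx))
      have a3 := sq2 ((S.R.1 (t, x) + S.f.1 (t, x)) * S.h.1 (t, x)) (S.T.1 (t, x) * S.f.1 (t, x))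
      simp only [P, mul_ap, add_ap, pow_ap, kk_ap]
      have e : S.R.1 (t, x) * S.h.1 (t, x) + S.T.1 (t, x) * S.f.1 (t, x) + S.f.1 (t, x) * S.h.1 (t, x)
        = (S.R.1 (t, x) + S.f.1 (t, x)) * S.h.1 (t, x) + S.T.1 (t, x) * S.f.1 (t, x) := by ring
      rw [e]; linarith
    simp only [J_kk, J_add] at h1
    have p0 := J_sq_nonneg S.p t
    have q0 := J_sq_nonneg S.q t
    calc _ ≤ (ε ^ 2)⁻¹ * ((ε ^ 2)⁻¹ * (2 * B ^ 2 * (J (S.h ^ 2) t + J (S.f ^ 2) t))) := by gcongr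
      _ = 2 * B ^ 2 * (ε ^ 2)⁻¹ * ((ε ^ 2)⁻¹ * J (S.f ^ 2) t + (ε ^ 2)⁻¹ * J (S.h ^ 2) t) := by ring
      _ ≤ _ := by
        unfold mm
        gcongr
        linarith
  have key : ∀ x ∈ Ω, (kk (c0 / 4) * S.V - kk 2 * (kk (ε ^ 2)⁻¹ * (kk (ε ^ 2)⁻¹ * S.P ^ 2))).1 (t, x)
      ≤ S.E1.1 (t, x) ∧ S.E1.1 (t, x)
      ≤ (kk (2 * B * μ) * S.V + kk 2 * (kk (ε ^ 2)⁻¹ * (kk (ε ^ 2)⁻¹ * S.P ^ 2))).1 (t, x) := by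
    intro x hx
    have hG : 0 ≤ S.G.1 (t, x) := by simp only [G, add_ap, pow_ap]; positivity
    have hZ : 0 ≤ S.Z.1 (t, x) := by simp only [Z, add_ap, pow_ap]; positivity
    have hd : S.d.1 (t, x) ^ 2 ≤ 2 * S.G.1 (t, x) := by
      simp only [d, G, add_ap, pow_ap]
      refine (sq2 _ _).trans ?_
      have := sq_nonneg ((D1 S.q).1 (t, x))
      have := sq_nonneg ((D2 S.p).1 (t, x))
      linarith
    simp only [E1, V, mul_ap, add_ap, sub_ap, pow_ap, kk_ap]
    generalize S.G.1 (t, x) = G at *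
    generalize S.Z.1 (t, x) = Z at *
    generalize S.P.1 (t, x) = P at *
    generalize S.d.1 (t, x) = d at *
    generalize (ε ^ 2)⁻¹ = k at *
    have s1 := sq_nonneg (d - 4 * (k * P))
    have s2 := sq_nonneg (d + 4 * (k * P))
    have hd0 := sq_nonneg d
    have hμG : G ≤ μ * G := le_mul_of_one_le_left hG hμ
    have hcG : c0 * G ≤ G := mul_le_of_le_one_left hG hc1
    have hkZ : 0 ≤ k * Z := by positivity
    have hκ1 := mul_le_mul_of_nonneg_right S.hκ hkZ
    have hκ2 := mul_le_mul_of_nonneg_right (le_of_abs_le S.hκB) hkZ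
    have hcZ : c0 * (k * Z) ≤ c0 * μ * (k * Z) := by
      apply mul_le_mul_of_nonneg_right _ hkZ
      exact le_mul_of_one_le_right hc.le hμ
    have hcZ0 : 0 ≤ c0 * (k * Z) := by positivity
    have hrd0 : 0 ≤ μ * (1 + r) * d ^ 2 := by positivity
    have hrd : μ * (1 + r) * d ^ 2 ≤ μ * B * (2 * G) := by
      have := le_of_abs_le S.hrB1
      gcongr
    have hBG : μ * G ≤ B * (μ * G) := le_mul_of_one_le_left (by positivity) hB
    have hBZ : 0 ≤ B * μ * (k * Z) := by positivity
    constructor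
    · linarith
    · linarith
  constructor
  · have h := J_mono (fun x hx => (key x hx).1)
    simp only [J_sub, J_kk] at h
    linarith
  · have h := J_mono (fun x hx => (key x hx).2)
    simp only [J_add, J_kk] at h
    linarith

/-- second constant -/
def C2 (B c0 μ : ℝ) : ℝ := 4 * B ^ 2 + 4 * B ^ 2 * (2 * B ^ 4 / c0 ^ 4) + C1 B c0 μ * (2 * B ^ 4 / c0 ^ 4)

theorem first (S : Sys B c0 r μ ε σ κ τ) (hM : 880 * B ^ 5 ≤ c0 ^ 4 * μ)
    (hE : 880 * B ^ 5 * ε ≤ c0 ^ 4) (hM2 : 1440 * B ^ 3 ≤ c0 ^ 8 * μ) (t : ℝ) (ht : t ∈ Set.Icc 0 τ) :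
    c0 / 4 * J S.V t + c0 ^ 2 / 2 * ∫ s in (0 : ℝ)..t, J S.YY s
      ≤ 2 * B * μ * J S.V 0 + C2 B c0 μ * (ε ^ 2)⁻¹ * S.mm 0
        + C1 B c0 μ * (ε ^ 2)⁻¹ * ∫ s in (0 : ℝ)..t, J (D1 S.f ^ 2) s := by
  obtain ⟨b1, b2⟩ := S.basic hM hE hM2 t ht
  have hε := S.hε
  have hc := S.hc0
  have hB := S.hB
  have hμ0 : 0 < μ := by linarith [S.hμ]
  have hk : 0 < (ε ^ 2)⁻¹ := by positivity
  have e1 := (S.E1_bounds t ht).1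
  have e2 := (S.E1_bounds 0 ⟨le_rfl, ht.1.trans ht.2⟩).2
  have hC1 : 0 ≤ C1 B c0 μ := by unfold C1; positivity
  have h1 : ∫ s in (0 : ℝ)..t, (J (Dt S.E1) s + c0 ^ 2 / 2 * J S.YY s)
      ≤ ∫ s in (0 : ℝ)..t, C1 B c0 μ * (ε ^ 2)⁻¹ * (J S.V s + J (D1 S.f ^ 2) s) := by
    apply intervalIntegral.integral_mono_on ht.1
    · exact ((J_cont _).add ((J_cont _).const_mul _)).intervalIntegrable _ _
    · exact (((J_cont _).add (J_cont _)).const_mul _).intervalIntegrable _ _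
    · intro s hs
      exact S.first_diff s ⟨hs.1, hs.2.trans ht.2⟩
  rw [intervalIntegral.integral_add ((J_cont _).intervalIntegrable _ _)
      (((J_cont _).const_mul _).intervalIntegrable _ _), intervalIntegral.integral_const_mul,
    intervalIntegral.integral_const_mul, intervalIntegral.integral_add ((J_cont _).intervalIntegrable _ _)
      ((J_cont _).intervalIntegrable _ _), J_Dt] at h1
  have m1 := mul_le_mul_of_nonneg_left b1 (by positivity : 0 ≤ 4 * B ^ 2 * (ε ^ 2)⁻¹)
  have m2 := mul_le_mul_of_nonneg_left b2 (by positivity : 0 ≤ C1 B c0 μ * (ε ^ 2)⁻¹)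
  unfold C2
  linarith
end Sys

section translate
variable {F' : Type*} [NormedAddCommGroup F'] [NormedSpace ℝ F']

theorem iter_smooth (u : ℝ → ℝ × ℝ → F') (hu : ContDiff ℝ (⊤ : ℕ∞) (Function.uncurry u)) (j : ℕ) :
    ContDiff ℝ (⊤ : ℕ∞) (Function.uncurry fun s x => iteratedFDeriv ℝ j (u s) x) := by
  induction j with
  | zero =>
    exact (continuousMultilinearCurryFin0 ℝ (ℝ × ℝ) F').symm.contDiff.comp hu
  | succ n ih =>
    have h1 : ContDiff ℝ (⊤ : ℕ∞) (fun z : ℝ × (ℝ × ℝ) => fderiv ℝ (fun x => iteratedFDeriv ℝ n (u z.1) x) z.2) := by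
      refine ContDiff.fderiv (m := (⊤ : ℕ∞))
        (f := fun (z : ℝ × (ℝ × ℝ)) (x : ℝ × ℝ) => iteratedFDeriv ℝ n (u z.1) x) ?_ contDiff_snd (by simp)
      exact ih.comp (contDiff_fst.fst.prodMk contDiff_snd)
    exact (continuousMultilinearCurryLeftEquiv ℝ (fun _ : Fin (n + 1) => ℝ × ℝ) F').symm.contDiff.comp h1

theorem dSq_cont (u : ℝ → ℝ × ℝ → F') (hu : ContDiff ℝ (⊤ : ℕ∞) (Function.uncurry u)) (j : ℕ) :
    Continuous (fun s => dSq j (u s)) := by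
  apply contΩ (f := fun s x => ‖iteratedFDeriv ℝ j (u s) x‖ ^ 2)
  exact ((iter_smooth u hu j).continuous.norm.pow 2)

theorem dSq_nonneg (j : ℕ) (g : ℝ × ℝ → F') : 0 ≤ dSq j g :=
  setIntegral_nonneg Ω_meas (fun _ _ => by positivity)

theorem HSq_nonneg (j : ℕ) (g : ℝ × ℝ → F') : 0 ≤ HSq j g :=
  Finset.sum_nonneg (fun _ _ => dSq_nonneg _ _)

theorem HSq_cont (u : ℝ → ℝ × ℝ → F') (hu : ContDiff ℝ (⊤ : ℕ∞) (Function.uncurry u)) (j : ℕ) :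
    Continuous (fun s => HSq j (u s)) :=
  continuous_finsetSum _ (fun i _ => dSq_cont u hu i)

theorem slice_smooth (u : ℝ → ℝ × ℝ → F') (hu : ContDiff ℝ (⊤ : ℕ∞) (Function.uncurry u)) (s : ℝ) :
    ContDiff ℝ (⊤ : ℕ∞) (u s) :=
  hu.comp (contDiff_const.prodMk contDiff_id)

theorem iter_cont (g : ℝ × ℝ → F') (hg : ContDiff ℝ (⊤ : ℕ∞) g) (j : ℕ) :
    Continuous (fun x => ‖iteratedFDeriv ℝ j g x‖ ^ 2) :=
  ((hg.continuous_iteratedFDeriv (m := j) (by exact_mod_cast le_top)).norm.pow 2)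

theorem dt_smooth (u : ℝ → ℝ × ℝ → F') (hu : ContDiff ℝ (⊤ : ℕ∞) (Function.uncurry u)) :
    ContDiff ℝ (⊤ : ℕ∞) (Function.uncurry (dt u)) := by
  have h1 : ContDiff ℝ (⊤ : ℕ∞) (fun z : ℝ × (ℝ × ℝ) => fderiv ℝ (fun s => u s z.2) z.1) := by
    refine ContDiff.fderiv (m := (⊤ : ℕ∞))
      (f := fun (z : ℝ × (ℝ × ℝ)) (s : ℝ) => u s z.2) ?_ contDiff_fst (by simp)
    exact hu.comp (contDiff_snd.prodMk contDiff_fst.snd)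
  exact h1.clm_apply contDiff_const

theorem opnorm_le (L : (ℝ × ℝ) →L[ℝ] F') : ‖L‖ ^ 2 ≤ 2 * (‖L (1, 0)‖ ^ 2 + ‖L (0, 1)‖ ^ 2) := by
  have h : ‖L‖ ≤ ‖L (1, 0)‖ + ‖L (0, 1)‖ := by
    apply L.opNorm_le_bound (by positivity)
    intro v
    have e : L v = v.1 • L (1, 0) + v.2 • L (0, 1) := by
      rw [← map_smul, ← map_smul, ← map_add]
      congr 1
      ext <;> simp
    rw [e]
    refine (norm_add_le _ _).trans ?_
    rw [norm_smul, norm_smul]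
    have h1 : ‖v.1‖ ≤ ‖v‖ := norm_fst_le v
    have h2 : ‖v.2‖ ≤ ‖v‖ := norm_snd_le v
    have a := mul_le_mul_of_nonneg_right h1 (norm_nonneg (L (1, 0)))
    have b := mul_le_mul_of_nonneg_right h2 (norm_nonneg (L (0, 1)))
    linarith
  have := pow_le_pow_left₀ (norm_nonneg L) h 2
  have := sq2 ‖L (1, 0)‖ ‖L (0, 1)‖
  linarith

theorem d1_norm (g : ℝ × ℝ → F') (x : ℝ × ℝ) : ‖d1 g x‖ ≤ ‖iteratedFDeriv ℝ 1 g x‖ := by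
  rw [norm_iteratedFDeriv_one]
  exact ((fderiv ℝ g x).le_opNorm _).trans (by simp [Prod.norm_def])
theorem d2_norm (g : ℝ × ℝ → F') (x : ℝ × ℝ) : ‖d2 g x‖ ≤ ‖iteratedFDeriv ℝ 1 g x‖ := by
  rw [norm_iteratedFDeriv_one]
  exact ((fderiv ℝ g x).le_opNorm _).trans (by simp [Prod.norm_def])

theorem snd_norm (g : ℝ × ℝ → F') (hg : ContDiff ℝ (⊤ : ℕ∞) g) (x v w : ℝ × ℝ) (hv : ‖v‖ ≤ 1) (hw : ‖w‖ ≤ 1) :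
    ‖fderiv ℝ (fun y => fderiv ℝ g y w) x v‖ ≤ ‖iteratedFDeriv ℝ 2 g x‖ := by
  have hd : DifferentiableAt ℝ (fderiv ℝ g) x :=
    ((hg.fderiv_right (m := (⊤ : ℕ∞)) (by simp)).differentiable (by simp)) x
  have e : fderiv ℝ (fun y => fderiv ℝ g y w) x v = iteratedFDeriv ℝ 2 g x ![v, w] := by
    rw [iteratedFDeriv_two_apply, fderiv_clm_apply hd (differentiableAt_const _)]
    simp
  rw [e]
  refine (ContinuousMultilinearMap.le_opNorm _ _).trans ?_
  rw [Fin.prod_univ_two]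
  have : ‖v‖ * ‖w‖ ≤ 1 := mul_le_one₀ hv (norm_nonneg _) hw
  exact mul_le_of_le_one_right (norm_nonneg _) this
end translate

theorem sl_smooth (a : SA) (t : ℝ) : ContDiff ℝ (⊤ : ℕ∞) (fun x : ℝ × ℝ => a.1 (t, x)) :=
  (smo a).comp (contDiff_const.prodMk contDiff_id)

theorem sl_fderiv (a : SA) (t : ℝ) (x v : ℝ × ℝ) :
    fderiv ℝ (fun y : ℝ × ℝ => a.1 (t, y)) x v = (DD (0, v) a).1 (t, x) := by
  have h1 : HasFDerivAt a.1 (fderiv ℝ a.1 (t, x)) (t, x) := (dif a _).hasFDerivAt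
  have h2 : HasFDerivAt (fun y : ℝ × ℝ => ((t, y) : E3)) (ContinuousLinearMap.inr ℝ ℝ (ℝ × ℝ)) x :=
    hasFDerivAt_prodMk_right t x
  have h3 := HasFDerivAt.comp x h1 h2
  have e : (fun y : ℝ × ℝ => a.1 (t, y)) = a.1 ∘ fun y : ℝ × ℝ => ((t, y) : E3) := rfl
  rw [e, h3.fderiv]
  rfl

theorem sl_d1 (a : SA) (t : ℝ) : d1 (fun y : ℝ × ℝ => a.1 (t, y)) = fun y => (D1 a).1 (t, y) :=
  funext fun x => sl_fderiv a t x (1, 0)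
theorem sl_d2 (a : SA) (t : ℝ) : d2 (fun y : ℝ × ℝ => a.1 (t, y)) = fun y => (D2 a).1 (t, y) :=
  funext fun x => sl_fderiv a t x (0, 1)

theorem dSq0 (a : SA) (t : ℝ) : dSq 0 (fun y : ℝ × ℝ => a.1 (t, y)) = J (a ^ 2) t := by
  unfold dSq J
  congr 1
  funext x
  rw [norm_iteratedFDeriv_zero, pow_ap, Real.norm_eq_abs, sq_abs]

theorem J_le_dSq {a b : SA} {t : ℝ} {j : ℕ}
    (h : ∀ x, |b.1 (t, x)| ≤ ‖iteratedFDeriv ℝ j (fun y : ℝ × ℝ => a.1 (t, y)) x‖) :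
    J (b ^ 2) t ≤ dSq j (fun y : ℝ × ℝ => a.1 (t, y)) := by
  apply setIntegral_mono_on (J_int _ t) (integrableΩ (iter_cont _ (sl_smooth a t) j)) Ω_meas
  intro x _
  rw [pow_ap, ← sq_abs]
  exact pow_le_pow_left₀ (abs_nonneg _) (h x) 2

theorem J1_le (a : SA) (t : ℝ) : J (D1 a ^ 2) t ≤ dSq 1 (fun y : ℝ × ℝ => a.1 (t, y)) :=
  J_le_dSq fun x => by
    have := d1_norm (fun y : ℝ × ℝ => a.1 (t, y)) x
    rwa [sl_d1] at this
theorem J2_le (a : SA) (t : ℝ) : J (D2 a ^ 2) t ≤ dSq 1 (fun y : ℝ × ℝ => a.1 (t, y)) :=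
  J_le_dSq fun x => by
    have := d2_norm (fun y : ℝ × ℝ => a.1 (t, y)) x
    rwa [sl_d2] at this

theorem Jvw_le (a : SA) (t : ℝ) (v w : ℝ × ℝ) (hv : ‖v‖ ≤ 1) (hw : ‖w‖ ≤ 1) :
    J (DD (0, v) (DD (0, w) a) ^ 2) t ≤ dSq 2 (fun y : ℝ × ℝ => a.1 (t, y)) :=
  J_le_dSq fun x => by
    have := snd_norm _ (sl_smooth a t) x v w hv hw
    simp only [sl_fderiv] at this
    exact this

theorem n10 : ‖((1, 0) : ℝ × ℝ)‖ ≤ 1 := by simp [Prod.norm_def]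
theorem n01 : ‖((0, 1) : ℝ × ℝ)‖ ≤ 1 := by simp [Prod.norm_def]

theorem J11_le (a : SA) (t : ℝ) : J (D1 (D1 a) ^ 2) t ≤ dSq 2 (fun y : ℝ × ℝ => a.1 (t, y)) :=
  Jvw_le a t _ _ n10 n10
theorem J12_le (a : SA) (t : ℝ) : J (D1 (D2 a) ^ 2) t ≤ dSq 2 (fun y : ℝ × ℝ => a.1 (t, y)) :=
  Jvw_le a t _ _ n10 n01
theorem J22_le (a : SA) (t : ℝ) : J (D2 (D2 a) ^ 2) t ≤ dSq 2 (fun y : ℝ × ℝ => a.1 (t, y)) :=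
  Jvw_le a t _ _ n01 n01

theorem dSq1_le (a : SA) (t : ℝ) :
    dSq 1 (fun y : ℝ × ℝ => a.1 (t, y)) ≤ 2 * (J (D1 a ^ 2) t + J (D2 a ^ 2) t) := by
  rw [← J_add, ← J_kk]
  apply setIntegral_mono_on (integrableΩ (iter_cont _ (sl_smooth a t) 1)) (J_int _ t) Ω_meas
  intro x _
  rw [norm_iteratedFDeriv_one]
  refine (opnorm_le _).trans (le_of_eq ?_)
  rw [sl_fderiv, sl_fderiv, Real.norm_eq_abs, Real.norm_eq_abs, sq_abs, sq_abs]
  rfl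

theorem pair_norm (a b : ℝ) : ‖((a, b) : ℝ × ℝ)‖ ^ 2 ≤ a ^ 2 + b ^ 2 := by
  change (max ‖a‖ ‖b‖) ^ 2 ≤ _
  rcases max_choice ‖a‖ ‖b‖ with h | h
  · rw [h, Real.norm_eq_abs, sq_abs]; linarith [sq_nonneg b]
  · rw [h, Real.norm_eq_abs, sq_abs]; linarith [sq_nonneg a]

theorem pair_smooth (a b : SA) (t : ℝ) :
    ContDiff ℝ (⊤ : ℕ∞) (fun y : ℝ × ℝ => ((a.1 (t, y), b.1 (t, y)) : ℝ × ℝ)) :=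
  (sl_smooth a t).prodMk (sl_smooth b t)

theorem pair0 (a b : SA) (t : ℝ) :
    dSq 0 (fun y : ℝ × ℝ => ((a.1 (t, y), b.1 (t, y)) : ℝ × ℝ)) ≤ J (a ^ 2) t + J (b ^ 2) t := by
  rw [← J_add]
  apply setIntegral_mono_on (integrableΩ (iter_cont _ (pair_smooth a b t) 0)) (J_int _ t) Ω_meas
  intro x _
  rw [norm_iteratedFDeriv_zero]
  exact pair_norm _ _

theorem pair1 (a b : SA) (t : ℝ) :
    dSq 1 (fun y : ℝ × ℝ => ((a.1 (t, y), b.1 (t, y)) : ℝ × ℝ))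
      ≤ 2 * (J (D1 a ^ 2) t + J (D2 a ^ 2) t + J (D1 b ^ 2) t + J (D2 b ^ 2) t) := by
  rw [← J_add, ← J_add, ← J_add, ← J_kk]
  apply setIntegral_mono_on (integrableΩ (iter_cont _ (pair_smooth a b t) 1)) (J_int _ t) Ω_meas
  intro x _
  rw [norm_iteratedFDeriv_one]
  refine (opnorm_le _).trans ?_
  have da := ((sl_smooth a t).differentiable (by simp)) x
  have db := ((sl_smooth b t).differentiable (by simp)) x
  rw [DifferentiableAt.fderiv_prodMk da db]
  simp only [ContinuousLinearMap.prod_apply, sl_fderiv]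
  have h1 := pair_norm ((D1 a).1 (t, x)) ((D1 b).1 (t, x))
  have h2 := pair_norm ((D2 a).1 (t, x)) ((D2 b).1 (t, x))
  simp only [add_ap, mul_ap, pow_ap, kk_ap]
  simp only [D1, D2] at h1 h2 ⊢
  linarith

theorem pairfst (a b : SA) (t : ℝ) (j : ℕ) : dSq j (fun y : ℝ × ℝ => a.1 (t, y))
    ≤ dSq j (fun y : ℝ × ℝ => ((a.1 (t, y), b.1 (t, y)) : ℝ × ℝ)) := by
  apply setIntegral_mono_on (integrableΩ (iter_cont _ (sl_smooth a t) j))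
    (integrableΩ (iter_cont _ (pair_smooth a b t) j)) Ω_meas
  intro x _
  have h := (ContinuousLinearMap.fst ℝ ℝ ℝ).norm_iteratedFDeriv_comp_left (n := j)
    ((pair_smooth a b t).contDiffAt (x := x)) (by exact_mod_cast le_top)
  refine pow_le_pow_left₀ (norm_nonneg _) (h.trans ?_) 2
  exact mul_le_of_le_one_left (norm_nonneg _) (ContinuousLinearMap.norm_fst_le ..)

theorem pairsnd (a b : SA) (t : ℝ) (j : ℕ) : dSq j (fun y : ℝ × ℝ => b.1 (t, y))
    ≤ dSq j (fun y : ℝ × ℝ => ((a.1 (t, y), b.1 (t, y)) : ℝ × ℝ)) := by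
  apply setIntegral_mono_on (integrableΩ (iter_cont _ (sl_smooth b t) j))
    (integrableΩ (iter_cont _ (pair_smooth a b t) j)) Ω_meas
  intro x _
  have h := (ContinuousLinearMap.snd ℝ ℝ ℝ).norm_iteratedFDeriv_comp_left (n := j)
    ((pair_smooth a b t).contDiffAt (x := x)) (by exact_mod_cast le_top)
  refine pow_le_pow_left₀ (norm_nonneg _) (h.trans ?_) 2
  exact mul_le_of_le_one_left (norm_nonneg _) (ContinuousLinearMap.norm_snd_le ..)

theorem dt_sl (a : SA) (t : ℝ) : dt (fun s x => a.1 (s, x)) t = fun x => (Dt a).1 (t, x) := by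
  funext ⟨x, y⟩
  exact (hasDerivAt_t a t x y).deriv

theorem dt_pair (a b : SA) (t : ℝ) : dt (fun s x => ((a.1 (s, x), b.1 (s, x)) : ℝ × ℝ)) t
    = fun x => ((Dt a).1 (t, x), (Dt b).1 (t, x)) := by
  funext ⟨x, y⟩
  exact ((hasDerivAt_t a t x y).prodMk (hasDerivAt_t b t x y)).deriv

/-! suprema over a time interval -/
theorem sup_le_of {g : ℝ → ℝ} {t M : ℝ} (hM : 0 ≤ M) (h : ∀ s ∈ Set.Icc (0 : ℝ) t, g s ≤ M) :
    (⨆ s ∈ Set.Icc (0 : ℝ) t, g s) ≤ M :=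
  Real.iSup_le (fun s => Real.iSup_le (fun hs => h s hs) hM) hM

theorem sup_nonneg {g : ℝ → ℝ} {t : ℝ} (hg : ∀ s, 0 ≤ g s) : 0 ≤ ⨆ s ∈ Set.Icc (0 : ℝ) t, g s :=
  Real.iSup_nonneg fun s => Real.iSup_nonneg fun _ => hg s

theorem le_sup_of {g : ℝ → ℝ} {t : ℝ} (hc : Continuous g) {s : ℝ}
    (hs : s ∈ Set.Icc (0 : ℝ) t) : g s ≤ ⨆ s ∈ Set.Icc (0 : ℝ) t, g s := by
  obtain ⟨M, hM⟩ := (isCompact_Icc (a := (0 : ℝ)) (b := t)).bddAbove_image hc.continuousOn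
  have hb : BddAbove (Set.range fun s => ⨆ _ : s ∈ Set.Icc (0 : ℝ) t, g s) := by
    refine ⟨max M 0, ?_⟩
    rintro _ ⟨u, rfl⟩
    refine Real.iSup_le (fun hu => ?_) (le_max_right _ _)
    exact (hM ⟨u, hu, rfl⟩).trans (le_max_left _ _)
  have h := le_ciSup hb s
  rwa [ciSup_pos hs] at h

/-- Bounds contained in the a priori assumption `N ≤ 1`. -/
theorem bounds {ε τ : ℝ} {φ : ℝ → ℝ × ℝ → ℝ} {ψ : ℝ → ℝ × ℝ → ℝ × ℝ} {θ : ℝ → ℝ × ℝ → ℝ}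
    (hφ : ContDiff ℝ (⊤ : ℕ∞) (Function.uncurry φ)) (hψ : ContDiff ℝ (⊤ : ℕ∞) (Function.uncurry ψ))
    (hθ : ContDiff ℝ (⊤ : ℕ∞) (Function.uncurry θ)) (hε : 0 < ε) (hτ : 0 ≤ τ)
    (hN : Nfun ε φ ψ θ τ ≤ 1) :
    (∀ t ∈ Set.Icc (0 : ℝ) τ,
      (ε ^ 2)⁻¹ * (L2Sq (ψ t) + (ε ^ 2)⁻¹ * L2Sq (φ t) + (ε ^ 2)⁻¹ * L2Sq (θ t)) ≤ 1
      ∧ dSq 1 (ψ t) + (ε ^ 2)⁻¹ * dSq 1 (θ t) ≤ 1 ∧ (ε ^ 2)⁻¹ * dSq 1 (φ t) ≤ 1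
      ∧ ε ^ 2 * ((ε ^ 2)⁻¹ * dSq 2 (φ t) + dSq 2 (ψ t) + (ε ^ 2)⁻¹ * dSq 2 (θ t)) ≤ 1)
    ∧ (∫ s in (0 : ℝ)..τ, (ε ^ 2)⁻¹ * HSq 2 (φ s)) ≤ 1 := by
  have hk : 0 < (ε ^ 2)⁻¹ := by positivity
  have hk4 : 0 < (ε ^ 4)⁻¹ := by positivity
  have hL : ∀ (u : ℝ → ℝ × ℝ → ℝ) (s : ℝ), 0 ≤ L2Sq (u s) := fun u s => dSq_nonneg _ _
  have hL' : ∀ (u : ℝ → ℝ × ℝ → ℝ × ℝ) (s : ℝ), 0 ≤ L2Sq (u s) := fun u s => dSq_nonneg _ _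
  have hd : ∀ (j : ℕ) (u : ℝ → ℝ × ℝ → ℝ) (s : ℝ), 0 ≤ dSq j (u s) := fun j u s => dSq_nonneg _ _
  have hd' : ∀ (j : ℕ) (u : ℝ → ℝ × ℝ → ℝ × ℝ) (s : ℝ), 0 ≤ dSq j (u s) := fun j u s => dSq_nonneg _ _
  have hH : ∀ (j : ℕ) (u : ℝ → ℝ × ℝ → ℝ) (s : ℝ), 0 ≤ HSq j (u s) := fun j u s => HSq_nonneg _ _
  have hH' : ∀ (j : ℕ) (u : ℝ → ℝ × ℝ → ℝ × ℝ) (s : ℝ), 0 ≤ HSq j (u s) := fun j u s => HSq_nonneg _ _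
  have i0 : 0 ≤ ∫ s in (0 : ℝ)..τ, (HSq 1 (ψ s) + (ε ^ 2)⁻¹ * HSq 1 (θ s)) :=
    intervalIntegral.integral_nonneg hτ fun s _ => by have := hH' 1 ψ s; have := hH 1 θ s; positivity
  have i1 : 0 ≤ ∫ s in (0 : ℝ)..τ, (L2Sq (dt ψ s) + (ε ^ 2)⁻¹ * L2Sq (dt θ s)) :=
    intervalIntegral.integral_nonneg hτ fun s _ => by
      have := hL' (dt ψ) s; have := hL (dt θ) s; positivity
  have i2 : 0 ≤ ∫ s in (0 : ℝ)..τ, ((ε ^ 4)⁻¹ * HSq 1 (φ s) + (ε ^ 2)⁻¹ * L2Sq (dt φ s)) :=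
    intervalIntegral.integral_nonneg hτ fun s _ => by
      have := hH 1 φ s; have := hL (dt φ) s; positivity
  have i2' : 0 ≤ ∫ s in (0 : ℝ)..τ, (HSq 2 (ψ s) + (ε ^ 2)⁻¹ * HSq 2 (θ s)) :=
    intervalIntegral.integral_nonneg hτ fun s _ => by have := hH' 2 ψ s; have := hH 2 θ s; positivity
  have i3 : 0 ≤ ∫ s in (0 : ℝ)..τ, (dSq 1 (dt ψ s) + (ε ^ 2)⁻¹ * dSq 1 (dt θ s)) :=
    intervalIntegral.integral_nonneg hτ fun s _ => by
      have := hd' 1 (dt ψ) s; have := hd 1 (dt θ) s; positivity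
  have i4 : 0 ≤ ∫ s in (0 : ℝ)..τ, ((ε ^ 4)⁻¹ * HSq 2 (φ s) + HSq 3 (ψ s) + (ε ^ 2)⁻¹ * HSq 3 (θ s)) :=
    intervalIntegral.integral_nonneg hτ fun s _ => by
      have := hH 2 φ s; have := hH' 3 ψ s; have := hH 3 θ s; positivity
  have i5 : 0 ≤ ∫ s in (0 : ℝ)..τ, (L2Sq (dt (dt ψ) s) + (ε ^ 2)⁻¹ * L2Sq (dt (dt θ) s)) :=
    intervalIntegral.integral_nonneg hτ fun s _ => by
      have := hL' (dt (dt ψ)) s; have := hL (dt (dt θ)) s; positivity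
  have s0 : 0 ≤ ⨆ s ∈ Set.Icc (0 : ℝ) τ,
      (L2Sq (ψ s) + (ε ^ 2)⁻¹ * L2Sq (φ s) + (ε ^ 2)⁻¹ * L2Sq (θ s)) :=
    sup_nonneg fun s => by have := hL' ψ s; have := hL φ s; have := hL θ s; positivity
  have s1 : 0 ≤ ⨆ s ∈ Set.Icc (0 : ℝ) τ, (dSq 1 (ψ s) + (ε ^ 2)⁻¹ * dSq 1 (θ s)) :=
    sup_nonneg fun s => by have := hd' 1 ψ s; have := hd 1 θ s; positivity
  have s2 : 0 ≤ ⨆ s ∈ Set.Icc (0 : ℝ) τ, dSq 1 (φ s) := sup_nonneg fun s => hd 1 φ s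
  have s3 : 0 ≤ ⨆ s ∈ Set.Icc (0 : ℝ) τ,
      ((ε ^ 2)⁻¹ * L2Sq (dt φ s) + L2Sq (dt ψ s) + (ε ^ 2)⁻¹ * L2Sq (dt θ s)) :=
    sup_nonneg fun s => by
      have := hL' (dt ψ) s; have := hL (dt φ) s; have := hL (dt θ) s; positivity
  have s4 : 0 ≤ ⨆ s ∈ Set.Icc (0 : ℝ) τ,
      ((ε ^ 2)⁻¹ * dSq 2 (φ s) + dSq 2 (ψ s) + (ε ^ 2)⁻¹ * dSq 2 (θ s)) :=
    sup_nonneg fun s => by have := hd' 2 ψ s; have := hd 2 φ s; have := hd 2 θ s; positivity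
  have s5 : 0 ≤ ⨆ s ∈ Set.Icc (0 : ℝ) τ,
      ((ε ^ 2)⁻¹ * dSq 3 (φ s) + (dSq 3 (ψ s) + dSq 1 (dt ψ s))
        + (ε ^ 2)⁻¹ * (dSq 3 (θ s) + dSq 1 (dt θ s))) :=
    sup_nonneg fun s => by
      have := hd' 3 ψ s; have := hd 3 φ s; have := hd 3 θ s
      have := hd' 1 (dt ψ) s; have := hd 1 (dt θ) s; positivity
  unfold Nfun A0 A1 A2 A3 A4 A5 at hN
  have he : ε ^ 2 * (ε ^ 4)⁻¹ = (ε ^ 2)⁻¹ := by field_simp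
  have p0 := mul_nonneg hk.le s0
  have p0' := mul_nonneg hk.le i0
  have p2 := mul_nonneg hk.le s2
  have p3 := mul_nonneg (sq_nonneg ε) s3
  have p3' := mul_nonneg (sq_nonneg ε) i3
  have p4 := mul_nonneg (sq_nonneg ε) s4
  have p4' := mul_nonneg (sq_nonneg ε) i4
  have p5 := mul_nonneg (by positivity : 0 ≤ ε ^ 4) s5
  have p5' := mul_nonneg (by positivity : 0 ≤ ε ^ 4) i5
  simp only [mul_add] at hN
  simp only [← mul_add] at hN
  refine ⟨fun t ht => ⟨?_, ?_, ?_, ?_⟩, ?_⟩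
  · have h := le_sup_of (g := fun s => L2Sq (ψ s) + (ε ^ 2)⁻¹ * L2Sq (φ s) + (ε ^ 2)⁻¹ * L2Sq (θ s))
      (((dSq_cont ψ hψ 0).add ((dSq_cont φ hφ 0).const_mul _)).add ((dSq_cont θ hθ 0).const_mul _)) ht
    have h' := mul_le_mul_of_nonneg_left h hk.le
    linarith
  · have h := le_sup_of (g := fun s => dSq 1 (ψ s) + (ε ^ 2)⁻¹ * dSq 1 (θ s))
      ((dSq_cont ψ hψ 1).add ((dSq_cont θ hθ 1).const_mul _)) ht
    linarith
  · have h := le_sup_of (g := fun s => dSq 1 (φ s)) (dSq_cont φ hφ 1) ht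
    have h' := mul_le_mul_of_nonneg_left h hk.le
    linarith
  · have h := le_sup_of (g := fun s => (ε ^ 2)⁻¹ * dSq 2 (φ s) + dSq 2 (ψ s) + (ε ^ 2)⁻¹ * dSq 2 (θ s))
      ((((dSq_cont φ hφ 2).const_mul _).add (dSq_cont ψ hψ 2)).add ((dSq_cont θ hθ 2).const_mul _)) ht
    have h' := mul_le_mul_of_nonneg_left h (sq_nonneg ε)
    linarith
  · have h : (∫ s in (0 : ℝ)..τ, (ε ^ 2)⁻¹ * HSq 2 (φ s)) ≤ ε ^ 2 * ∫ s in (0 : ℝ)..τ,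
        ((ε ^ 4)⁻¹ * HSq 2 (φ s) + HSq 3 (ψ s) + (ε ^ 2)⁻¹ * HSq 3 (θ s)) := by
      rw [← intervalIntegral.integral_const_mul]
      apply intervalIntegral.integral_mono_on hτ
      · exact ((HSq_cont φ hφ 2).const_mul _).intervalIntegrable _ _
      · exact (((((HSq_cont φ hφ 2).const_mul _).add (HSq_cont ψ hψ 3)).add
          ((HSq_cont θ hθ 3).const_mul _)).const_mul _).intervalIntegrable _ _
      · intro s _
        rw [← he]
        have := hH' 3 ψ s; have := hH 3 θ s
        have h1 : 0 ≤ ε ^ 2 * HSq 3 (ψ s) := by positivity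
        have h2 : 0 ≤ ε ^ 2 * ((ε ^ 2)⁻¹ * HSq 3 (θ s)) := by positivity
        nlinarith
    linarith

/-- a smooth function equal to `1/z` for `z ≥ 1/4` -/
def gg (z : ℝ) : ℝ := Real.smoothTransition (8 * z - 1) / z

theorem gg_eq {z : ℝ} (hz : 1 / 4 ≤ z) : gg z = z⁻¹ := by
  unfold gg
  rw [Real.smoothTransition.one_of_one_le (by linarith), one_div]

theorem gg_smooth : ContDiff ℝ (⊤ : ℕ∞) gg := by
  rw [contDiff_iff_contDiffAt]
  intro z
  by_cases hz : z = 0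
  · subst hz
    have h : gg =ᶠ[𝓝 0] fun _ => (0 : ℝ) := by
      filter_upwards [Iio_mem_nhds (show (0 : ℝ) < 1 / 8 by norm_num)] with y hy
      unfold gg
      rw [Real.smoothTransition.zero_of_nonpos (by have : y < 1 / 8 := hy; linarith), zero_div]
    exact contDiffAt_const.congr_of_eventuallyEq h
  · refine ContDiffAt.div ?_ contDiffAt_id hz
    exact (Real.smoothTransition.contDiff.comp
      ((contDiff_const.mul contDiff_id).sub contDiff_const)).contDiffAt

/-- background temperature -/
def TT (γ Pr ε χ : ℝ) : SA :=
  kk χ + kk (1 - χ) * X2 - kk (ε ^ 2 * Pr / (2 * (γ / (γ - 1)))) * (X2 ^ 2 - X2)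

theorem TT_ap (γ Pr ε χ t : ℝ) (x : ℝ × ℝ) : (TT γ Pr ε χ).1 (t, x) = tT γ Pr ε χ x := rfl

/-- background density -/
def RR (γ Pr ε χ : ℝ) : SA := ⟨fun p => gg ((TT γ Pr ε χ).1 p), gg_smooth.comp (smo _)⟩

theorem RR_ap (γ Pr ε χ t : ℝ) (x : ℝ × ℝ) : (RR γ Pr ε χ).1 (t, x) = gg (tT γ Pr ε χ x) := rfl

theorem DD_RR (γ Pr ε χ : ℝ) (v p : E3) :
    (DD v (RR γ Pr ε χ)).1 p = deriv gg ((TT γ Pr ε χ).1 p) * (DD v (TT γ Pr ε χ)).1 p := by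
  rw [DD_ap, DD_ap]
  have h : fderiv ℝ (gg ∘ (TT γ Pr ε χ).1) p = _ :=
    fderiv_comp p (gg_smooth.differentiable (by simp) _) (dif (TT γ Pr ε χ) p)
  change fderiv ℝ (gg ∘ (TT γ Pr ε χ).1) p v = _
  rw [h, ContinuousLinearMap.comp_apply, fderiv_eq_smul_deriv, smul_eq_mul, mul_comm]

theorem D1_TT (γ Pr ε χ : ℝ) : D1 (TT γ Pr ε χ) = 0 := by
  simp [TT, D1_add, D1_sub, D1_mul, D1_kk, D1_X2, D1_sq]
theorem Dt_TT (γ Pr ε χ : ℝ) : Dt (TT γ Pr ε χ) = 0 := by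
  simp [TT, Dt_add, Dt_sub, Dt_mul, Dt_kk, Dt_X2, Dt_sq]
theorem D2_TT (γ Pr ε χ : ℝ) (p : E3) : (D2 (TT γ Pr ε χ)).1 p
    = (1 - χ) - ε ^ 2 * Pr / (2 * (γ / (γ - 1))) * (2 * p.2.2 - 1) := by
  have : D2 (TT γ Pr ε χ) = kk (1 - χ) - kk (ε ^ 2 * Pr / (2 * (γ / (γ - 1)))) * (kk 2 * X2 - 1) := by
    simp [TT, D2_add, D2_sub, D2_mul, D2_kk, D2_X2, D2_sq]
  rw [this]
  rfl
theorem D1_RR (γ Pr ε χ : ℝ) : D1 (RR γ Pr ε χ) = 0 := SA_ext fun p => by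
  have h := DD_RR γ Pr ε χ e1 p
  have h2 : DD e1 (TT γ Pr ε χ) = 0 := D1_TT γ Pr ε χ
  rw [h2, zero_ap, mul_zero] at h
  exact h
theorem Dt_RR (γ Pr ε χ : ℝ) : Dt (RR γ Pr ε χ) = 0 := SA_ext fun p => by
  have h := DD_RR γ Pr ε χ e0 p
  have h2 : DD e0 (TT γ Pr ε χ) = 0 := Dt_TT γ Pr ε χ
  rw [h2, zero_ap, mul_zero] at h
  exact h

theorem deriv_gg {z : ℝ} (hz : 1 / 2 ≤ z) : |deriv gg z| ≤ 4 := by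
  have h : gg =ᶠ[𝓝 z] fun y => y⁻¹ := by
    filter_upwards [Ioi_mem_nhds (show (1 : ℝ) / 4 < z by linarith)] with y hy
    exact gg_eq (le_of_lt hy)
  rw [h.deriv_eq, deriv_inv, abs_neg, abs_of_nonneg (by positivity)]
  rw [show (4 : ℝ) = ((1 / 2 : ℝ) ^ 2)⁻¹ by norm_num]
  gcongr

/-- Viscous heating constant. -/
def bb (γ Pr : ℝ) : ℝ := Pr * (γ - 1) / (2 * γ)

theorem bb_eq {γ Pr ε : ℝ} (hγ : 1 < γ) : ε ^ 2 * Pr / (2 * (γ / (γ - 1))) = ε ^ 2 * bb γ Pr := by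
  have : γ - 1 ≠ 0 := by linarith
  have : γ ≠ 0 := by linarith
  unfold bb
  field_simp

theorem bb_pos {γ Pr : ℝ} (hγ : 1 < γ) (hPr : 0 < Pr) : 0 < bb γ Pr := by
  have : 0 < γ - 1 := by linarith
  unfold bb
  positivity

section
variable {γ Pr ε χ : ℝ}

theorem T_bd (hγ : 1 < γ) (hPr : 0 < Pr) (hε : 0 < ε) (hε1 : ε ≤ 1)
    (hχ : |1 - χ| ≤ 1 / 2) {x : ℝ × ℝ} (hx : x ∈ Ω) :
    1 / 2 ≤ tT γ Pr ε χ x ∧ tT γ Pr ε χ x ≤ 3 / 2 + bb γ Pr := by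
  obtain ⟨h1, h2⟩ := abs_le.1 hχ
  have hb := bb_pos hγ hPr
  have y0 : 0 < x.2 := hx.2.1
  have y1 : x.2 < 1 := hx.2.2
  unfold tT
  rw [bb_eq hγ]
  have e2 : ε ^ 2 ≤ 1 := by nlinarith
  have hc0 : 0 ≤ ε ^ 2 * bb γ Pr := by positivity
  have hc1 : ε ^ 2 * bb γ Pr ≤ bb γ Pr := by nlinarith
  have hy : 0 ≤ x.2 - x.2 ^ 2 := by nlinarith
  have hy1 : x.2 - x.2 ^ 2 ≤ 1 := by nlinarith
  have h3 := mul_nonneg hc0 hy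
  have h4 := mul_le_mul_of_nonneg_left hy1 hc0
  constructor
  · nlinarith
  · nlinarith

theorem T'_bd {K : ℝ} (hγ : 1 < γ) (hPr : 0 < Pr) (hε : 0 < ε) (hε1 : ε ≤ 1)
    (hK : |1 - χ| ≤ K * ε) {x : ℝ × ℝ} (hx : x ∈ Ω) (t : ℝ) :
    |(D2 (TT γ Pr ε χ)).1 (t, x)| ≤ (K + bb γ Pr) * ε := by
  rw [D2_TT, bb_eq hγ]
  have hb := bb_pos hγ hPr
  have y0 : 0 < x.2 := hx.2.1
  have y1 : x.2 < 1 := hx.2.2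
  have e2 : ε ^ 2 ≤ ε := by nlinarith
  have hc0 : 0 ≤ ε ^ 2 * bb γ Pr := by positivity
  have hc1 : ε ^ 2 * bb γ Pr ≤ ε * bb γ Pr := by nlinarith
  obtain ⟨h1, h2⟩ := abs_le.1 hK
  rw [abs_le]
  simp only
  constructor
  · nlinarith
  · nlinarith

theorem R'_bd {K : ℝ} (hγ : 1 < γ) (hPr : 0 < Pr) (hε : 0 < ε) (hε1 : ε ≤ 1)
    (hχ : |1 - χ| ≤ 1 / 2) (hK : |1 - χ| ≤ K * ε) {x : ℝ × ℝ} (hx : x ∈ Ω) (t : ℝ) :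
    |(D2 (RR γ Pr ε χ)).1 (t, x)| ≤ 4 * ((K + bb γ Pr) * ε) := by
  have h : (D2 (RR γ Pr ε χ)).1 (t, x) = _ := DD_RR γ Pr ε χ e2 (t, x)
  rw [h, abs_mul]
  exact mul_le_mul (deriv_gg (T_bd hγ hPr hε hε1 hχ hx).1) (T'_bd hγ hPr hε hε1 hK hx t)
    (abs_nonneg _) (by norm_num)

theorem R_eq (hγ : 1 < γ) (hPr : 0 < Pr) (hε : 0 < ε) (hε1 : ε ≤ 1)
    (hχ : |1 - χ| ≤ 1 / 2) {x : ℝ × ℝ} (hx : x ∈ Ω) (t : ℝ) :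
    (RR γ Pr ε χ).1 (t, x) = tρ γ Pr ε χ x :=
  gg_eq (by have := (T_bd hγ hPr hε hε1 hχ hx).1; change 1 / 4 ≤ tT γ Pr ε χ x; linarith)

theorem R_bd (hγ : 1 < γ) (hPr : 0 < Pr) (hε : 0 < ε) (hε1 : ε ≤ 1)
    (hχ : |1 - χ| ≤ 1 / 2) {x : ℝ × ℝ} (hx : x ∈ Ω) (t : ℝ) :
    (3 / 2 + bb γ Pr)⁻¹ ≤ (RR γ Pr ε χ).1 (t, x) ∧ (RR γ Pr ε χ).1 (t, x) ≤ 2 := by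
  rw [R_eq hγ hPr hε hε1 hχ hx]
  obtain ⟨h1, h2⟩ := T_bd hγ hPr hε hε1 hχ hx
  have : 0 < tT γ Pr ε χ x := by linarith
  unfold tρ
  constructor
  · gcongr
  · rw [show (2 : ℝ) = (1 / 2)⁻¹ by norm_num]
    gcongr
end

theorem d_congr {g : ℝ × ℝ → ℝ} {a : SA} {t : ℝ} (hg : ∀ y ∈ Ω, g y = a.1 (t, y)) {x : ℝ × ℝ}
    (hx : x ∈ Ω) : d1 g x = (D1 a).1 (t, x) ∧ d2 g x = (D2 a).1 (t, x) := by
  have h : g =ᶠ[𝓝 x] fun y => a.1 (t, y) := by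
    filter_upwards [Ω_open.mem_nhds hx] with y hy
    exact hg y hy
  have h1 := congrFun (sl_d1 a t) x
  have h2 := congrFun (sl_d2 a t) x
  rw [← h1, ← h2]
  unfold d1 d2
  rw [h.fderiv_eq]
  exact ⟨rfl, rfl⟩

theorem divv_sl (p q : SA) (t : ℝ) : divv (fun y : ℝ × ℝ => ((p.1 (t, y), q.1 (t, y)) : ℝ × ℝ))
    = fun y => (D1 p + D2 q).1 (t, y) := by
  funext x
  unfold divv
  simp only [sl_d1, sl_d2]
  rfl

theorem lap_sl (a : SA) (t : ℝ) : lap (fun y : ℝ × ℝ => a.1 (t, y))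
    = fun y => (D1 (D1 a) + D2 (D2 a)).1 (t, y) := by
  funext x
  unfold lap
  simp only [sl_d1, sl_d2]
  rfl

theorem grad_sl (a : SA) (t : ℝ) : grad (fun y : ℝ × ℝ => a.1 (t, y))
    = fun y => ((D1 a).1 (t, y), (D2 a).1 (t, y)) := by
  funext x
  unfold grad
  simp only [sl_d1, sl_d2]

theorem tu1 : (fun y : ℝ × ℝ => (tu y).1) = fun y => X2.1 (0, y) := rfl
theorem tu2 : (fun y : ℝ × ℝ => (tu y).2) = fun y => (kk 0).1 (0, y) := rfl

theorem eqs {γ Pr r Re ε χ τ : ℝ} (S : PerturbSol γ Pr r Re ε χ τ) (f p q h : SA)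
    (eφ : S.φ = fun s x => f.1 (s, x)) (eψ : S.ψ = fun s x => (p.1 (s, x), q.1 (s, x)))
    (eθ : S.θ = fun s x => h.1 (s, x))
    (hγ : 1 < γ) (hPr : 0 < Pr) (hε : 0 < ε) (hε1 : ε ≤ 1) (hχ : |1 - χ| ≤ 1 / 2)
    {t : ℝ} (ht : t ∈ Set.Icc 0 τ) {x : ℝ × ℝ} (hx : x ∈ Ω) :
    (Dt f + (X2 + p) * D1 f + q * D2 f + (RR γ Pr ε χ + f) * (D1 p + D2 q) + q * D2 (RR γ Pr ε χ)).1 (t, x) = 0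
    ∧ ((RR γ Pr ε χ + f) * (Dt p + (X2 + p) * D1 p + q * D2 p + q)
      + kk (ε ^ 2)⁻¹ * D1 (RR γ Pr ε χ * h + TT γ Pr ε χ * f + f * h)
      - kk Re⁻¹ * (D1 (D1 p) + D2 (D2 p)) - kk (Re⁻¹ * (1 + r)) * (D1 (D1 p) + D1 (D2 q))).1 (t, x) = 0
    ∧ ((RR γ Pr ε χ + f) * (Dt q + (X2 + p) * D1 q + q * D2 q)
      + kk (ε ^ 2)⁻¹ * D2 (RR γ Pr ε χ * h + TT γ Pr ε χ * f + f * h)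
      - kk Re⁻¹ * (D1 (D1 q) + D2 (D2 q)) - kk (Re⁻¹ * (1 + r)) * (D2 (D1 p) + D2 (D2 q))).1 (t, x) = 0
    ∧ (kk (1 / (γ - 1)) * (RR γ Pr ε χ + f) * (Dt h + (X2 + p) * D1 h + q * D2 h + q * D2 (TT γ Pr ε χ))
      + (RR γ Pr ε χ + f) * (TT γ Pr ε χ + h) * (D1 p + D2 q)
      - kk (γ / (γ - 1) / (Re * Pr)) * (D1 (D1 h) + D2 (D2 h))
      - kk (ε ^ 2) * (kk (2 * Re⁻¹) * (D1 p ^ 2 + D2 q ^ 2 + kk (1 / 2) * (D1 q + D2 p) ^ 2)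
        + kk (2 * Re⁻¹) * (D1 q + D2 p) + kk (r * Re⁻¹) * (D1 p + D2 q) ^ 2)).1 (t, x) = 0 := by
  have hR : ∀ y ∈ Ω, tρ γ Pr ε χ y = (RR γ Pr ε χ).1 (t, y) := fun y hy =>
    (R_eq hγ hPr hε hε1 hχ hy t).symm
  have hT : ∀ y, tT γ Pr ε χ y = (TT γ Pr ε χ).1 (t, y) := fun y => rfl
  obtain ⟨dR1, dR2⟩ := d_congr hR hx
  obtain ⟨dT1, dT2⟩ := d_congr (fun y _ => hT y) hx
  have hRT : ∀ y ∈ Ω, (1 : ℝ) = (RR γ Pr ε χ * TT γ Pr ε χ).1 (t, y) := fun y hy => by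
    rw [mul_ap, ← hR y hy, ← hT y]
    have := (T_bd hγ hPr hε hε1 hχ hy).1
    exact (inv_mul_cancel₀ (by linarith)).symm
  obtain ⟨dO1, dO2⟩ := d_congr hRT hx
  have o1 : d1 (fun _ : ℝ × ℝ => (1 : ℝ)) x = 0 := by unfold d1; simp
  have o2 : d2 (fun _ : ℝ × ℝ => (1 : ℝ)) x = 0 := by unfold d2; simp
  rw [o1] at dO1
  rw [o2] at dO2
  have hP : ∀ y ∈ Ω, pρ γ Pr ε χ (fun s x => f.1 (s, x)) t y * pT γ Pr ε χ (fun s x => h.1 (s, x)) t y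
      = (RR γ Pr ε χ * TT γ Pr ε χ + (RR γ Pr ε χ * h + TT γ Pr ε χ * f + f * h)).1 (t, y) :=
    fun y hy => by
      simp only [pρ, pT, hR y hy, hT, add_ap, mul_ap]
      ring
  obtain ⟨dP1, dP2⟩ := d_congr hP hx
  rw [D1_add, add_ap, ← dO1, zero_add] at dP1
  rw [D2_add, add_ap, ← dO2, zero_add] at dP2
  have z1 : (D1 (RR γ Pr ε χ)).1 (t, x) = 0 := by rw [D1_RR]; rfl
  have z2 : (D1 (TT γ Pr ε χ)).1 (t, x) = 0 := by rw [D1_TT]; rfl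
  have m0 := S.mass_eq t ht x hx
  have m1 := S.mom_eq1 t ht x hx
  have m2 := S.mom_eq2 t ht x hx
  have m3 := S.energy_eq t ht x hx
  rw [eφ, eψ] at m0
  rw [eφ, eψ, eθ] at m1 m2 m3
  have gR : grad (tρ γ Pr ε χ) x = (0, (D2 (RR γ Pr ε χ)).1 (t, x)) := by
    unfold grad; rw [dR1, dR2, z1]
  have gT : grad (tT γ Pr ε χ) x = (0, (D2 (TT γ Pr ε χ)).1 (t, x)) := by
    unfold grad; rw [dT1, dT2, z2]
  have gu1 : grad (fun y : ℝ × ℝ => (tu y).1) x = (0, 1) := by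
    rw [tu1, grad_sl, D1_X2, D2_X2]; rfl
  have gu2 : grad (fun y : ℝ × ℝ => (tu y).2) x = (0, 0) := by
    rw [tu2, grad_sl, D1_kk, D2_kk]; rfl
  have du : defContract tu (fun y : ℝ × ℝ => ((p.1 (t, y), q.1 (t, y)) : ℝ × ℝ)) x
      = ((D1 q).1 (t, x) + (D2 p).1 (t, x)) / 2 := by
    unfold defContract
    rw [tu1, tu2]
    simp only [sl_d1, sl_d2, D1_X2, D2_X2, D1_kk, D2_kk, zero_ap, one_ap]
    ring
  have dd : defContract (fun y : ℝ × ℝ => ((p.1 (t, y), q.1 (t, y)) : ℝ × ℝ))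
      (fun y : ℝ × ℝ => ((p.1 (t, y), q.1 (t, y)) : ℝ × ℝ)) x
      = (D1 p).1 (t, x) ^ 2 + (D2 q).1 (t, x) ^ 2 + 1 / 2 * ((D1 q).1 (t, x) + (D2 p).1 (t, x)) ^ 2 := by
    unfold defContract
    simp only [sl_d1, sl_d2]
    ring
  rw [dP1, gu1, divv_sl, sl_d1] at m1
  rw [dP2, gu2, divv_sl, sl_d2] at m2
  simp only [dt_sl, dt_pair, divv_sl, grad_sl, lap_sl, sl_d1, sl_d2, gR, gT, du, dd] at m0 m1 m2 m3
  simp only [pρ, pT, pu, hR x hx, hT, dot, tu, D1_add, D2_add, add_ap, mul_ap, Prod.fst_add, Prod.snd_add] at m0 m1 m2 m3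
  refine ⟨?_, ?_, ?_, ?_⟩
  · simp only [add_ap, mul_ap, sub_ap, X2_ap, pow_ap, kk_ap]
    linarith
  · simp only [D1_add, add_ap, mul_ap, sub_ap, X2_ap, pow_ap, kk_ap]
    linarith
  · simp only [D2_add, add_ap, mul_ap, sub_ap, X2_ap, pow_ap, kk_ap]
    linarith
  · simp only [add_ap, mul_ap, sub_ap, X2_ap, pow_ap, kk_ap]
    rw [one_div, inv_mul_eq_div]
    linarith

theorem van_dt {a : SA} {τ : ℝ} (hv : ∀ t ∈ Set.Icc 0 τ, Van t a) (h0 : Van 0 (Dt a)) :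
    ∀ t ∈ Set.Icc 0 τ, Van t (Dt a) := by
  intro t ht
  rcases eq_or_lt_of_le (ht.1.trans ht.2) with h | h
  · have : t = 0 := le_antisymm (h ▸ ht.2) ht.1
    rw [this]; exact h0
  · intro x y hy
    have h1 := (hasDerivAt_t a t x y).hasDerivWithinAt (s := Set.Icc 0 τ)
    have h2 : HasDerivWithinAt (fun s => a.1 (s, x, y)) 0 (Set.Icc 0 τ) t :=
      (hasDerivWithinAt_const t (Set.Icc 0 τ) (0 : ℝ)).congr (fun s hs => hv s hs x y hy) (hv t ht x y hy)
    exact (uniqueDiffOn_Icc h t ht).eq_deriv _ h1 h2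

/-- scalar form of the a priori bounds at one time -/
structure SB (ε : ℝ) (a : SA) (t : ℝ) : Prop where
  b0 : (ε ^ 2)⁻¹ * J (a ^ 2) t ≤ 1
  b1 : J (D1 a ^ 2) t ≤ 1
  b2 : J (D2 a ^ 2) t ≤ 1
  b11 : ε ^ 2 * J (D1 (D1 a) ^ 2) t ≤ 1
  b12 : ε ^ 2 * J (D1 (D2 a) ^ 2) t ≤ 1
  b22 : ε ^ 2 * J (D2 (D2 a) ^ 2) t ≤ 1

theorem SB_of {ε : ℝ} {a : SA} {t : ℝ} (hε : 0 < ε)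
    (h0 : (ε ^ 2)⁻¹ * dSq 0 (fun y : ℝ × ℝ => a.1 (t, y)) ≤ 1)
    (h1 : dSq 1 (fun y : ℝ × ℝ => a.1 (t, y)) ≤ 1)
    (h2 : ε ^ 2 * dSq 2 (fun y : ℝ × ℝ => a.1 (t, y)) ≤ 1) : SB ε a t where
  b0 := by rwa [dSq0] at h0
  b1 := (J1_le a t).trans h1
  b2 := (J2_le a t).trans h1
  b11 := (mul_le_mul_of_nonneg_left (J11_le a t) (sq_nonneg ε)).trans h2
  b12 := (mul_le_mul_of_nonneg_left (J12_le a t) (sq_nonneg ε)).trans h2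
  b22 := (mul_le_mul_of_nonneg_left (J22_le a t) (sq_nonneg ε)).trans h2

theorem SB.sup {ε : ℝ} {a : SA} {t : ℝ} (h : SB ε a t) (hε : 0 < ε) (hε1 : ε ≤ 1) {x : ℝ × ℝ}
    (hx : x ∈ Ω) : |a.1 (t, x)| ≤ 5 := by
  have := supΩ a (m := ε⁻¹) ((one_le_inv₀ hε).2 hε1) t x hx
  rw [inv_pow, inv_inv] at this
  apply abs_le_of_sq_le_sq (by linarith [h.b0, h.b1, h.b2, h.b12]) (by norm_num)

theorem smul_J (c : ℝ) (a : SA) (t : ℝ) : J ((kk c * a) ^ 2) t = c ^ 2 * J (a ^ 2) t := by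
  rw [← J_kk]
  apply J_congr
  intro x _
  simp only [pow_ap, mul_ap, kk_ap]
  ring

/-- all a priori bounds for the components -/
theorem comps {ε τ : ℝ} (f p q h : SA) (hε : 0 < ε) (hτ : 0 ≤ τ)
    (hN : Nfun ε (fun s x => f.1 (s, x)) (fun s x => (p.1 (s, x), q.1 (s, x)))
      (fun s x => h.1 (s, x)) τ ≤ 1) :
    (∀ t ∈ Set.Icc (0 : ℝ) τ, SB ε p t ∧ SB ε q t ∧ SB ε (kk ε⁻¹ * f) t ∧ SB ε (kk ε⁻¹ * h) t)
    ∧ ∫ s in (0 : ℝ)..τ, (ε ^ 2)⁻¹ * (J (f ^ 2) s + J (D1 f ^ 2) s + J (D2 f ^ 2) s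
    + J (D1 (D2 f) ^ 2) s) ≤ 2 := by
  obtain ⟨hb, hi⟩ := bounds (φ := fun s x => f.1 (s, x)) (ψ := fun s x => (p.1 (s, x), q.1 (s, x)))
    (θ := fun s x => h.1 (s, x)) (smo f) ((smo p).prodMk (smo q)) (smo h) hε hτ hN
  have hk : 0 < (ε ^ 2)⁻¹ := by positivity
  have he : 0 < ε ^ 2 := by positivity
  constructor
  · intro t ht
    obtain ⟨g0, g1, g2, g3⟩ := hb t ht
    simp only [L2Sq, dSq0] at g0
    have aux : ∀ a : SA, (ε ^ 2)⁻¹ * ((ε ^ 2)⁻¹ * J (a ^ 2) t) ≤ 1 →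
        (ε ^ 2)⁻¹ * dSq 1 (fun y : ℝ × ℝ => a.1 (t, y)) ≤ 1 →
        dSq 2 (fun y : ℝ × ℝ => a.1 (t, y)) ≤ 1 → SB ε (kk ε⁻¹ * a) t := by
      intro a h0 h1 h2
      have d1 : D1 (kk ε⁻¹ * a) = kk ε⁻¹ * D1 a := by simp [D1_mul, D1_kk]
      have d2 : D2 (kk ε⁻¹ * a) = kk ε⁻¹ * D2 a := by simp [D2_mul, D2_kk]
      have e1 : ∀ b : SA, D1 (kk ε⁻¹ * b) = kk ε⁻¹ * D1 b := fun b => by simp [D1_mul, D1_kk]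
      have e2 : ∀ b : SA, D2 (kk ε⁻¹ * b) = kk ε⁻¹ * D2 b := fun b => by simp [D2_mul, D2_kk]
      have hc : ε ^ 2 * (ε ^ 2)⁻¹ = 1 := mul_inv_cancel₀ he.ne'
      refine ⟨?_, ?_, ?_, ?_, ?_, ?_⟩
      · rw [smul_J, inv_pow]; exact h0
      · rw [e1, smul_J, inv_pow]
        exact (mul_le_mul_of_nonneg_left (J1_le a t) hk.le).trans h1
      · rw [e2, smul_J, inv_pow]
        exact (mul_le_mul_of_nonneg_left (J2_le a t) hk.le).trans h1
      · rw [e1, e1, smul_J, inv_pow, ← mul_assoc, hc, one_mul]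
        exact (J11_le a t).trans h2
      · rw [e2, e1, smul_J, inv_pow, ← mul_assoc, hc, one_mul]
        exact (J12_le a t).trans h2
      · rw [e2, e2, smul_J, inv_pow, ← mul_assoc, hc, one_mul]
        exact (J22_le a t).trans h2
    have nf0 := J_sq_nonneg f t
    have nh0 := J_sq_nonneg h t
    have k2f : 0 ≤ (ε ^ 2)⁻¹ * ((ε ^ 2)⁻¹ * J (f ^ 2) t) := by positivity
    have k2h : 0 ≤ (ε ^ 2)⁻¹ * ((ε ^ 2)⁻¹ * J (h ^ 2) t) := by positivity
    have nψ := fun j => dSq_nonneg j (fun y : ℝ × ℝ => ((p.1 (t, y), q.1 (t, y)) : ℝ × ℝ))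
    have nf := fun j => dSq_nonneg j (fun y : ℝ × ℝ => f.1 (t, y))
    have nh := fun j => dSq_nonneg j (fun y : ℝ × ℝ => h.1 (t, y))
    have hc : ∀ z : ℝ, ε ^ 2 * ((ε ^ 2)⁻¹ * z) = z := fun z => by
      rw [← mul_assoc, mul_inv_cancel₀ he.ne', one_mul]
    rw [mul_add, mul_add] at g0 g3
    rw [hc, hc] at g3
    have n0 := mul_nonneg hk.le (nψ 0)
    have n2 := mul_nonneg he.le (nψ 2)
    have nh1 := mul_nonneg hk.le (nh 1)
    have F0 := fun j => pairfst p q t j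
    have S0 := fun j => pairsnd p q t j
    refine ⟨SB_of hε ?_ ?_ ?_, SB_of hε ?_ ?_ ?_, aux f ?_ g2 ?_, aux h ?_ ?_ ?_⟩
    · linarith [mul_le_mul_of_nonneg_left (F0 0) hk.le]
    · linarith [F0 1]
    · linarith [mul_le_mul_of_nonneg_left (F0 2) he.le, nf 2, nh 2]
    · linarith [mul_le_mul_of_nonneg_left (S0 0) hk.le]
    · linarith [S0 1]
    · linarith [mul_le_mul_of_nonneg_left (S0 2) he.le, nf 2, nh 2]
    · linarith
    · linarith [nf 2, nh 2]
    · linarith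
    · linarith [nψ 1]
    · linarith [nf 2, nh 2]
  · have h2 : (2 : ℝ) ≥ ∫ s in (0 : ℝ)..τ, 2 * ((ε ^ 2)⁻¹ * HSq 2 (fun x => f.1 (s, x))) := by
      rw [intervalIntegral.integral_const_mul]; linarith
    refine le_trans ?_ h2
    apply intervalIntegral.integral_mono_on hτ
    · exact (((((J_cont _).add (J_cont _)).add (J_cont _)).add (J_cont _)).const_mul _).intervalIntegrable _ _
    · exact (((HSq_cont (fun s x => f.1 (s, x)) (smo f) 2).const_mul _).const_mul _).intervalIntegrable _ _
    · intro s _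
      have e : HSq 2 (fun x => f.1 (s, x)) = J (f ^ 2) s + dSq 1 (fun x : ℝ × ℝ => f.1 (s, x))
          + dSq 2 (fun x : ℝ × ℝ => f.1 (s, x)) := by
        simp [HSq, Finset.sum_range_succ, dSq0]
      have : J (f ^ 2) s + J (D1 f ^ 2) s + J (D2 f ^ 2) s + J (D1 (D2 f) ^ 2) s
          ≤ 2 * HSq 2 (fun x => f.1 (s, x)) := by
        rw [e]
        linarith [J1_le f s, J2_le f s, J12_le f s, J_sq_nonneg f s,
          dSq_nonneg 2 (fun x : ℝ × ℝ => f.1 (s, x))]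
      calc _ ≤ (ε ^ 2)⁻¹ * (2 * HSq 2 (fun x => f.1 (s, x))) := mul_le_mul_of_nonneg_left this hk.le
        _ = _ := by ring

/-- lower constant -/
def cc (γ Pr : ℝ) : ℝ :=
  min 1 (min ((3 / 2 + bb γ Pr)⁻¹ / 2) (min (1 / (γ - 1)) (γ / (γ - 1) / Pr)))
/-- upper constant -/
def BB (γ Pr r K : ℝ) : ℝ :=
  7 + |r| + |1 + r| + 1 / (γ - 1) + γ / (γ - 1) / Pr + 4 * (K + bb γ Pr) + bb γ Pr

theorem cc_pos {γ Pr : ℝ} (hγ : 1 < γ) (hPr : 0 < Pr) : 0 < cc γ Pr := by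
  have := bb_pos hγ hPr
  have h1 : 0 < γ - 1 := by linarith
  have h2 : 0 < γ := by linarith
  unfold cc
  refine lt_min one_pos (lt_min ?_ (lt_min ?_ ?_)) <;> positivity

theorem BB_ge {γ Pr r K : ℝ} (hγ : 1 < γ) (hPr : 0 < Pr) (hK : 0 < K) : 7 ≤ BB γ Pr r K := by
  have := bb_pos hγ hPr
  have h1 : 0 < γ - 1 := by linarith
  have h2 : 0 < γ := by linarith
  have h3 : 0 < 1 / (γ - 1) := by positivity
  have h4 : 0 < γ / (γ - 1) / Pr := by positivity
  unfold BB
  linarith [abs_nonneg r, abs_nonneg (1 + r)]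

set_option maxHeartbeats 2000000 in
theorem mkSys {γ Pr r Re ε χ τ K : ℝ} (S : PerturbSol γ Pr r Re ε χ τ) (f p q h : SA)
    (eφ : S.φ = fun s x => f.1 (s, x)) (eψ : S.ψ = fun s x => (p.1 (s, x), q.1 (s, x)))
    (eθ : S.θ = fun s x => h.1 (s, x))
    (hγ : 1 < γ) (hPr : 0 < Pr) (hr : 0 < 1 + r) (hK : 0 < K) (hRe : 0 < Re) (hRe1 : Re ≤ 1)
    (hε : 0 < ε) (hε1 : ε ≤ 1) (hεs : ε ≤ (3 / 2 + bb γ Pr)⁻¹ / 10)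
    (hχK : |1 - χ| ≤ K * ε) (hχ : |1 - χ| ≤ 1 / 2) (hτ : 0 ≤ τ) (hS : StdHyp S)
    (hN : Nfun ε S.φ S.ψ S.θ τ ≤ 1) :
    ∃ Y : Sys (BB γ Pr r K) (cc γ Pr) r Re⁻¹ ε (1 / (γ - 1)) (γ / (γ - 1) / (Re * Pr)) τ,
      Y.f = f ∧ Y.p = p ∧ Y.q = q ∧ Y.h = h := by
  have hb := bb_pos hγ hPr
  have h1 : 0 < γ - 1 := by linarith
  have h2 : 0 < γ := by linarith
  have h3 : 0 < 1 / (γ - 1) := by positivity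
  have h4 : 0 < γ / (γ - 1) / Pr := by positivity
  have a1 := abs_nonneg r
  have a2 := abs_nonneg (1 + r)
  have hB7 := BB_ge (r := r) hγ hPr hK
  have hBe : BB γ Pr r K =
    7 + |r| + |1 + r| + 1 / (γ - 1) + γ / (γ - 1) / Pr + 4 * (K + bb γ Pr) + bb γ Pr := rfl
  have c1 : cc γ Pr ≤ 1 := min_le_left _ _
  have c2 : cc γ Pr ≤ (3 / 2 + bb γ Pr)⁻¹ / 2 := (min_le_right _ _).trans (min_le_left _ _)
  have c3 : cc γ Pr ≤ 1 / (γ - 1) :=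
    (min_le_right _ _).trans ((min_le_right _ _).trans (min_le_left _ _))
  have c4 : cc γ Pr ≤ γ / (γ - 1) / Pr :=
    (min_le_right _ _).trans ((min_le_right _ _).trans (min_le_right _ _))
  have r0p : 0 < (3 / 2 + bb γ Pr)⁻¹ := by positivity
  have r01 : (3 / 2 + bb γ Pr)⁻¹ ≤ 2 / 3 := by
    rw [show (2 / 3 : ℝ) = (3 / 2)⁻¹ by norm_num]
    gcongr
    linarith
  have hκe : γ / (γ - 1) / (Re * Pr) = γ / (γ - 1) / Pr * Re⁻¹ := by field_simp
  have hμ0 : 0 < Re⁻¹ := by positivity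
  rw [eφ, eψ, eθ] at hN
  obtain ⟨hc, hi⟩ := comps f p q h hε hτ hN
  have he2 : 0 < ε ^ 2 := by positivity
  have he21 : ε ^ 2 ≤ 1 := by nlinarith
  have k1 : 1 ≤ (ε ^ 2)⁻¹ := (one_le_inv₀ he2).2 he21
  have sc : ∀ (a : SA) (t : ℝ), SB ε (kk ε⁻¹ * a) t → ∀ x ∈ Ω, |a.1 (t, x)| ≤ 5 * ε := by
    intro a t hs x hx
    have := hs.sup hε hε1 hx
    rw [mul_ap, kk_ap, abs_mul, abs_of_pos (inv_pos.2 hε), inv_mul_le_iff₀ hε] at this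
    linarith
  have hε5 : 5 * ε ≤ BB γ Pr r K * ε := by nlinarith
  have bf : ∀ t ∈ Set.Icc 0 τ, ∀ x ∈ Ω, |f.1 (t, x)| ≤ 5 * ε := fun t ht => sc f t (hc t ht).2.2.1
  have bh : ∀ t ∈ Set.Icc 0 τ, ∀ x ∈ Ω, |h.1 (t, x)| ≤ 5 * ε := fun t ht => sc h t (hc t ht).2.2.2
  have bR := fun (t : ℝ) (x : ℝ × ℝ) (hx : x ∈ Ω) => R_bd hγ hPr hε hε1 hχ hx t
  have bT := fun (x : ℝ × ℝ) (hx : x ∈ Ω) => T_bd hγ hPr hε hε1 hχ hx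
  have bR' := fun (t : ℝ) (x : ℝ × ℝ) (hx : x ∈ Ω) => R'_bd hγ hPr hε hε1 hχ hχK hx t
  have bT' := fun (t : ℝ) (x : ℝ × ℝ) (hx : x ∈ Ω) => T'_bd hγ hPr hε hε1 hχK hx t
  have EQ := fun (t : ℝ) (ht : t ∈ Set.Icc 0 τ) (x : ℝ × ℝ) (hx : x ∈ Ω) =>
    eqs S f p q h eφ eψ eθ hγ hPr hε hε1 hχ ht hx
  have hψ0 : ∀ t ∈ Set.Icc 0 τ, ∀ x y : ℝ, (y = 0 ∨ y = 1) →
      ((p.1 (t, x, y), q.1 (t, x, y)) : ℝ × ℝ) = 0 := fun t ht x y hy => by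
    have := S.bc_ψ t ht (x, y) hy
    rwa [eψ] at this
  have vp : ∀ t ∈ Set.Icc 0 τ, Van t p := fun t ht x y hy => congrArg Prod.fst (hψ0 t ht x y hy)
  have vq : ∀ t ∈ Set.Icc 0 τ, Van t q := fun t ht x y hy => congrArg Prod.snd (hψ0 t ht x y hy)
  have vh : ∀ t ∈ Set.Icc 0 τ, Van t h := fun t ht x y hy => by
    have := S.bc_θ t ht (x, y) hy
    rwa [eθ] at this
  have h00 := hS.2.2.2.2
  rw [eψ, eθ, dt_pair, dt_sl] at h00
  have vp0 : Van 0 (Dt p) := fun x y hy => congrArg Prod.fst (h00 (x, y) hy).1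
  have vq0 : Van 0 (Dt q) := fun x y hy => congrArg Prod.snd (h00 (x, y) hy).1
  have vh0 : Van 0 (Dt h) := fun x y hy => (h00 (x, y) hy).2
  have pψ : ∀ t x y : ℝ, ((p.1 (t, x + 2 * π, y), q.1 (t, x + 2 * π, y)) : ℝ × ℝ)
      = (p.1 (t, x, y), q.1 (t, x, y)) := fun t x y => by
    have := S.periodic_ψ t (x, y)
    rwa [eψ] at this
  have k0 : ∀ z : ℝ, ε ^ 2 * z ≤ 1 → z ≤ BB γ Pr r K * (ε ^ 2)⁻¹ := fun z hz => by
    have : z ≤ (ε ^ 2)⁻¹ * 1 := by rwa [← div_eq_inv_mul, le_div_iff₀ he2, mul_comm]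
    nlinarith
  have ks : ∀ (a : SA) (t : ℝ), J ((kk ε⁻¹ * a) ^ 2) t ≤ 1 → J (a ^ 2) t ≤ BB γ Pr r K :=
    fun a t hj => by
      rw [smul_J, inv_pow] at hj
      have := J_sq_nonneg a t
      nlinarith
  have ks2 : ∀ (a : SA) (t : ℝ), ε ^ 2 * J ((kk ε⁻¹ * a) ^ 2) t ≤ 1 → J (a ^ 2) t ≤ BB γ Pr r K :=
    fun a t hj => by
      rw [smul_J, inv_pow, ← mul_assoc, mul_inv_cancel₀ he2.ne', one_mul] at hj
      linarith
  have e1 : ∀ b : SA, D1 (kk ε⁻¹ * b) = kk ε⁻¹ * D1 b := fun b => by simp [D1_mul, D1_kk]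
  have e2 : ∀ b : SA, D2 (kk ε⁻¹ * b) = kk ε⁻¹ * D2 b := fun b => by simp [D2_mul, D2_kk]
  refine ⟨{ f := f, p := p, q := q, h := h, R := RR γ Pr ε χ, T := TT γ Pr ε χ
            hB := by linarith
            hc0 := cc_pos hγ hPr
            hc1 := c1
            hε := hε
            hε1 := hε1
            hμ := (one_le_inv₀ hRe).2 hRe1
            hr := hr
            hrB := by linarith
            hrB1 := by linarith
            hσ := c3
            hσB := by rw [abs_of_pos h3]; linarith
            hκ := by rw [hκe]; exact mul_le_mul_of_nonneg_right c4 hμ0.le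
            hκB := by
              rw [hκe, abs_of_pos (by positivity)]
              exact mul_le_mul_of_nonneg_right (by linarith) hμ0.le
            pf := fun t x y => by
              have := S.periodic_φ t (x, y)
              rwa [eφ] at this
            pp := fun t x y => congrArg Prod.fst (pψ t x y)
            pq := fun t x y => congrArg Prod.snd (pψ t x y)
            ph := fun t x y => by
              have := S.periodic_θ t (x, y)
              rwa [eθ] at this
            pR := fun _ _ _ => rfl
            pT := fun _ _ _ => rfl
            D1R := D1_RR _ _ _ _
            D1T := D1_TT _ _ _ _
            DtR := Dt_RR _ _ _ _
            DtT := Dt_TT _ _ _ _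
            vp := vp
            vq := vq
            vh := vh
            vpt := van_dt vp vp0
            vqt := van_dt vq vq0
            vht := van_dt vh vh0
            RT := fun t _ x hx => by
              rw [R_eq hγ hPr hε hε1 hχ hx]
              exact inv_mul_cancel₀ (by have := (bT x hx).1; linarith)
            mass := fun t ht x hx => (EQ t ht x hx).1
            mom1 := fun t ht x hx => (EQ t ht x hx).2.1
            mom2 := fun t ht x hx => (EQ t ht x hx).2.2.1
            ener := fun t ht x hx => (EQ t ht x hx).2.2.2
            bp := fun t ht x hx => ((hc t ht).1.sup hε hε1 hx).trans (by linarith)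
            bq := fun t ht x hx => ((hc t ht).2.1.sup hε hε1 hx).trans (by linarith)
            bf := fun t ht x hx => (bf t ht x hx).trans hε5
            bh := fun t ht x hx => (bh t ht x hx).trans hε5
            bR := fun t _ x hx => by
              obtain ⟨b1, b2⟩ := bR t x hx
              rw [abs_of_nonneg (by linarith)]; linarith
            bT := fun t _ x hx => by
              obtain ⟨b1, b2⟩ := bT x hx
              rw [TT_ap, abs_of_nonneg (by linarith)]; linarith
            bρ := fun t ht x hx => by
              obtain ⟨b1, b2⟩ := bR t x hx
              have b3 := bf t ht x hx
              refine (abs_add_le _ _).trans ?_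
              rw [abs_of_nonneg (a := (RR γ Pr ε χ).1 (t, x)) (by linarith)]
              linarith
            bR' := fun t _ x hx => (bR' t x hx).trans (by rw [← mul_assoc]; gcongr; linarith)
            bT' := fun t _ x hx => (bT' t x hx).trans (by gcongr; linarith)
            lR := fun t _ x hx => by have := (bR t x hx).1; linarith
            lT := fun t _ x hx => by have := (bT x hx).1; rw [TT_ap]; linarith
            lρ := fun t ht x hx => by
              have := (bR t x hx).1
              have := (abs_le.1 (bf t ht x hx)).1
              linarith
            nint := hi.trans (by linarith)
            nf := fun t ht => by
              obtain ⟨_, _, hf, _⟩ := hc t ht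
              refine ⟨ks _ _ ?_, ks2 _ _ ?_, ks2 _ _ ?_⟩
              · rw [← e2]; exact hf.b2
              · rw [← e1, ← e2]; exact hf.b12
              · rw [← e2, ← e2]; exact hf.b22
            np := fun t ht => by
              obtain ⟨hp, hq, _, _⟩ := hc t ht
              exact ⟨hp.b1.trans (by linarith), hp.b2.trans (by linarith),
                hq.b1.trans (by linarith), hq.b2.trans (by linarith)⟩
            npp := fun t ht => by
              obtain ⟨hp, hq, _, _⟩ := hc t ht
              exact ⟨k0 _ hp.b11, k0 _ hp.b12, k0 _ hp.b22⟩
            nqq := fun t ht => by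
              obtain ⟨hp, hq, _, _⟩ := hc t ht
              exact ⟨k0 _ hq.b11, k0 _ hq.b12, k0 _ hq.b22⟩ }, rfl, rfl, rfl, rfl⟩

/-- the final constant -/
def CC (B c0 μ : ℝ) : ℝ :=
  160 * B ^ 2 + (8 / c0 + 2 / c0 ^ 2) * (8 * B * μ + 2 * Sys.C2 B c0 μ + Sys.C1 B c0 μ)

theorem C1_nonneg {B c0 μ : ℝ} (hB : 1 ≤ B) (hc : 0 < c0) : 0 ≤ Sys.C1 B c0 μ := by
  unfold Sys.C1; positivity
theorem C2_nonneg {B c0 μ : ℝ} (hB : 1 ≤ B) (hc : 0 < c0) : 0 ≤ Sys.C2 B c0 μ := by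
  have := C1_nonneg (μ := μ) hB hc
  unfold Sys.C2; positivity

theorem CC_pos {B c0 μ : ℝ} (hB : 1 ≤ B) (hc : 0 < c0) (hμ : 0 < μ) : 0 < CC B c0 μ := by
  have := C1_nonneg (μ := μ) hB hc
  have := C2_nonneg (μ := μ) hB hc
  unfold CC; positivity

theorem concl_i {B c0 r μ ε σ κ τ : ℝ} (S : Sys B c0 r μ ε σ κ τ) (t : ℝ) (ht : t ∈ Set.Icc 0 τ) :
    (∫ s in (0 : ℝ)..t, L2Sq (dt (fun s x => S.f.1 (s, x)) s))
      ≤ CC B c0 μ * ∫ s in (0 : ℝ)..t, (HSq 1 (fun x => ((S.p.1 (s, x), S.q.1 (s, x)) : ℝ × ℝ))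
        + L2Sq (d1 (fun x => S.f.1 (s, x)))) := by
  have hB := S.hB
  have hc := S.hc0
  have hμ := S.hμ
  have h1 := C1_nonneg (μ := μ) hB hc
  have h2 := C2_nonneg (μ := μ) hB hc
  rw [← intervalIntegral.integral_const_mul]
  simp only [dt_sl, sl_d1, L2Sq, dSq0]
  have hcψ := HSq_cont (fun s x => ((S.p.1 (s, x), S.q.1 (s, x)) : ℝ × ℝ)) ((smo S.p).prodMk (smo S.q)) 1
  apply intervalIntegral.integral_mono_on ht.1
  · exact (J_cont _).intervalIntegrable _ _
  · exact ((hcψ.add (J_cont _)).const_mul _).intervalIntegrable _ _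
  · intro s hs
    have hd := S.dtf s ⟨hs.1, hs.2.trans ht.2⟩
    have e : HSq 1 (fun x => ((S.p.1 (s, x), S.q.1 (s, x)) : ℝ × ℝ))
        = dSq 0 (fun x => ((S.p.1 (s, x), S.q.1 (s, x)) : ℝ × ℝ))
          + dSq 1 (fun x => ((S.p.1 (s, x), S.q.1 (s, x)) : ℝ × ℝ)) := by
      simp [HSq, Finset.sum_range_succ]
    have f0 := pairfst S.p S.q s 0
    have s0 := pairsnd S.p S.q s 0
    have f1 := pairfst S.p S.q s 1
    have s1 := pairsnd S.p S.q s 1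
    rw [dSq0] at f0 s0
    have hG : J S.G s = J (D1 S.p ^ 2) s + J (D2 S.p ^ 2) s + J (D1 S.q ^ 2) s + J (D2 S.q ^ 2) s := by
      simp only [Sys.G, J_add]
    have n0 := dSq_nonneg 0 (fun x => ((S.p.1 (s, x), S.q.1 (s, x)) : ℝ × ℝ))
    have n1 := dSq_nonneg 1 (fun x => ((S.p.1 (s, x), S.q.1 (s, x)) : ℝ × ℝ))
    have n2 := J_sq_nonneg (D1 S.f) s
    have hX : J (D1 S.f ^ 2) s + J (S.p ^ 2) s + J (S.q ^ 2) s + J S.G s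
        ≤ 4 * (HSq 1 (fun x => ((S.p.1 (s, x), S.q.1 (s, x)) : ℝ × ℝ)) + J (D1 S.f ^ 2) s) := by
      rw [e, hG]
      linarith [J1_le S.p s, J2_le S.p s, J1_le S.q s, J2_le S.q s]
    have hCC : 160 * B ^ 2 ≤ CC B c0 μ := by
      unfold CC
      have : 0 ≤ (8 / c0 + 2 / c0 ^ 2) * (8 * B * μ + 2 * Sys.C2 B c0 μ + Sys.C1 B c0 μ) := by positivity
      linarith
    calc J (Dt S.f ^ 2) s ≤ _ := hd
      _ ≤ 40 * B ^ 2 * (4 * (HSq 1 (fun x => ((S.p.1 (s, x), S.q.1 (s, x)) : ℝ × ℝ)) + J (D1 S.f ^ 2) s)) :=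
        mul_le_mul_of_nonneg_left hX (by positivity)
      _ = 160 * B ^ 2 * (HSq 1 (fun x => ((S.p.1 (s, x), S.q.1 (s, x)) : ℝ × ℝ)) + J (D1 S.f ^ 2) s) := by ring
      _ ≤ _ := mul_le_mul_of_nonneg_right hCC (by rw [e]; positivity)

set_option maxHeartbeats 1000000 in
theorem concl_ii {B c0 r μ ε σ κ τ : ℝ} (S : Sys B c0 r μ ε σ κ τ) (hM : 880 * B ^ 5 ≤ c0 ^ 4 * μ)
    (hE : 880 * B ^ 5 * ε ≤ c0 ^ 4) (hM2 : 1440 * B ^ 3 ≤ c0 ^ 8 * μ)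
    (t : ℝ) (ht : t ∈ Set.Icc 0 τ) (φ : ℝ → ℝ × ℝ → ℝ) (ψ : ℝ → ℝ × ℝ → ℝ × ℝ) (θ : ℝ → ℝ × ℝ → ℝ)
    (eφ : φ = fun s x => S.f.1 (s, x)) (eψ : ψ = fun s x => (S.p.1 (s, x), S.q.1 (s, x)))
    (eθ : θ = fun s x => S.h.1 (s, x)) :
    A1 ε φ ψ θ t ≤ CC B c0 μ * A1 ε φ ψ θ 0 + CC B c0 μ * (ε ^ 2)⁻¹ * A0 ε φ ψ θ 0
      + CC B c0 μ * (ε ^ 2)⁻¹ * ∫ s in (0 : ℝ)..t, L2Sq (d1 (φ s)) := by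
  have hB := S.hB
  have hc := S.hc0
  have hμ := S.hμ
  have hε := S.hε
  have hk : 0 < (ε ^ 2)⁻¹ := by positivity
  have h1 := C1_nonneg (μ := μ) hB hc
  have h2 := C2_nonneg (μ := μ) hB hc
  have sψ : ContDiff ℝ (⊤ : ℕ∞) (Function.uncurry ψ) := by rw [eψ]; exact (smo S.p).prodMk (smo S.q)
  have sφ : ContDiff ℝ (⊤ : ℕ∞) (Function.uncurry φ) := by rw [eφ]; exact smo S.f
  have sθ : ContDiff ℝ (⊤ : ℕ∞) (Function.uncurry θ) := by rw [eθ]; exact smo S.h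
  have hφs : ∀ s, φ s = fun x => S.f.1 (s, x) := fun s => by rw [eφ]
  have hψs : ∀ s, ψ s = fun x => (S.p.1 (s, x), S.q.1 (s, x)) := fun s => by rw [eψ]
  have hθs : ∀ s, θ s = fun x => S.h.1 (s, x) := fun s => by rw [eθ]
  have h00 : (0 : ℝ) ∈ Set.Icc (0 : ℝ) 0 := ⟨le_rfl, le_rfl⟩
  -- initial values
  have a1 : dSq 1 (ψ 0) + (ε ^ 2)⁻¹ * dSq 1 (θ 0) ≤ A1 ε φ ψ θ 0 := by
    unfold A1
    rw [intervalIntegral.integral_same, add_zero]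
    exact le_sup_of (g := fun s => dSq 1 (ψ s) + (ε ^ 2)⁻¹ * dSq 1 (θ s))
      ((dSq_cont ψ sψ 1).add ((dSq_cont θ sθ 1).const_mul _)) h00
  have a0 : L2Sq (ψ 0) + (ε ^ 2)⁻¹ * L2Sq (φ 0) + (ε ^ 2)⁻¹ * L2Sq (θ 0) ≤ A0 ε φ ψ θ 0 := by
    unfold A0
    rw [intervalIntegral.integral_same, add_zero]
    exact le_sup_of (g := fun s => L2Sq (ψ s) + (ε ^ 2)⁻¹ * L2Sq (φ s) + (ε ^ 2)⁻¹ * L2Sq (θ s))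
      (((dSq_cont ψ sψ 0).add ((dSq_cont φ sφ 0).const_mul _)).add ((dSq_cont θ sθ 0).const_mul _)) h00
  have n1 := dSq_nonneg 1 (ψ 0)
  have n2 : 0 ≤ (ε ^ 2)⁻¹ * dSq 1 (θ 0) := mul_nonneg hk.le (dSq_nonneg 1 (θ 0))
  have m1 : 0 ≤ L2Sq (ψ 0) := dSq_nonneg 0 (ψ 0)
  have m2 : 0 ≤ (ε ^ 2)⁻¹ * L2Sq (φ 0) := mul_nonneg hk.le (dSq_nonneg 0 (φ 0))
  have m3 : 0 ≤ (ε ^ 2)⁻¹ * L2Sq (θ 0) := mul_nonneg hk.le (dSq_nonneg 0 (θ 0))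
  have hV0 : J S.V 0 ≤ 4 * A1 ε φ ψ θ 0 := by
    rw [Sys.Ez]
    have f1 := pairfst S.p S.q 0 1
    have s1 := pairsnd S.p S.q 0 1
    rw [hψs, hθs] at a1
    rw [hψs] at n1
    rw [hθs] at n2
    have k1 := mul_le_mul_of_nonneg_left (J1_le S.h 0) hk.le
    have k2 := mul_le_mul_of_nonneg_left (J2_le S.h 0) hk.le
    linarith [J1_le S.p 0, J2_le S.p 0, J1_le S.q 0, J2_le S.q 0]
  have hm0 : S.mm 0 ≤ 2 * A0 ε φ ψ θ 0 := by
    unfold Sys.mm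
    have f0 := pairfst S.p S.q 0 0
    have s0 := pairsnd S.p S.q 0 0
    rw [dSq0] at f0 s0
    rw [hψs, hφs, hθs] at a0
    rw [hψs] at m1
    rw [hφs] at m2
    rw [hθs] at m3
    simp only [L2Sq, dSq0] at a0 m1 m2 m3
    linarith
  have A1p : 0 ≤ A1 ε φ ψ θ 0 := by linarith
  have A0p : 0 ≤ A0 ε φ ψ θ 0 := by linarith
  set I := ∫ s in (0 : ℝ)..t, J (D1 S.f ^ 2) s with hI
  have hI' : ∫ s in (0 : ℝ)..t, L2Sq (d1 (φ s)) = I := by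
    rw [hI]
    congr 1
    funext s
    rw [hφs, sl_d1, L2Sq, dSq0]
  have hI0 : 0 ≤ I := intervalIntegral.integral_nonneg ht.1 fun s _ => J_sq_nonneg _ s
  set W := 8 * B * μ * A1 ε φ ψ θ 0 + 2 * Sys.C2 B c0 μ * ((ε ^ 2)⁻¹ * A0 ε φ ψ θ 0)
    + Sys.C1 B c0 μ * ((ε ^ 2)⁻¹ * I) with hW
  have hkA : 0 ≤ (ε ^ 2)⁻¹ * A0 ε φ ψ θ 0 := mul_nonneg hk.le A0p
  have hkI : 0 ≤ (ε ^ 2)⁻¹ * I := mul_nonneg hk.le hI0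
  have hW0 : 0 ≤ W := by positivity
  have main : ∀ s ∈ Set.Icc (0 : ℝ) t, c0 / 4 * J S.V s + c0 ^ 2 / 2 * ∫ u in (0 : ℝ)..s, J S.YY u ≤ W := by
    intro s hs
    have h := S.first hM hE hM2 s ⟨hs.1, hs.2.trans ht.2⟩
    have hIs : ∫ u in (0 : ℝ)..s, J (D1 S.f ^ 2) u ≤ I := by
      rw [hI, ← intervalIntegral.integral_add_adjacent_intervals
        ((J_cont _).intervalIntegrable 0 s) ((J_cont _).intervalIntegrable s t)]
      linarith [intervalIntegral.integral_nonneg (μ := volume) hs.2 fun u (_ : u ∈ Set.Icc s t) =>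
        J_sq_nonneg (D1 S.f) u]
    have e1 : 2 * B * μ * J S.V 0 ≤ 2 * B * μ * (4 * A1 ε φ ψ θ 0) :=
      mul_le_mul_of_nonneg_left hV0 (by positivity)
    have e2 : Sys.C2 B c0 μ * (ε ^ 2)⁻¹ * S.mm 0 ≤ Sys.C2 B c0 μ * (ε ^ 2)⁻¹ * (2 * A0 ε φ ψ θ 0) :=
      mul_le_mul_of_nonneg_left hm0 (by positivity)
    have e3 : Sys.C1 B c0 μ * (ε ^ 2)⁻¹ * (∫ u in (0 : ℝ)..s, J (D1 S.f ^ 2) u)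
        ≤ Sys.C1 B c0 μ * (ε ^ 2)⁻¹ * I := mul_le_mul_of_nonneg_left hIs (by positivity)
    rw [hW]
    linarith
  have YYn : ∀ s, 0 ≤ J S.YY s := fun s => by
    simp only [Sys.YY, J_add, J_kk]
    have := J_sq_nonneg (Dt S.p) s
    have := J_sq_nonneg (Dt S.q) s
    have := J_sq_nonneg (Dt S.h) s
    positivity
  have hsup : (⨆ s ∈ Set.Icc (0 : ℝ) t, (dSq 1 (ψ s) + (ε ^ 2)⁻¹ * dSq 1 (θ s))) ≤ 8 / c0 * W := by
    apply sup_le_of (by positivity)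
    intro s hs
    have hm := main s hs
    have hy : 0 ≤ ∫ u in (0 : ℝ)..s, J S.YY u := intervalIntegral.integral_nonneg hs.1 fun u _ => YYn u
    have hy' : 0 ≤ c0 ^ 2 / 2 * ∫ u in (0 : ℝ)..s, J S.YY u := by positivity
    have hv : dSq 1 (ψ s) + (ε ^ 2)⁻¹ * dSq 1 (θ s) ≤ 2 * J S.V s := by
      rw [Sys.Ez, hψs, hθs]
      have k1 := mul_le_mul_of_nonneg_left (dSq1_le S.h s) hk.le
      linarith [pair1 S.p S.q s]
    have : J S.V s ≤ 4 / c0 * W := by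
      rw [div_mul_eq_mul_div, le_div_iff₀ hc]
      linarith
    calc _ ≤ 2 * J S.V s := hv
      _ ≤ 2 * (4 / c0 * W) := by linarith
      _ = _ := by ring
  have hintg : ∫ s in (0 : ℝ)..t, (L2Sq (dt ψ s) + (ε ^ 2)⁻¹ * L2Sq (dt θ s)) ≤ 2 / c0 ^ 2 * W := by
    have hle : ∫ s in (0 : ℝ)..t, (L2Sq (dt ψ s) + (ε ^ 2)⁻¹ * L2Sq (dt θ s))
        ≤ ∫ s in (0 : ℝ)..t, J S.YY s := by
      apply intervalIntegral.integral_mono_on ht.1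
      · exact ((dSq_cont _ (dt_smooth ψ sψ) 0).add
          ((dSq_cont _ (dt_smooth θ sθ) 0).const_mul _)).intervalIntegrable _ _
      · exact (J_cont _).intervalIntegrable _ _
      · intro s _
        rw [eψ, eθ, dt_pair, dt_sl]
        simp only [Sys.YY, J_add, J_kk, L2Sq, dSq0]
        linarith [pair0 (Dt S.p) (Dt S.q) s]
    have hm := main t ⟨ht.1, le_rfl⟩
    have hv : 0 ≤ c0 / 4 * J S.V t := mul_nonneg (by positivity) (S.V_nonneg t)
    refine hle.trans ?_
    rw [div_mul_eq_mul_div, le_div_iff₀ (by positivity)]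
    linarith
  have hA : A1 ε φ ψ θ t ≤ (8 / c0 + 2 / c0 ^ 2) * W := by
    unfold A1
    linarith
  rw [hI']
  set D := 8 / c0 + 2 / c0 ^ 2 with hD
  have hD0 : 0 ≤ D := by positivity
  have t1 : D * (8 * B * μ) ≤ CC B c0 μ := by
    unfold CC
    rw [← hD]
    have : 0 ≤ D * (2 * Sys.C2 B c0 μ + Sys.C1 B c0 μ) := by positivity
    linarith [sq_nonneg B]
  have t2 : D * (2 * Sys.C2 B c0 μ) ≤ CC B c0 μ := by
    unfold CC
    rw [← hD]
    have : 0 ≤ D * (8 * B * μ + Sys.C1 B c0 μ) := by positivity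
    linarith [sq_nonneg B]
  have t3 : D * Sys.C1 B c0 μ ≤ CC B c0 μ := by
    unfold CC
    rw [← hD]
    have : 0 ≤ D * (8 * B * μ + 2 * Sys.C2 B c0 μ) := by positivity
    linarith [sq_nonneg B]
  have u1 := mul_le_mul_of_nonneg_right t1 A1p
  have u2 := mul_le_mul_of_nonneg_right t2 hkA
  have u3 := mul_le_mul_of_nonneg_right t3 hkI
  calc A1 ε φ ψ θ t ≤ D * W := hA
    _ = D * (8 * B * μ) * A1 ε φ ψ θ 0 + D * (2 * Sys.C2 B c0 μ) * ((ε ^ 2)⁻¹ * A0 ε φ ψ θ 0)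
        + D * Sys.C1 B c0 μ * ((ε ^ 2)⁻¹ * I) := by rw [hW]; ring
    _ ≤ _ := by linarith

/-- first-order estimates: `∂tφ` in `L²ₜL²ₓ` and the bound on `A₁`. -/
theorem first_order_estimates (γ Pr r Kχ : ℝ)
    (hγ : 1 < γ) (hPr : 0 < Pr) (hr : 0 < 1 + r) (hK : 0 < Kχ) :
    ∃ Re₀ ε₁ : ℝ, 0 < Re₀ ∧ 0 < ε₁ ∧
      ∀ Re : ℝ, 0 < Re → Re < Re₀ →
        ∃ C : ℝ, 0 < C ∧
          ∀ (ε χ T : ℝ) (S : PerturbSol γ Pr r Re ε χ T),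
            0 < ε → ε ≤ 1 → ε < ε₁ → 0 < χ → |1 - χ| ≤ Kχ * ε → |1 - χ| ≤ 1 / 2 →
            0 ≤ T → SmoothSol S → StdHyp S → Nfun ε S.φ S.ψ S.θ T ≤ 1 →
            ∀ t ∈ Set.Icc (0 : ℝ) T,
              (∫ s in (0 : ℝ)..t, L2Sq (dt S.φ s))
                  ≤ C * ∫ s in (0 : ℝ)..t, (HSq 1 (S.ψ s) + L2Sq (d1 (S.φ s))) ∧
              A1 ε S.φ S.ψ S.θ t
                  ≤ C * A1 ε S.φ S.ψ S.θ 0 + C * (ε ^ 2)⁻¹ * A0 ε S.φ S.ψ S.θ 0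
                    + C * (ε ^ 2)⁻¹ * ∫ s in (0 : ℝ)..t, L2Sq (d1 (S.φ s)) := by
  have hb := bb_pos hγ hPr
  have hB7 := BB_ge (r := r) hγ hPr hK
  have hc := cc_pos hγ hPr
  set B := BB γ Pr r Kχ with hBd
  set c0 := cc γ Pr with hcd
  have hB0 : 0 < B := by linarith
  refine ⟨min 1 (min (c0 ^ 4 / (880 * B ^ 5)) (c0 ^ 8 / (1440 * B ^ 3))),
    min ((3 / 2 + bb γ Pr)⁻¹ / 10) (c0 ^ 4 / (880 * B ^ 5)),
    lt_min one_pos (lt_min (by positivity) (by positivity)),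
    lt_min (by positivity) (by positivity), fun Re hRe hRe0 => ?_⟩
  have hRe1 : Re ≤ 1 := (hRe0.trans_le (min_le_left _ _)).le
  have hM : 880 * B ^ 5 ≤ c0 ^ 4 * Re⁻¹ := by
    have h : Re < c0 ^ 4 / (880 * B ^ 5) :=
      hRe0.trans_le ((min_le_right _ _).trans (min_le_left _ _))
    rw [lt_div_iff₀ (by positivity)] at h
    rw [← div_eq_mul_inv, le_div_iff₀ hRe]
    linarith
  have hM2 : 1440 * B ^ 3 ≤ c0 ^ 8 * Re⁻¹ := by
    have h : Re < c0 ^ 8 / (1440 * B ^ 3) :=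
      hRe0.trans_le ((min_le_right _ _).trans (min_le_right _ _))
    rw [lt_div_iff₀ (by positivity)] at h
    rw [← div_eq_mul_inv, le_div_iff₀ hRe]
    linarith
  refine ⟨CC B c0 Re⁻¹, CC_pos (by linarith) hc (by positivity), ?_⟩
  intro ε χ T S hε hε1 hεs _ hχK hχ hT hsm hstd hN t ht
  have hE : 880 * B ^ 5 * ε ≤ c0 ^ 4 := by
    have h : ε < c0 ^ 4 / (880 * B ^ 5) := hεs.trans_le (min_le_right _ _)
    rw [lt_div_iff₀ (by positivity)] at h
    linarith
  obtain ⟨sφ, sψ, sθ⟩ := hsm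
  have eφ : S.φ = fun s x => (⟨Function.uncurry S.φ, sφ⟩ : SA).1 (s, x) := rfl
  have eψ : S.ψ = fun s x => ((⟨fun z => (Function.uncurry S.ψ z).1, sψ.fst⟩ : SA).1 (s, x),
    (⟨fun z => (Function.uncurry S.ψ z).2, sψ.snd⟩ : SA).1 (s, x)) := rfl
  have eθ : S.θ = fun s x => (⟨Function.uncurry S.θ, sθ⟩ : SA).1 (s, x) := rfl
  obtain ⟨Y, yf, yp, yq, yh⟩ := mkSys S _ _ _ _ eφ eψ eθ hγ hPr hr hK hRe hRe1 hε hε1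
    (hεs.trans_le (min_le_left _ _)).le hχK hχ hT hstd hN
  rw [← yf] at eφ
  rw [← yp, ← yq] at eψ
  rw [← yh] at eθ
  refine ⟨?_, concl_ii Y hM hE hM2 t ht S.φ S.ψ S.θ eφ eψ eθ⟩
  rw [eφ, eψ]
  exact concl_i Y t ht
end Couette
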